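/- Fix a ∈ [−1,1], μ > 0 and γ > 1. There exist constants δ > 0 and C > 0, independent of T, of the initial data and of τ, such that for every τ ∈ (0, min{1, μ²}) and every solution (v, u, S) of the relaxed system on [0,T] × ℝ with (v − 1, u, S) ∈ C⁰([0,T]; H²(ℝ)) ∩ C¹([0,T]; H¹(ℝ)), v > 0 and 2τaS + μ > 0: if E(T) < δ, then for all t ∈ (0, T), E(t) + ∫₀ᵗ D(s) ds ≤ C (E₀ + E(t)^{1/2} ∫₀ᵗ D(s) ds). -/

import Mathlib

open MeasureTheory Filter Set intervalIntegral

noncomputable section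

/-- Squared `H^k(ℝ)` norm: sum of the squared `L²` norms of the derivatives up to order `k`. -/
def HSq (k : ℕ) (f : ℝ → ℝ) : ℝ :=
  ∑ j ∈ Finset.range (k + 1), ∫ x : ℝ, (iteratedDeriv j f x) ^ 2

/-- Classical membership in `H^k(ℝ)`. -/
def MemH (k : ℕ) (f : ℝ → ℝ) : Prop :=
  ContDiff ℝ k f ∧ ∀ j ≤ k, Integrable fun x => (iteratedDeriv j f x) ^ 2

/-- Partial derivative in time. -/
def pt (f : ℝ → ℝ → ℝ) (t x : ℝ) : ℝ := deriv (fun s => f s x) t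

/-- Partial derivative in space. -/
def px (f : ℝ → ℝ → ℝ) (t x : ℝ) : ℝ := deriv (f t) x

/-- Continuity of `t ↦ f t` as an `H^k`-valued map on `I`. -/
def ContH (k : ℕ) (I : Set ℝ) (f : ℝ → ℝ → ℝ) : Prop :=
  ∀ s ∈ I, Tendsto (fun t => HSq k fun x => f t x - f s x) (nhdsWithin s I) (nhds 0)

/-- `f ∈ C⁰(I; H^k) ∩ C¹(I; H^(k-1))`. -/
def RegH (k : ℕ) (I : Set ℝ) (f : ℝ → ℝ → ℝ) : Prop :=
  (∀ t ∈ I, MemH k (f t)) ∧ ContH k I f ∧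
  (∀ x, ∀ t ∈ I, DifferentiableAt ℝ (fun s => f s x) t) ∧
  (∀ t ∈ I, MemH (k - 1) fun x => pt f t x) ∧ ContH (k - 1) I fun t x => pt f t x

/-- The 1-d isentropic compressible Navier–Stokes system with Oldroyd-type constitutive
law, in Lagrangian coordinates, at a point `(t, x)`:
`v_t = u_x`, `u_t + (v^(-γ))_x = S_x`, `τ (S_t - (2 a S / v) u_x) + S = μ u_x / v`. -/
def RelaxedSystem (a μ γ τ : ℝ) (v u S : ℝ → ℝ → ℝ) (t x : ℝ) : Prop :=
  pt v t x = px u t x ∧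
  pt u t x + deriv (fun y => v t y ^ (-γ)) x = px S t x ∧
  τ * (pt S t x - 2 * a * S t x / v t x * px u t x) + S t x = μ * px u t x / v t x

/-- The energy functional `E(t)`. -/
def En (τ : ℝ) (v u S : ℝ → ℝ → ℝ) (t : ℝ) : ℝ :=
  sSup ((fun s => HSq 2 (fun x => v s x - 1) + HSq 2 (u s) + τ * HSq 2 (S s)) '' Icc 0 t)

/-- The dissipation functional `D(t)`. -/
def Dn (v u S : ℝ → ℝ → ℝ) (t : ℝ) : ℝ :=
  HSq 1 (fun x => px v t x) + HSq 1 (fun x => px u t x) + HSq 2 (S t)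

/-- A solution of the relaxed system on `[0,T] × ℝ` in the class
`C⁰([0,T]; H²) ∩ C¹([0,T]; H¹)` with `v > 0` and `2τaS + μ > 0`. -/
def IsSolOn (a μ γ τ T : ℝ) (v u S : ℝ → ℝ → ℝ) : Prop :=
  (∀ t ∈ Icc (0 : ℝ) T, ∀ x : ℝ,
      0 < v t x ∧ 0 < 2 * τ * a * S t x + μ ∧ RelaxedSystem a μ γ τ v u S t x) ∧
  RegH 2 (Icc 0 T) (fun t x => v t x - 1) ∧ RegH 2 (Icc 0 T) u ∧ RegH 2 (Icc 0 T) S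

/-- Squared `L²(ℝ)` norm. -/
def n2 (f : ℝ → ℝ) : ℝ := ∫ x, f x ^ 2

/-- Continuous square-integrable functions. -/
structure L2C (f : ℝ → ℝ) : Prop where
  cont : Continuous f
  int : Integrable fun x => f x ^ 2

/-- Difference quotient. -/
def dq (h : ℝ) (f : ℝ → ℝ) (x : ℝ) : ℝ := (f (x + h) - f x) / h

lemma n2_nonneg (f : ℝ → ℝ) : 0 ≤ n2 f := integral_nonneg fun _ => sq_nonneg _

lemma integrable_of_cont_le {f g : ℝ → ℝ} (hf : Continuous f) (hg : Integrable g)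
    (h : ∀ x, |f x| ≤ g x) : Integrable f :=
  hg.mono' hf.aestronglyMeasurable (Eventually.of_forall h)

lemma L2C.mul_int {f g : ℝ → ℝ} (hf : L2C f) (hg : L2C g) :
    Integrable fun x => f x * g x := by
  refine integrable_of_cont_le (hf.cont.mul hg.cont) (hf.int.add hg.int) fun x => ?_
  simp only [Pi.add_apply]
  rw [abs_le]
  constructor <;> nlinarith [sq_nonneg (f x + g x), sq_nonneg (f x - g x), sq_nonneg (f x),
    sq_nonneg (g x)]

lemma L2C.of_sq_le {f g : ℝ → ℝ} (hf : Continuous f) (hg : Integrable g)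
    (h : ∀ x, f x ^ 2 ≤ g x) : L2C f :=
  ⟨hf, integrable_of_cont_le (hf.pow 2) hg fun x => by rw [abs_of_nonneg (sq_nonneg _)]; exact h x⟩

lemma L2C.const_mul {f : ℝ → ℝ} (hf : L2C f) (c : ℝ) : L2C fun x => c * f x :=
  ⟨continuous_const.mul hf.cont, by simpa only [mul_pow] using hf.int.const_mul (c ^ 2)⟩

lemma n2_const_mul (f : ℝ → ℝ) (c : ℝ) : n2 (fun x => c * f x) = c ^ 2 * n2 f := by
  simp only [n2, mul_pow, MeasureTheory.integral_const_mul]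

lemma L2C.add {f g : ℝ → ℝ} (hf : L2C f) (hg : L2C g) : L2C fun x => f x + g x :=
  L2C.of_sq_le (hf.cont.add hg.cont) ((hf.int.const_mul 2).add (hg.int.const_mul 2)) fun x => by
    simp only [Pi.add_apply]; nlinarith [sq_nonneg (f x - g x)]

lemma L2C.sub {f g : ℝ → ℝ} (hf : L2C f) (hg : L2C g) : L2C fun x => f x - g x := by
  simpa [sub_eq_add_neg] using hf.add (hg.const_mul (-1))

lemma L2C.shift {f : ℝ → ℝ} (hf : L2C f) (h : ℝ) : L2C fun x => f (x + h) :=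
  ⟨hf.cont.comp (by fun_prop), hf.int.comp_add_right h⟩

lemma L2C.bdd_mul {f b : ℝ → ℝ} {M : ℝ} (hf : L2C f) (hb : Continuous b)
    (hM : ∀ x, |b x| ≤ M) : L2C fun x => b x * f x := by
  refine L2C.of_sq_le (hb.mul hf.cont) (hf.int.const_mul (M ^ 2)) fun x => ?_
  rw [mul_pow]
  exact mul_le_mul_of_nonneg_right (sq_le_sq' (abs_le.1 (hM x)).1 (abs_le.1 (hM x)).2)
    (sq_nonneg _)

lemma n2_shift (f : ℝ → ℝ) (h : ℝ) : n2 (fun x => f (x + h)) = n2 f :=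
  integral_add_right_eq_self (fun x => f x ^ 2) h

lemma n2_le_of_sq_le {f g : ℝ → ℝ} (hf : L2C f) (hg : Integrable g)
    (h : ∀ x, f x ^ 2 ≤ g x) : n2 f ≤ ∫ x, g x := integral_mono hf.int hg h

lemma n2_sub_le {f g : ℝ → ℝ} (hf : L2C f) (hg : L2C g) :
    n2 (fun x => f x - g x) ≤ 2 * n2 f + 2 * n2 g := by
  have := n2_le_of_sq_le (hf.sub hg) ((hf.int.const_mul 2).add (hg.int.const_mul 2)) fun x => by
    simp only [Pi.add_apply]; nlinarith [sq_nonneg (f x + g x)]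
  rwa [integral_add' (hf.int.const_mul 2) (hg.int.const_mul 2), MeasureTheory.integral_const_mul,
    MeasureTheory.integral_const_mul] at this

lemma cauchy_schwarz {f g : ℝ → ℝ} (hf : L2C f) (hg : L2C g) :
    |∫ x, f x * g x| ≤ √(n2 f) * √(n2 g) := by
  rw [← Real.sqrt_mul (n2_nonneg f)]
  apply Real.abs_le_sqrt
  have key : ∀ c : ℝ, 0 ≤ n2 f * (c * c) + (2 * ∫ x, f x * g x) * c + n2 g := fun c => by
    have h1 : n2 (fun x => c * f x + g x) = n2 f * (c * c) + (2 * ∫ x, f x * g x) * c + n2 g := by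
      have : ∀ x, (c * f x + g x) ^ 2 = c * c * f x ^ 2 + (2 * c) * (f x * g x) + g x ^ 2 :=
        fun x => by ring
      simp only [n2, this]
      have i1 : Integrable fun x => c * c * f x ^ 2 + 2 * c * (f x * g x) :=
        (hf.int.const_mul _).add ((hf.mul_int hg).const_mul _)
      rw [integral_add i1 hg.int,
        integral_add (hf.int.const_mul _) ((hf.mul_int hg).const_mul _),
        MeasureTheory.integral_const_mul,
        MeasureTheory.integral_const_mul]
      ring
    rw [← h1]; exact n2_nonneg _
  have := discrim_le_zero key
  unfold discrim at this
  nlinarith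

/-- Minkowski-type bound for averages of `L²` functions. -/
lemma L2C.average {w : ℝ → ℝ → ℝ} {B : ℝ} (hw : Continuous (Function.uncurry w))
    (hB : ∀ θ, L2C (w θ) ∧ n2 (w θ) ≤ B) :
    L2C (fun x => ∫ θ in (0:ℝ)..1, w θ x) ∧ n2 (fun x => ∫ θ in (0:ℝ)..1, w θ x) ≤ B := by
  have hB0 : 0 ≤ B := (n2_nonneg _).trans (hB 0).2
  have hw' : Continuous (Function.uncurry fun x θ => w θ x) :=
    hw.comp continuous_swap
  have hc : Continuous (fun x => ∫ θ in (0:ℝ)..1, w θ x) :=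
    intervalIntegral.continuous_parametric_intervalIntegral_of_continuous' hw' 0 1
  have hwx : ∀ x, Continuous fun θ => w θ x := fun x =>
    hw.comp (by fun_prop : Continuous fun θ : ℝ => (θ, x))
  have jensen : ∀ x, (∫ θ in (0:ℝ)..1, w θ x) ^ 2 ≤ ∫ θ in (0:ℝ)..1, w θ x ^ 2 := fun x => by
    set c := ∫ θ in (0:ℝ)..1, w θ x with hcdef
    have h0 : 0 ≤ ∫ θ in (0:ℝ)..1, (w θ x - c) ^ 2 :=
      intervalIntegral.integral_nonneg (by norm_num) fun _ _ => sq_nonneg _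
    have e : ∀ θ, (w θ x - c) ^ 2 = w θ x ^ 2 - (2 * c) * w θ x + c ^ 2 := fun θ => by ring
    simp only [e] at h0
    rw [intervalIntegral.integral_add, intervalIntegral.integral_sub,
      intervalIntegral.integral_const_mul, intervalIntegral.integral_const, ← hcdef] at h0
    · simp at h0; nlinarith
    · exact ((hwx x).pow 2).intervalIntegrable _ _
    · exact (continuous_const.mul (hwx x)).intervalIntegrable _ _
    · exact (((hwx x).pow 2).sub (continuous_const.mul (hwx x))).intervalIntegrable _ _
    · exact continuous_const.intervalIntegrable _ _
  have hlin : ∫⁻ x, ENNReal.ofReal ((∫ θ in (0:ℝ)..1, w θ x) ^ 2) ≤ ENNReal.ofReal B := by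
    calc ∫⁻ x, ENNReal.ofReal ((∫ θ in (0:ℝ)..1, w θ x) ^ 2)
        ≤ ∫⁻ x, ∫⁻ θ in Ioc (0:ℝ) 1, ENNReal.ofReal (w θ x ^ 2) := by
          refine lintegral_mono fun x => ?_
          rw [← ofReal_integral_eq_lintegral_ofReal, ← intervalIntegral.integral_of_le zero_le_one]
          · exact ENNReal.ofReal_le_ofReal (jensen x)
          · exact ((hwx x).pow 2).integrableOn_Ioc
          · exact Eventually.of_forall fun _ => sq_nonneg _
      _ = ∫⁻ θ in Ioc (0:ℝ) 1, ∫⁻ x, ENNReal.ofReal (w θ x ^ 2) := by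
          refine lintegral_lintegral_swap ?_
          exact (ENNReal.continuous_ofReal.comp (hw'.pow 2)).measurable.aemeasurable
      _ ≤ ∫⁻ θ in Ioc (0:ℝ) 1, ENNReal.ofReal B := by
          refine lintegral_mono fun θ => ?_
          rw [← ofReal_integral_eq_lintegral_ofReal (hB θ).1.int
            (Eventually.of_forall fun _ => sq_nonneg _)]
          exact ENNReal.ofReal_le_ofReal (hB θ).2
      _ = ENNReal.ofReal B := by simp
  have hint : Integrable fun x => (∫ θ in (0:ℝ)..1, w θ x) ^ 2 := by
    refine ⟨(hc.pow 2).aestronglyMeasurable, ?_⟩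
    rw [hasFiniteIntegral_iff_ofReal (Eventually.of_forall fun _ => sq_nonneg _)]
    exact hlin.trans_lt ENNReal.ofReal_lt_top
  refine ⟨⟨hc, hint⟩, ?_⟩
  rw [← ofReal_integral_eq_lintegral_ofReal hint (Eventually.of_forall fun _ => sq_nonneg _)]
    at hlin
  exact (ENNReal.ofReal_le_ofReal_iff hB0).1 hlin

lemma L2C.dq {f : ℝ → ℝ} (hf : L2C f) (h : ℝ) : L2C (dq h f) := by
  have := ((hf.shift h).sub hf).const_mul h⁻¹
  convert this using 2
  simp only [_root_.dq]; ring

lemma dq_eq_average {f f1 : ℝ → ℝ} (hd : ∀ x, HasDerivAt f (f1 x) x) (hc : Continuous f1)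
    {h : ℝ} (hh : h ≠ 0) (x : ℝ) : dq h f x = ∫ θ in (0:ℝ)..1, f1 (x + h * θ) := by
  rw [intervalIntegral.integral_comp_add_mul _ hh,
    intervalIntegral.integral_eq_sub_of_hasDerivAt (fun y _ => hd y) (hc.intervalIntegrable _ _)]
  simp [_root_.dq]; ring

lemma n2_dq_le {f f1 : ℝ → ℝ} (hd : ∀ x, HasDerivAt f (f1 x) x) (hf1 : L2C f1) (h : ℝ) :
    n2 (dq h f) ≤ n2 f1 := by
  rcases eq_or_ne h 0 with rfl | hh
  · have : n2 (dq 0 f) = 0 := by simp [n2, dq]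
    rw [this]; exact n2_nonneg _
  · have e : dq h f = fun x => ∫ θ in (0:ℝ)..1, f1 (x + h * θ) :=
      funext (dq_eq_average hd hf1.cont hh)
    rw [e]
    refine (L2C.average (w := fun θ x => f1 (x + h * θ)) ?_ fun θ => ⟨hf1.shift _, ?_⟩).2
    · exact hf1.cont.comp (by fun_prop)
    · exact (n2_shift f1 (h * θ)).le

lemma n2_translate_sub_le {f f1 : ℝ → ℝ} (hd : ∀ x, HasDerivAt f (f1 x) x) (hf1 : L2C f1)
    (h : ℝ) : n2 (fun x => f (x + h) - f x) ≤ h ^ 2 * n2 f1 := by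
  rcases eq_or_ne h 0 with rfl | hh
  · simp [n2]
  · have e : (fun x => f (x + h) - f x) = fun x => h * dq h f x := by
      funext x; simp only [dq]; field_simp
    rw [e, n2_const_mul]
    exact mul_le_mul_of_nonneg_left (n2_dq_le hd hf1 h) (sq_nonneg _)

lemma n2_dq_sub_deriv_le {f f1 f2 : ℝ → ℝ} (hd : ∀ x, HasDerivAt f (f1 x) x)
    (hd1 : ∀ x, HasDerivAt f1 (f2 x) x) (hf1 : L2C f1) (hf2 : L2C f2) {h : ℝ} (hh : h ≠ 0) :
    n2 (fun x => dq h f x - f1 x) ≤ h ^ 2 * n2 f2 := by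
  have e : (fun x => dq h f x - f1 x)
      = fun x => ∫ θ in (0:ℝ)..1, (f1 (x + h * max 0 (min 1 θ)) - f1 x) := by
    funext x
    have : ∫ θ in (0:ℝ)..1, (f1 (x + h * max 0 (min 1 θ)) - f1 x)
        = ∫ θ in (0:ℝ)..1, (f1 (x + h * θ) - f1 x) := by
      refine intervalIntegral.integral_congr fun θ hθ => ?_
      rw [uIcc_of_le zero_le_one] at hθ
      simp only [min_eq_right hθ.2, max_eq_right hθ.1]
    rw [this, intervalIntegral.integral_sub, ← dq_eq_average hd hf1.cont hh]
    · simp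
    · exact (hf1.cont.comp (by fun_prop)).intervalIntegrable _ _
    · exact continuous_const.intervalIntegrable _ _
  rw [e]
  refine (L2C.average (w := fun θ x => f1 (x + h * max 0 (min 1 θ)) - f1 x) ?_
    fun θ => ⟨(hf1.shift _).sub hf1, ?_⟩).2
  · exact (hf1.cont.comp (by fun_prop)).sub (hf1.cont.comp continuous_snd)
  · refine (n2_translate_sub_le hd1 hf2 _).trans
      (mul_le_mul_of_nonneg_right ?_ (n2_nonneg _))
    rw [mul_pow]
    have h0 : 0 ≤ max 0 (min 1 θ) := le_max_left _ _
    have h1 : max 0 (min 1 θ) ≤ 1 := max_le zero_le_one (min_le_left _ _)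
    have : max 0 (min 1 θ) ^ 2 ≤ 1 := pow_le_one₀ h0 h1
    nlinarith [sq_nonneg h]

lemma dq_mem {f f1 : ℝ → ℝ} (hd : ∀ x, HasDerivAt f (f1 x) x) {h : ℝ} (hh : 0 < h) (x : ℝ) :
    ∃ ξ ∈ Ioo x (x + h), dq h f x = f1 ξ := by
  obtain ⟨ξ, hξ, e⟩ := exists_hasDerivAt_eq_slope f f1 (lt_add_of_pos_right x hh)
    (fun y _ => (hd y).continuousAt.continuousWithinAt) fun y _ => hd y
  exact ⟨ξ, hξ, by rw [e, dq]; congr 1; ring⟩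

lemma abs_dq_le {f f1 : ℝ → ℝ} (hd : ∀ x, HasDerivAt f (f1 x) x) {h M : ℝ} (hh : 0 < h)
    (hM : ∀ x, |f1 x| ≤ M) (x : ℝ) : |dq h f x| ≤ M := by
  obtain ⟨ξ, -, e⟩ := dq_mem hd hh x
  rw [e]; exact hM ξ

lemma HasDerivAt.dq {f f1 : ℝ → ℝ} (hd : ∀ x, HasDerivAt f (f1 x) x) (h x : ℝ) :
    HasDerivAt (dq h f) (_root_.dq h f1 x) x :=
  (((hd (x + h)).comp_add_const x h).sub (hd x)).div_const h

lemma tendsto_n2_of_le {g : ℝ → ℝ → ℝ} {g0 : ℝ → ℝ} {l : Filter ℝ} [l.IsCountablyGenerated]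
    [l.NeBot] (hg : ∀ h, L2C (g h)) (hg0 : L2C g0)
    (hlim : ∀ x, Tendsto (fun h => g h x) l (nhds (g0 x))) (hle : ∀ h, n2 (g h) ≤ n2 g0) :
    Tendsto (fun h => n2 (g h)) l (nhds (n2 g0)) := by
  have key : ∀ f, L2C f → ENNReal.ofReal (n2 f) = ∫⁻ x, ENNReal.ofReal (f x ^ 2) := fun f hf =>
    ofReal_integral_eq_lintegral_ofReal hf.int (Eventually.of_forall fun _ => sq_nonneg _)
  have h1 : Tendsto (fun h => ENNReal.ofReal (n2 (g h))) l (nhds (ENNReal.ofReal (n2 g0))) := by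
    refine tendsto_of_le_liminf_of_limsup_le ?_ ?_
    · simp only [key _ hg0, key _ (hg _)]
      refine le_trans (le_of_eq ?_) (lintegral_liminf_le fun h =>
        (ENNReal.continuous_ofReal.comp ((hg h).cont.pow 2)).measurable)
      refine lintegral_congr fun x => ?_
      exact (((ENNReal.continuous_ofReal.comp (continuous_pow 2)).tendsto _).comp
        (hlim x)).liminf_eq.symm
    · exact limsup_le_of_le (h := Eventually.of_forall fun h => ENNReal.ofReal_le_ofReal (hle h))
  have := (ENNReal.tendsto_toReal ENNReal.ofReal_ne_top).comp h1
  simpa only [Function.comp_def, ENNReal.toReal_ofReal (n2_nonneg _)] using this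

lemma tendsto_n2_dq {f f1 : ℝ → ℝ} (hd : ∀ x, HasDerivAt f (f1 x) x) (hf : L2C f)
    (hf1 : L2C f1) : Tendsto (fun h => n2 (dq h f)) (nhdsWithin 0 (Ioi 0)) (nhds (n2 f1)) := by
  refine tendsto_n2_of_le (fun h => hf.dq h) hf1 (fun x => ?_) fun h => n2_dq_le hd hf1 h
  rw [Metric.tendsto_nhdsWithin_nhds]
  intro ε hε
  obtain ⟨η, hη, H⟩ := Metric.continuousAt_iff.1 (hf1.cont.continuousAt (x := x)) ε hε
  refine ⟨η, hη, fun {h} hh hd' => ?_⟩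
  obtain ⟨ξ, hξ, e⟩ := dq_mem hd (mem_Ioi.1 hh) x
  rw [e]
  apply H
  rw [Real.dist_eq, sub_zero, abs_lt] at hd'
  rw [Real.dist_eq, abs_lt]
  constructor <;> linarith [hξ.1, hξ.2, mem_Ioi.1 hh]

lemma tendsto_n2_dq_dq {f f1 f2 : ℝ → ℝ} (hd : ∀ x, HasDerivAt f (f1 x) x)
    (hd1 : ∀ x, HasDerivAt f1 (f2 x) x) (hf : L2C f) (hf1 : L2C f1) (hf2 : L2C f2) :
    Tendsto (fun h => n2 (dq h (dq h f))) (nhdsWithin 0 (Ioi 0)) (nhds (n2 f2)) := by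
  refine tendsto_n2_of_le (fun h => (hf.dq h).dq h) hf2 (fun x => ?_) fun h =>
    (n2_dq_le (HasDerivAt.dq hd h) (hf1.dq h) h).trans (n2_dq_le hd1 hf2 h)
  rw [Metric.tendsto_nhdsWithin_nhds]
  intro ε hε
  obtain ⟨η, hη, H⟩ := Metric.continuousAt_iff.1 (hf2.cont.continuousAt (x := x)) ε hε
  refine ⟨η / 2, by positivity, fun {h} hh hd' => ?_⟩
  obtain ⟨ξ, hξ, e⟩ := dq_mem (HasDerivAt.dq hd h) (mem_Ioi.1 hh) x
  obtain ⟨ζ, hζ, e'⟩ := dq_mem hd1 (mem_Ioi.1 hh) ξ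
  rw [e, e']
  apply H
  rw [Real.dist_eq, sub_zero, abs_lt] at hd'
  rw [Real.dist_eq, abs_lt]
  constructor <;> linarith [hξ.1, hξ.2, hζ.1, hζ.2, mem_Ioi.1 hh]

/-- Sobolev embedding `H¹ ⊂ L^∞` in one dimension. -/
lemma sq_le_n2_add_n2 {f f1 : ℝ → ℝ} (hd : ∀ x, HasDerivAt f (f1 x) x) (hf : L2C f)
    (hf1 : L2C f1) (x : ℝ) : f x ^ 2 ≤ n2 f + n2 f1 := by
  have hd2 : ∀ y, HasDerivAt (fun y => f y ^ 2) (2 * (f y * f1 y)) y := fun y => by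
    simpa [mul_assoc] using (hd y).fun_pow 2
  have hi : Integrable fun y => 2 * (f y * f1 y) := (hf.mul_int hf1).const_mul 2
  have h0 := tendsto_zero_of_hasDerivAt_of_integrableOn_Iic (a := x) (fun y _ => hd2 y)
    hi.integrableOn hf.int.integrableOn
  have h1 := integral_Iic_of_hasDerivAt_of_tendsto (a := x)
    (hd2 x).continuousAt.continuousWithinAt (fun y _ => hd2 y) hi.integrableOn h0
  rw [sub_zero] at h1
  rw [← h1, n2, n2, ← integral_add hf.int hf1.int]
  refine (setIntegral_mono hi.integrableOn (hf.int.add hf1.int).integrableOn fun y => ?_).trans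
    (setIntegral_le_integral (hf.int.add hf1.int)
      (Eventually.of_forall fun y => add_nonneg (sq_nonneg _) (sq_nonneg _)))
  simp only [Pi.add_apply]
  nlinarith [sq_nonneg (f y - f1 y)]

/-- `f` is integrable with integral `c`. -/
def HasInt (f : ℝ → ℝ) (c : ℝ) : Prop := Integrable f ∧ ∫ x, f x = c

lemma HasInt.add {f g : ℝ → ℝ} {c d : ℝ} (hf : HasInt f c) (hg : HasInt g d) :
    HasInt (fun x => f x + g x) (c + d) :=
  ⟨Integrable.add hf.1 hg.1, by rw [integral_add hf.1 hg.1, hf.2, hg.2]⟩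

lemma HasInt.const_mul {f : ℝ → ℝ} {c : ℝ} (hf : HasInt f c) (k : ℝ) :
    HasInt (fun x => k * f x) (k * c) :=
  ⟨Integrable.const_mul hf.1 k, by rw [MeasureTheory.integral_const_mul, hf.2]⟩

lemma L2C.hasInt {f : ℝ → ℝ} (hf : L2C f) : HasInt (fun x => f x ^ 2) (n2 f) := ⟨hf.int, rfl⟩

lemma HasInt.le {f g : ℝ → ℝ} {c d : ℝ} (hf : HasInt f c) (hg : HasInt g d)
    (h : ∀ x, f x ≤ g x) : c ≤ d := by
  rw [← hf.2, ← hg.2]; exact integral_mono hf.1 hg.1 h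

/-- Continuity in time with values in `L²(ℝ)`. -/
def CL2 (I : Set ℝ) (f : ℝ → ℝ → ℝ) : Prop :=
  (∀ t ∈ I, L2C (f t)) ∧
    ∀ s ∈ I, Tendsto (fun t => n2 fun x => f t x - f s x) (nhdsWithin s I) (nhds 0)

/-- Bounded jointly continuous functions on `I × ℝ`. -/
def JC (I : Set ℝ) (f : ℝ → ℝ → ℝ) : Prop :=
  ContinuousOn (Function.uncurry f) (I ×ˢ univ) ∧ ∃ M, ∀ t ∈ I, ∀ x, |f t x| ≤ M

lemma CL2.continuousOn {I : Set ℝ} {f : ℝ → ℝ → ℝ} (hf : CL2 I f) :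
    ContinuousOn (fun t => n2 (f t)) I := by
  intro s hs
  have key : ∀ t ∈ I, |n2 (f t) - n2 (f s)| ≤ n2 (fun x => f t x - f s x)
      + 2 * (√(n2 fun x => f t x - f s x) * √(n2 (f s))) := fun t ht => by
    have hd := (hf.1 t ht).sub (hf.1 s hs)
    have e : n2 (f t) - n2 (f s) = n2 (fun x => f t x - f s x)
        + 2 * ∫ x, (f t x - f s x) * f s x := by
      rw [← MeasureTheory.integral_const_mul]
      simp only [n2]
      rw [← MeasureTheory.integral_sub (hf.1 t ht).int (hf.1 s hs).int,
        ← MeasureTheory.integral_add hd.int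
        ((hd.mul_int (hf.1 s hs)).const_mul 2)]
      exact integral_congr_ae (Eventually.of_forall fun x => by ring)
    have h1 := cauchy_schwarz hd (hf.1 s hs)
    have h0 := n2_nonneg (fun x => f t x - f s x)
    rw [e]
    refine (abs_add_le _ _).trans ?_
    rw [abs_of_nonneg h0, abs_mul, abs_two]
    linarith
  have hlim : Tendsto (fun t => n2 (fun x => f t x - f s x)
      + 2 * (√(n2 fun x => f t x - f s x) * √(n2 (f s)))) (nhdsWithin s I) (nhds 0) := by
    have h := hf.2 s hs
    have := h.add (((h.sqrt).mul_const (√(n2 (f s)))).const_mul 2)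
    simpa using this
  refine tendsto_iff_dist_tendsto_zero.2 (squeeze_zero' (Eventually.of_forall fun _ => dist_nonneg)
    ?_ hlim)
  filter_upwards [self_mem_nhdsWithin] with t ht
  exact key t ht

lemma CL2.bounded {T : ℝ} {f : ℝ → ℝ → ℝ} (hf : CL2 (Icc 0 T) f) :
    ∃ M, 0 ≤ M ∧ ∀ t ∈ Icc 0 T, n2 (f t) ≤ M := by
  obtain ⟨M, hM⟩ := (isCompact_Icc.image_of_continuousOn hf.continuousOn).bddAbove
  exact ⟨max M 0, le_max_right _ _, fun t ht => (hM (mem_image_of_mem _ ht)).trans (le_max_left _ _)⟩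

lemma CL2.mono {I J : Set ℝ} {f : ℝ → ℝ → ℝ} (hf : CL2 I f) (h : J ⊆ I) : CL2 J f :=
  ⟨fun t ht => hf.1 t (h ht), fun s hs => (hf.2 s (h hs)).mono_left (nhdsWithin_mono _ h)⟩

lemma n2_dq_le_mul {f : ℝ → ℝ} (hf : L2C f) (h : ℝ) : n2 (dq h f) ≤ h⁻¹ ^ 2 * (4 * n2 f) := by
  have e : dq h f = fun x => h⁻¹ * (f (x + h) - f x) := by
    funext x; simp only [dq]; ring
  rw [e, n2_const_mul]
  refine mul_le_mul_of_nonneg_left ?_ (sq_nonneg _)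
  have := n2_sub_le (hf.shift h) hf
  rw [n2_shift] at this
  linarith

lemma CL2.dq {I : Set ℝ} {f : ℝ → ℝ → ℝ} (hf : CL2 I f) (h : ℝ) :
    CL2 I fun t => _root_.dq h (f t) := by
  refine ⟨fun t ht => (hf.1 t ht).dq h, fun s hs => ?_⟩
  have hlim := (((hf.2 s hs).const_mul 4).const_mul (h⁻¹ ^ 2))
  rw [mul_zero, mul_zero] at hlim
  refine squeeze_zero' (Eventually.of_forall fun _ => n2_nonneg _) ?_ hlim
  filter_upwards [self_mem_nhdsWithin] with t ht
  have e : (fun x => _root_.dq h (f t) x - _root_.dq h (f s) x)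
      = _root_.dq h fun x => f t x - f s x := by
    funext x; simp only [_root_.dq]; ring
  rw [e]
  exact n2_dq_le_mul ((hf.1 t ht).sub (hf.1 s hs)) h

lemma JC.mono {I J : Set ℝ} {f : ℝ → ℝ → ℝ} (hf : JC I f) (h : J ⊆ I) : JC J f :=
  ⟨hf.1.mono (prod_mono_left h), hf.2.imp fun _ hM t ht => hM t (h ht)⟩

lemma JC.dq {I : Set ℝ} {f : ℝ → ℝ → ℝ} (hf : JC I f) (h : ℝ) :
    JC I fun t => _root_.dq h (f t) := by
  obtain ⟨hc, M, hM⟩ := hf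
  refine ⟨?_, (M + M) / |h|, fun t ht x => ?_⟩
  · have h1 : ContinuousOn (fun p : ℝ × ℝ => f p.1 (p.2 + h)) (I ×ˢ univ) :=
      hc.comp (f := fun p : ℝ × ℝ => (p.1, p.2 + h)) (by fun_prop) fun p hp => ⟨hp.1, trivial⟩
    exact (h1.sub hc).div_const h
  · simp only [_root_.dq, abs_div]
    refine div_le_div_of_nonneg_right ((abs_sub _ _).trans (add_le_add (hM t ht _) (hM t ht _)))
      (abs_nonneg h)

lemma JC.of_CL2 {T : ℝ} {f f1 : ℝ → ℝ → ℝ} (hd : ∀ t ∈ Icc 0 T, ∀ x, HasDerivAt (f t) (f1 t x) x)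
    (hf : CL2 (Icc 0 T) f) (hf1 : CL2 (Icc 0 T) f1) : JC (Icc 0 T) f := by
  obtain ⟨M, hM0, hM⟩ := hf.bounded
  obtain ⟨M1, hM10, hM1⟩ := hf1.bounded
  refine ⟨?_, √(M + M1), fun t ht x => Real.abs_le_sqrt <|
    (sq_le_n2_add_n2 (hd t ht) (hf.1 t ht) (hf1.1 t ht) x).trans
      (add_le_add (hM t ht) (hM1 t ht))⟩
  rintro ⟨s, x⟩ ⟨hs, -⟩
  have hs : s ∈ Icc 0 T := hs
  have hlim : Tendsto (fun p : ℝ × ℝ => √((n2 fun x => f p.1 x - f s x)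
      + n2 fun x => f1 p.1 x - f1 s x) + |f s p.2 - f s x|)
      (nhdsWithin (s, x) (Icc 0 T ×ˢ univ)) (nhds 0) := by
    have hfst : Tendsto (fun p : ℝ × ℝ => p.1) (nhdsWithin (s, x) (Icc 0 T ×ˢ univ))
        (nhdsWithin s (Icc 0 T)) :=
      tendsto_nhdsWithin_of_tendsto_nhds_of_eventually_within _
        (continuous_fst.continuousAt.tendsto.mono_left nhdsWithin_le_nhds)
        (by filter_upwards [self_mem_nhdsWithin] with p hp using hp.1)
    have h1 := (((hf.2 s hs).add (hf1.2 s hs)).sqrt).comp hfst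
    have h2 : Tendsto (fun p : ℝ × ℝ => |f s p.2 - f s x|)
        (nhdsWithin (s, x) (Icc 0 T ×ˢ univ)) (nhds |f s x - f s x|) := by
      have : Continuous fun p : ℝ × ℝ => |f s p.2 - f s x| :=
        (((hf.1 s hs).cont.comp continuous_snd).sub continuous_const).abs
      exact (this.tendsto (s, x)).mono_left nhdsWithin_le_nhds
    simpa using h1.add h2
  refine tendsto_iff_dist_tendsto_zero.2 (squeeze_zero' (Eventually.of_forall fun _ => dist_nonneg)
    ?_ hlim)
  filter_upwards [self_mem_nhdsWithin] with p hp
  simp only [Function.uncurry, Real.dist_eq]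
  have h1 := Real.abs_le_sqrt (sq_le_n2_add_n2 (f := fun x => f p.1 x - f s x)
    (f1 := fun x => f1 p.1 x - f1 s x) (fun y => (hd p.1 hp.1 y).sub (hd s hs y))
    ((hf.1 _ hp.1).sub (hf.1 s hs)) ((hf1.1 _ hp.1).sub (hf1.1 s hs)) p.2)
  have e : f p.1 p.2 - f s x = (f p.1 p.2 - f s p.2) + (f s p.2 - f s x) := by ring
  rw [e]
  exact (abs_add_le _ _).trans (add_le_add_left h1 _)

/-- A function of `(t, x)` together with its first time derivative and its first two space
derivatives. -/
structure Jet where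
  f : ℝ → ℝ → ℝ
  ft : ℝ → ℝ → ℝ
  fx : ℝ → ℝ → ℝ
  fxx : ℝ → ℝ → ℝ

/-- Difference quotient of a jet. -/
def Jet.dq (h : ℝ) (J : Jet) : Jet where
  f t := _root_.dq h (J.f t)
  ft t := _root_.dq h (J.ft t)
  fx t := _root_.dq h (J.fx t)
  fxx t := _root_.dq h (J.fxx t)

/-- Regularity of a jet on the time interval `I`. -/
structure Reg (I : Set ℝ) (J : Jet) : Prop where
  dt : ∀ t ∈ I, ∀ x, HasDerivAt (fun s => J.f s x) (J.ft t x) t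
  dx : ∀ t ∈ I, ∀ x, HasDerivAt (J.f t) (J.fx t x) x
  dxx : ∀ t ∈ I, ∀ x, HasDerivAt (J.fx t) (J.fxx t x) x
  cf : CL2 I J.f
  cx : CL2 I J.fx
  cxx : CL2 I J.fxx
  ct : CL2 I J.ft
  jf : JC I J.f
  jt : JC I J.ft

lemma Reg.dq {I : Set ℝ} {J : Jet} (hJ : Reg I J) (h : ℝ) : Reg I (J.dq h) where
  dt t ht x := ((hJ.dt t ht (x + h)).sub (hJ.dt t ht x)).div_const h
  dx t ht x := HasDerivAt.dq (hJ.dx t ht) h x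
  dxx t ht x := HasDerivAt.dq (hJ.dxx t ht) h x
  cf := hJ.cf.dq h
  cx := hJ.cx.dq h
  cxx := hJ.cxx.dq h
  ct := hJ.ct.dq h
  jf := hJ.jf.dq h
  jt := hJ.jt.dq h

lemma Reg.mono {I I' : Set ℝ} {J : Jet} (hJ : Reg I J) (h : I' ⊆ I) : Reg I' J where
  dt t ht := hJ.dt t (h ht)
  dx t ht := hJ.dx t (h ht)
  dxx t ht := hJ.dxx t (h ht)
  cf := hJ.cf.mono h
  cx := hJ.cx.mono h
  cxx := hJ.cxx.mono h
  ct := hJ.ct.mono h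
  jf := hJ.jf.mono h
  jt := hJ.jt.mono h

/-- Fundamental theorem of calculus in time for space integrals. -/
lemma integral_time_deriv {T M : ℝ} (hT : 0 ≤ T) {φ φt : ℝ → ℝ → ℝ}
    (hd : ∀ s ∈ Icc 0 T, ∀ x, HasDerivAt (fun r => φ r x) (φt s x) s)
    (hc : ContinuousOn (Function.uncurry φt) (Icc 0 T ×ˢ univ))
    (hb : ∀ s ∈ Icc 0 T, ∃ g : ℝ → ℝ, Integrable g ∧ ∫ x, g x ≤ M ∧ ∀ x, |φt s x| ≤ g x)
    (h0 : Integrable (φ 0)) (h1 : Integrable (φ T)) :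
    IntervalIntegrable (fun s => ∫ x, φt s x) volume 0 T ∧
      ∫ s in (0:ℝ)..T, ∫ x, φt s x = (∫ x, φ T x) - ∫ x, φ 0 x := by
  have hcs : ∀ s ∈ Icc 0 T, Continuous (φt s) := fun s hs => by
    have : ContinuousOn (fun x : ℝ => φt s x) univ :=
      hc.comp (f := fun x : ℝ => (s, x)) (by fun_prop) fun x _ => ⟨hs, trivial⟩
    exact continuousOn_univ.1 this
  have hi : ∀ s ∈ Icc 0 T, Integrable (φt s) ∧ ∫ x, ‖φt s x‖ ≤ M := fun s hs => by
    obtain ⟨g, hg, hgM, hle⟩ := hb s hs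
    have := integrable_of_cont_le (hcs s hs) hg hle
    exact ⟨this, (integral_mono this.norm hg hle).trans hgM⟩
  have hmeas : AEStronglyMeasurable (Function.uncurry φt)
      ((volume.restrict (Ioc 0 T)).prod (volume : Measure ℝ)) := by
    have e : (volume.restrict (Ioc 0 T)).prod (volume : Measure ℝ)
        = (volume.prod volume).restrict (Ioc 0 T ×ˢ univ) := by
      rw [← Measure.prod_restrict, Measure.restrict_univ]
    rw [e]
    exact (hc.mono (prod_mono_left Ioc_subset_Icc_self)).aestronglyMeasurable
      (measurableSet_Ioc.prod MeasurableSet.univ)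
  have hint : Integrable (Function.uncurry φt)
      ((volume.restrict (Ioc 0 T)).prod (volume : Measure ℝ)) := by
    rw [integrable_prod_iff hmeas]
    constructor
    · filter_upwards [ae_restrict_mem measurableSet_Ioc] with s hs
      exact (hi s (Ioc_subset_Icc_self hs)).1
    · refine Integrable.mono' (g := fun _ => M) (integrable_const _) hmeas.norm.integral_prod_right' ?_
      filter_upwards [ae_restrict_mem measurableSet_Ioc] with s hs
      rw [Real.norm_of_nonneg (integral_nonneg fun _ => norm_nonneg _)]
      exact (hi s (Ioc_subset_Icc_self hs)).2
  refine ⟨(intervalIntegrable_iff_integrableOn_Ioc_of_le hT).2 hint.integral_prod_left, ?_⟩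
  rw [intervalIntegral.integral_of_le hT, integral_integral_swap hint,
    ← MeasureTheory.integral_sub h1 h0]
  refine integral_congr_ae (Eventually.of_forall fun x => ?_)
  simp only
  rw [← intervalIntegral.integral_of_le hT]
  refine intervalIntegral.integral_eq_sub_of_hasDerivAt (f := fun r => φ r x)
    (fun s hs => hd s (by rwa [uIcc_of_le hT] at hs) x) ?_
  refine ContinuousOn.intervalIntegrable ?_
  rw [uIcc_of_le hT]
  exact hc.comp (f := fun s : ℝ => (s, x)) (by fun_prop) fun s hs => ⟨hs, trivial⟩

lemma tendsto_integral_mul_dq {a f f1 f2 : ℝ → ℝ} (ha : L2C a)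
    (hd : ∀ x, HasDerivAt f (f1 x) x) (hd1 : ∀ x, HasDerivAt f1 (f2 x) x) (hf : L2C f)
    (hf1 : L2C f1) (hf2 : L2C f2) :
    Tendsto (fun k => ∫ x, a x * dq k f x) (nhdsWithin 0 {0}ᶜ) (nhds (∫ x, a x * f1 x)) := by
  have hlim : Tendsto (fun k : ℝ => √(n2 a) * √(k ^ 2 * n2 f2)) (nhdsWithin 0 {0}ᶜ) (nhds 0) := by
    have : Continuous fun k : ℝ => √(n2 a) * √(k ^ 2 * n2 f2) := by fun_prop
    simpa using (this.tendsto 0).mono_left nhdsWithin_le_nhds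
  refine tendsto_iff_dist_tendsto_zero.2 (squeeze_zero' (Eventually.of_forall fun _ => dist_nonneg)
    ?_ hlim)
  filter_upwards [self_mem_nhdsWithin] with k hk
  rw [Real.dist_eq, ← MeasureTheory.integral_sub (ha.mul_int (hf.dq k)) (ha.mul_int hf1)]
  simp only [← mul_sub]
  refine (cauchy_schwarz ha ((hf.dq k).sub hf1)).trans
    (mul_le_mul_of_nonneg_left (Real.sqrt_le_sqrt ?_) (Real.sqrt_nonneg _))
  exact n2_dq_sub_deriv_le hd hd1 hf1 hf2 hk

lemma integral_mul_dq {f g : ℝ → ℝ} (hf : L2C f) (hg : L2C g) (k : ℝ) :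
    ∫ x, f x * dq k g x = - ∫ x, g x * dq (-k) f x := by
  have h1 : Integrable fun x => k⁻¹ * (f x * g (x + k)) := (hf.mul_int (hg.shift k)).const_mul _
  have h2 : Integrable fun x => k⁻¹ * (f x * g x) := (hf.mul_int hg).const_mul _
  have h3 : Integrable fun x => k⁻¹ * (f (x + -k) * g x) :=
    ((hf.shift (-k)).mul_int hg).const_mul _
  have e1 : ∀ x, f x * dq k g x = k⁻¹ * (f x * g (x + k)) - k⁻¹ * (f x * g x) := fun x => by
    simp only [dq]; ring
  have e2 : ∀ x, g x * dq (-k) f x = k⁻¹ * (f x * g x) - k⁻¹ * (f (x + -k) * g x) := fun x => by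
    simp only [dq, div_neg]; ring
  have e3 : ∫ x, k⁻¹ * (f (x + -k) * g x) = ∫ x, k⁻¹ * (f x * g (x + k)) := by
    rw [← integral_add_right_eq_self (fun x => k⁻¹ * (f (x + -k) * g x)) k]
    simp
  simp only [e1, e2]
  rw [MeasureTheory.integral_sub h1 h2, MeasureTheory.integral_sub h2 h3, e3]
  ring

/-- Weak form of `d/dt ∫ f g_x = ∫ (f_t g_x - f_x g_t)`. -/
lemma integral_cross {T : ℝ} (hT : 0 ≤ T) {f g : Jet} (hf : Reg (Icc 0 T) f)
    (hg : Reg (Icc 0 T) g) :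
    IntervalIntegrable (fun s => ∫ x, (f.ft s x * g.fx s x - g.ft s x * f.fx s x)) volume 0 T ∧
      ∫ s in (0:ℝ)..T, ∫ x, (f.ft s x * g.fx s x - g.ft s x * f.fx s x)
        = (∫ x, f.f T x * g.fx T x) - ∫ x, f.f 0 x * g.fx 0 x := by
  have h0 : (0:ℝ) ∈ Icc 0 T := ⟨le_rfl, hT⟩
  have h1 : T ∈ Icc 0 T := ⟨hT, le_rfl⟩
  obtain ⟨A, hA0, hA⟩ := hf.ct.bounded
  obtain ⟨B, hB0, hB⟩ := hg.cx.bounded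
  obtain ⟨A', hA'0, hA'⟩ := hf.cx.bounded
  obtain ⟨B', hB'0, hB'⟩ := hg.ct.bounded
  have cs_le : ∀ {a b : ℝ → ℝ} {P Q : ℝ}, L2C a → L2C b → n2 a ≤ P → n2 b ≤ Q →
      |∫ x, a x * b x| ≤ √P * √Q := fun ha hb hP hQ =>
    (cauchy_schwarz ha hb).trans (mul_le_mul (Real.sqrt_le_sqrt hP) (Real.sqrt_le_sqrt hQ)
      (Real.sqrt_nonneg _) (Real.sqrt_nonneg _))
  set P : ℝ → ℝ → ℝ := fun k s => ∫ x, (f.ft s x * (g.dq k).f s x + f.f s x * (g.dq k).ft s x)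
    with hP
  have hPeq : ∀ k, ∀ s ∈ Icc 0 T, P k s = (∫ x, f.ft s x * dq k (g.f s) x)
      - ∫ x, g.ft s x * dq (-k) (f.f s) x := fun k s hs => by
    simp only [hP]
    rw [MeasureTheory.integral_add ((hf.ct.1 s hs).mul_int ((hg.dq k).cf.1 s hs))
      ((hf.cf.1 s hs).mul_int ((hg.dq k).ct.1 s hs))]
    have := integral_mul_dq (hf.cf.1 s hs) (hg.ct.1 s hs) k
    simp only [Jet.dq]
    rw [this]; ring
  have hlim : ∀ s ∈ Icc 0 T, Tendsto (fun k => P k s) (nhdsWithin 0 {0}ᶜ)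
      (nhds (∫ x, (f.ft s x * g.fx s x - g.ft s x * f.fx s x))) := fun s hs => by
    simp only [hPeq _ s hs]
    rw [MeasureTheory.integral_sub ((hf.ct.1 s hs).mul_int (hg.cx.1 s hs))
      ((hg.ct.1 s hs).mul_int (hf.cx.1 s hs))]
    refine (tendsto_integral_mul_dq (hf.ct.1 s hs) (hg.dx s hs) (hg.dxx s hs) (hg.cf.1 s hs)
      (hg.cx.1 s hs) (hg.cxx.1 s hs)).sub ?_
    refine (tendsto_integral_mul_dq (hg.ct.1 s hs) (hf.dx s hs) (hf.dxx s hs) (hf.cf.1 s hs)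
      (hf.cx.1 s hs) (hf.cxx.1 s hs)).comp ?_
    refine tendsto_nhdsWithin_of_tendsto_nhds_of_eventually_within _ ?_ ?_
    · have : Continuous fun k : ℝ => -k := continuous_neg
      simpa using (this.tendsto 0).mono_left (nhdsWithin_le_nhds (s := {0}ᶜ))
    · filter_upwards [self_mem_nhdsWithin] with k hk
      simpa using hk
  have hftc : ∀ k, IntervalIntegrable (P k) volume 0 T ∧ ∫ s in (0:ℝ)..T, P k s
      = (∫ x, f.f T x * (g.dq k).f T x) - ∫ x, f.f 0 x * (g.dq k).f 0 x := fun k => by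
    have hgk := hg.dq k
    obtain ⟨C, hC0, hC⟩ := hgk.cf.bounded
    obtain ⟨C', hC'0, hC'⟩ := hgk.ct.bounded
    obtain ⟨D, hD0, hD⟩ := hf.cf.bounded
    refine integral_time_deriv (M := A + C + D + C') hT
      (φ := fun s x => f.f s x * (g.dq k).f s x) (fun s hs x => (hf.dt s hs x).mul (hgk.dt s hs x))
      ((hf.jt.1.mul hgk.jf.1).add (hf.jf.1.mul hgk.jt.1)) (fun s hs => ?_)
      ((hf.cf.1 0 h0).mul_int (hgk.cf.1 0 h0)) ((hf.cf.1 T h1).mul_int (hgk.cf.1 T h1))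
    have hI := (((hf.ct.1 s hs).hasInt.add (hgk.cf.1 s hs).hasInt).add
      (hf.cf.1 s hs).hasInt).add (hgk.ct.1 s hs).hasInt
    refine ⟨_, hI.1, ?_, fun x => ?_⟩
    · rw [hI.2]
      exact add_le_add (add_le_add (add_le_add (hA s hs) (hC s hs)) (hD s hs)) (hC' s hs)
    · rw [abs_le]
      constructor <;> nlinarith [sq_nonneg (f.ft s x + (g.dq k).f s x),
        sq_nonneg (f.ft s x - (g.dq k).f s x), sq_nonneg (f.f s x + (g.dq k).ft s x),
        sq_nonneg (f.f s x - (g.dq k).ft s x), sq_nonneg (f.f s x), sq_nonneg (f.ft s x),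
        sq_nonneg ((g.dq k).f s x), sq_nonneg ((g.dq k).ft s x)]
  have hbound : ∀ k, ∀ s ∈ Icc 0 T, ‖P k s‖ ≤ √A * √B + √B' * √A' := fun k s hs => by
    rw [hPeq k s hs, Real.norm_eq_abs]
    refine (abs_sub _ _).trans (add_le_add ?_ ?_)
    · exact cs_le (hf.ct.1 s hs) ((hg.cf.1 s hs).dq k) (hA s hs)
        ((n2_dq_le (hg.dx s hs) (hg.cx.1 s hs) k).trans (hB s hs))
    · exact cs_le (hg.ct.1 s hs) ((hf.cf.1 s hs).dq (-k)) (hB' s hs)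
        ((n2_dq_le (hf.dx s hs) (hf.cx.1 s hs) (-k)).trans (hA' s hs))
  have hmeas : ∀ k, AEStronglyMeasurable (P k) (volume.restrict (uIoc 0 T)) := fun k => by
    rw [uIoc_of_le hT]
    exact ((intervalIntegrable_iff_integrableOn_Ioc_of_le hT).1 (hftc k).1).aestronglyMeasurable
  have hsub : ∀ {s}, s ∈ uIoc 0 T → s ∈ Icc 0 T := fun hs => by
    rw [uIoc_of_le hT] at hs; exact Ioc_subset_Icc_self hs
  have hdct := intervalIntegral.tendsto_integral_filter_of_dominated_convergence (μ := volume)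
    (a := 0) (b := T) (l := nhdsWithin (0:ℝ) {0}ᶜ) (F := P)
    (f := fun s => ∫ x, (f.ft s x * g.fx s x - g.ft s x * f.fx s x))
    (fun _ => √A * √B + √B' * √A') (Eventually.of_forall hmeas)
    (Eventually.of_forall fun k => Eventually.of_forall fun s hs => hbound k s (hsub hs))
    intervalIntegrable_const (Eventually.of_forall fun s hs => hlim s (hsub hs))
  constructor
  · have hmeas' : AEStronglyMeasurable
        (fun s => ∫ x, (f.ft s x * g.fx s x - g.ft s x * f.fx s x))
        (volume.restrict (Ioc 0 T)) := by
      refine aestronglyMeasurable_of_tendsto_ae (nhdsWithin (0:ℝ) {0}ᶜ) (f := P)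
        (fun k => by simpa only [uIoc_of_le hT] using hmeas k) ?_
      filter_upwards [ae_restrict_mem measurableSet_Ioc] with s hs
      exact hlim s (Ioc_subset_Icc_self hs)
    rw [intervalIntegrable_iff_integrableOn_Ioc_of_le hT]
    refine Integrable.mono' (g := fun _ => √A * √B + √B' * √A')
      (integrable_const _) hmeas' ?_
    filter_upwards [ae_restrict_mem measurableSet_Ioc] with s hs
    exact le_of_tendsto ((hlim s (Ioc_subset_Icc_self hs)).norm)
      (Eventually.of_forall fun k => hbound k s (Ioc_subset_Icc_self hs))
  · refine tendsto_nhds_unique hdct ?_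
    simp only [(hftc _).2]
    exact (tendsto_integral_mul_dq (hf.cf.1 T h1) (hg.dx T h1) (hg.dxx T h1) (hg.cf.1 T h1)
      (hg.cx.1 T h1) (hg.cxx.1 T h1)).sub (tendsto_integral_mul_dq (hf.cf.1 0 h0) (hg.dx 0 h0)
      (hg.dxx 0 h0) (hg.cf.1 0 h0) (hg.cx.1 0 h0) (hg.cxx.1 0 h0))

/-- Relative entropy density of the pressure `r ↦ r ^ (-γ)` at the state `1`. -/
def entropy (γ r : ℝ) : ℝ := r - 1 + (r ^ (1 - γ) - 1) / (γ - 1)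

lemma hasDerivAt_entropy {γ r : ℝ} (hγ : 1 < γ) (hr : 0 < r) :
    HasDerivAt (entropy γ) (1 - r ^ (-γ)) r := by
  have h1 := (((Real.hasDerivAt_rpow_const (p := 1 - γ) (Or.inl hr.ne')).sub_const 1).div_const
    (γ - 1))
  refine (((hasDerivAt_id' r).sub_const 1).fun_add h1).congr_deriv ?_
  have : γ - 1 ≠ 0 := by linarith
  have e : (1:ℝ) - γ - 1 = -γ := by ring
  rw [e]; field_simp; ring

lemma hasDerivAt_mul_rpow {c p r : ℝ} (hr : 0 < r) :
    HasDerivAt (fun y : ℝ => c * y ^ p) (c * p * r ^ (p - 1)) r := by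
  simpa [mul_assoc] using (Real.hasDerivAt_rpow_const (p := p) (Or.inl hr.ne')).const_mul c

lemma exists_bound_mul_rpow (c p : ℝ) :
    ∃ K : ℝ, 0 < K ∧ ∀ r ∈ Icc (1 / 2 : ℝ) (3 / 2), |c * r ^ p| ≤ K := by
  have hc : ContinuousOn (fun y : ℝ => c * y ^ p) (Icc (1 / 2 : ℝ) (3 / 2)) := fun r hr =>
    (hasDerivAt_mul_rpow (lt_of_lt_of_le (by norm_num) hr.1)).continuousAt.continuousWithinAt
  obtain ⟨K, hK⟩ := isCompact_Icc.exists_bound_of_continuousOn hc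
  exact ⟨max K 1, by positivity, fun r hr => (hK r hr).trans (le_max_left _ _)⟩

lemma exists_lower_bound_mul_rpow {c : ℝ} (hc0 : 0 < c) (p : ℝ) :
    ∃ k : ℝ, 0 < k ∧ ∀ r ∈ Icc (1 / 2 : ℝ) (3 / 2), k ≤ c * r ^ p := by
  have hc : ContinuousOn (fun y : ℝ => c * y ^ p) (Icc (1 / 2 : ℝ) (3 / 2)) := fun r hr =>
    (hasDerivAt_mul_rpow (lt_of_lt_of_le (by norm_num) hr.1)).continuousAt.continuousWithinAt
  obtain ⟨r0, hr0, hmin⟩ := isCompact_Icc.exists_isMinOn (nonempty_Icc.2 (by norm_num)) hc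
  exact ⟨c * r0 ^ p, mul_pos hc0 (Real.rpow_pos_of_pos (lt_of_lt_of_le (by norm_num) hr0.1) _),
    fun r hr => hmin hr⟩

lemma nonneg_of_deriv_sign {g g' : ℝ → ℝ} {a b : ℝ} (h1 : g 1 = 0) (ha : a < 1) (hb : 1 < b)
    (hd : ∀ r ∈ Icc a b, HasDerivAt g (g' r) r) (hs : ∀ r ∈ Icc a b, 0 ≤ g' r * (r - 1))
    {r : ℝ} (hr : r ∈ Icc a b) : 0 ≤ g r := by
  rcases lt_trichotomy r 1 with h | h | h
  · obtain ⟨ξ, hξ, e⟩ := exists_hasDerivAt_eq_slope g g' h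
      (fun y hy => (hd y ⟨hr.1.trans hy.1, hy.2.trans hb.le⟩).continuousAt.continuousWithinAt)
      fun y hy => hd y ⟨hr.1.trans hy.1.le, hy.2.le.trans hb.le⟩
    have hs' := hs ξ ⟨hr.1.trans hξ.1.le, hξ.2.le.trans hb.le⟩
    rw [h1, eq_div_iff (by linarith)] at e
    have : g' ξ ≤ 0 := by
      by_contra! hc
      nlinarith [mul_pos hc (sub_pos.2 hξ.2)]
    nlinarith
  · rw [h, h1]
  · obtain ⟨ξ, hξ, e⟩ := exists_hasDerivAt_eq_slope g g' h
      (fun y hy => (hd y ⟨ha.le.trans hy.1, hy.2.trans hr.2⟩).continuousAt.continuousWithinAt)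
      fun y hy => hd y ⟨ha.le.trans hy.1.le, hy.2.le.trans hr.2⟩
    have hs' := hs ξ ⟨ha.le.trans hξ.1.le, hξ.2.le.trans hr.2⟩
    rw [h1, eq_div_iff (by linarith)] at e
    have : 0 ≤ g' ξ := nonneg_of_mul_nonneg_left hs' (sub_pos.2 hξ.1)
    nlinarith

lemma pressure_bounds {γ : ℝ} (hγ : 1 < γ) : ∃ k K : ℝ, 0 < k ∧ 0 < K ∧
    ∀ r ∈ Icc (1 / 2 : ℝ) (3 / 2), k ≤ γ * r ^ (-γ - 1) ∧ γ * r ^ (-γ - 1) ≤ K ∧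
      |γ * (-γ - 1) * r ^ (-γ - 1 - 1)| ≤ K ∧
      |γ * (-γ - 1) * (-γ - 1 - 1) * r ^ (-γ - 1 - 1 - 1)| ≤ K ∧
      |1 - r ^ (-γ)| ≤ K * |r - 1| ∧
      k * (r - 1) ^ 2 ≤ entropy γ r ∧ entropy γ r ≤ K * (r - 1) ^ 2 := by
  obtain ⟨k, hk, hk'⟩ := exists_lower_bound_mul_rpow (by linarith : 0 < γ) (-γ - 1)
  obtain ⟨K0, hK0, hK0'⟩ := exists_bound_mul_rpow γ (-γ - 1)
  obtain ⟨K1, hK1, hK1'⟩ := exists_bound_mul_rpow (γ * (-γ - 1)) (-γ - 1 - 1)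
  obtain ⟨K2, hK2, hK2'⟩ := exists_bound_mul_rpow (γ * (-γ - 1) * (-γ - 1 - 1)) (-γ - 1 - 1 - 1)
  have hpos : ∀ r ∈ Icc (1 / 2 : ℝ) (3 / 2), 0 < r := fun r hr =>
    lt_of_lt_of_le (by norm_num) hr.1
  have hder : ∀ r ∈ Icc (1 / 2 : ℝ) (3 / 2),
      HasDerivAt (fun y : ℝ => 1 - y ^ (-γ)) (γ * r ^ (-γ - 1)) r := fun r hr => by
    exact ((Real.hasDerivAt_rpow_const (p := -γ) (Or.inl (hpos r hr).ne')).const_sub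
      1).congr_deriv (by ring)
  have hslope : ∀ r ∈ Icc (1 / 2 : ℝ) (3 / 2), k * (r - 1) ^ 2 ≤ (1 - r ^ (-γ)) * (r - 1) ∧
      (1 - r ^ (-γ)) * (r - 1) ≤ K0 * (r - 1) ^ 2 ∧ |1 - r ^ (-γ)| ≤ K0 * |r - 1| := by
    intro r hr
    have mvt : ∃ m, k ≤ m ∧ m ≤ K0 ∧ 1 - r ^ (-γ) = m * (r - 1) := by
      rcases lt_trichotomy r 1 with h | h | h
      · obtain ⟨ξ, hξ, e⟩ := exists_hasDerivAt_eq_slope (fun y : ℝ => 1 - y ^ (-γ))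
          (fun r => γ * r ^ (-γ - 1)) h (fun y hy =>
            (hder y ⟨hr.1.trans hy.1, hy.2.trans (by norm_num)⟩).continuousAt.continuousWithinAt)
          fun y hy => hder y ⟨hr.1.trans hy.1.le, hy.2.le.trans (by norm_num)⟩
        have hm : ξ ∈ Icc (1 / 2 : ℝ) (3 / 2) :=
          ⟨hr.1.trans hξ.1.le, hξ.2.le.trans (by norm_num)⟩
        refine ⟨_, hk' ξ hm, (le_abs_self _).trans (hK0' ξ hm), ?_⟩
        rw [e, Real.one_rpow]
        have : 1 - r ≠ 0 := by linarith
        field_simp; ring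
      · exact ⟨k, le_rfl, (hk' r hr).trans ((le_abs_self _).trans (hK0' r hr)), by simp [h]⟩
      · obtain ⟨ξ, hξ, e⟩ := exists_hasDerivAt_eq_slope (fun y : ℝ => 1 - y ^ (-γ))
          (fun r => γ * r ^ (-γ - 1)) h (fun y hy =>
            (hder y ⟨le_trans (by norm_num) hy.1,
              hy.2.trans hr.2⟩).continuousAt.continuousWithinAt)
          fun y hy => hder y ⟨le_trans (by norm_num) hy.1.le, hy.2.le.trans hr.2⟩
        have hm : ξ ∈ Icc (1 / 2 : ℝ) (3 / 2) :=
          ⟨le_trans (by norm_num) hξ.1.le, hξ.2.le.trans hr.2⟩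
        refine ⟨_, hk' ξ hm, (le_abs_self _).trans (hK0' ξ hm), ?_⟩
        rw [e, Real.one_rpow]
        have : r - 1 ≠ 0 := by linarith
        field_simp; ring
    obtain ⟨m, hm1, hm2, e⟩ := mvt
    rw [e]
    refine ⟨?_, ?_, ?_⟩
    · nlinarith [mul_le_mul_of_nonneg_right hm1 (sq_nonneg (r - 1))]
    · nlinarith [mul_le_mul_of_nonneg_right hm2 (sq_nonneg (r - 1))]
    · rw [abs_mul, abs_of_nonneg (hk.le.trans hm1)]
      exact mul_le_mul_of_nonneg_right hm2 (abs_nonneg _)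
  have hquad : ∀ c r : ℝ, HasDerivAt (fun y : ℝ => c / 2 * (y - 1) ^ 2) (c * (r - 1)) r :=
    fun c r => by
      exact ((((hasDerivAt_id' r).sub_const 1).fun_pow 2).const_mul (c / 2)).congr_deriv
        (by simp; ring)
  have hone : entropy γ 1 = 0 := by simp [entropy]
  refine ⟨k / 2, K0 + K1 + K2, by positivity, by positivity, fun r hr => ⟨?_, ?_, ?_, ?_, ?_, ?_, ?_⟩⟩
  · linarith [hk' r hr]
  · linarith [(le_abs_self _).trans (hK0' r hr)]
  · linarith [hK1' r hr]
  · linarith [hK2' r hr]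
  · exact (hslope r hr).2.2.trans (mul_le_mul_of_nonneg_right (by linarith) (abs_nonneg _))
  · have := nonneg_of_deriv_sign (g := fun y => entropy γ y - k / 2 * (y - 1) ^ 2)
      (a := 1 / 2) (b := 3 / 2) (by simp [hone]) (by norm_num) (by norm_num)
      (fun r hr => (hasDerivAt_entropy hγ (hpos r hr)).sub (hquad k r))
      (fun r hr => by nlinarith [(hslope r hr).1]) hr
    linarith
  · have := nonneg_of_deriv_sign (g := fun y => K0 / 2 * (y - 1) ^ 2 - entropy γ y)
      (a := 1 / 2) (b := 3 / 2) (by simp [hone]) (by norm_num) (by norm_num)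
      (fun r hr => (hquad K0 r).sub (hasDerivAt_entropy hγ (hpos r hr)))
      (fun r hr => by nlinarith [(hslope r hr).2.1]) hr
    nlinarith [sq_nonneg (r - 1)]

lemma cross_pointwise {a0 a1 b0 A α β τ p q Z z F G : ℝ} (ha0 : 0 < a0) (hb0 : 0 < b0)
    (hA : A = 3 / b0) (hα : a0 ≤ α) (hα' : α ≤ a1) (hβ : b0 ≤ β) (hτ : 0 < τ) (hτ1 : τ ≤ 1) :
    p ^ 2 + a0 / 4 * q ^ 2 ≤ A * ((β * p - Z + G) * p - τ * z * (α * q + z + F))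
        + ((α * q + z + F) * q - p ^ 2)
      + (A ^ 2 + (A * a1) ^ 2 / a0 + 2 * A + 1 / a0) * (Z ^ 2 + z ^ 2 + (F ^ 2 + G ^ 2)) := by
  have hA0 : 0 < A := by rw [hA]; positivity
  have hAb : A * b0 = 3 := by rw [hA]; field_simp
  have h1 : 3 * p ^ 2 ≤ A * β * p ^ 2 := by
    rw [← hAb]; exact mul_le_mul_of_nonneg_right (mul_le_mul_of_nonneg_left hβ hA0.le) (sq_nonneg p)
  have h2 : A * Z * p ≤ p ^ 2 / 2 + A ^ 2 * Z ^ 2 := by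
    nlinarith [sq_nonneg (p - A * Z), mul_nonneg (sq_nonneg A) (sq_nonneg Z)]
  have h3 : -(A * G * p) ≤ p ^ 2 / 2 + A ^ 2 * G ^ 2 := by
    nlinarith [sq_nonneg (p + A * G), mul_nonneg (sq_nonneg A) (sq_nonneg G)]
  have h4 : a0 * q ^ 2 ≤ α * q ^ 2 := mul_le_mul_of_nonneg_right hα (sq_nonneg q)
  have h5 : A * τ * α * z * q ≤ a0 / 4 * q ^ 2 + (A * a1) ^ 2 / a0 * z ^ 2 := by
    have e : a0 / 4 * q ^ 2 + (A * τ * α) ^ 2 / a0 * z ^ 2 - A * τ * α * z * q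
        = (a0 * q / 2 - A * τ * α * z) ^ 2 / a0 := by field_simp; ring
    have h0 : 0 ≤ (a0 * q / 2 - A * τ * α * z) ^ 2 / a0 := by positivity
    have h0' : (A * τ * α) ^ 2 / a0 * z ^ 2 ≤ (A * a1) ^ 2 / a0 * z ^ 2 := by
      have hα0 : 0 < α := lt_of_lt_of_le ha0 hα
      have : A * τ * α ≤ A * a1 := by
        have : τ * α ≤ 1 * a1 := mul_le_mul hτ1 hα' hα0.le zero_le_one
        nlinarith
      gcongr
    linarith
  have h6 : A * τ * z ^ 2 ≤ A * z ^ 2 := by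
    have : A * τ ≤ A := by nlinarith
    exact mul_le_mul_of_nonneg_right this (sq_nonneg z)
  have h7 : A * τ * z * F ≤ A * (z ^ 2 + F ^ 2) := by
    have h : z * F ≤ z ^ 2 + F ^ 2 := by nlinarith [sq_nonneg (z - F), sq_nonneg z, sq_nonneg F]
    have h' : τ * (z * F) ≤ z ^ 2 + F ^ 2 := by
      have h0 : 0 ≤ z ^ 2 + F ^ 2 := by positivity
      nlinarith [mul_le_mul_of_nonneg_left h hτ.le, mul_le_mul_of_nonneg_right hτ1 h0]
    nlinarith
  have h8 : ∀ y : ℝ, -(y * q) ≤ a0 / 4 * q ^ 2 + 1 / a0 * y ^ 2 := fun y => by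
    have e : a0 / 4 * q ^ 2 + 1 / a0 * y ^ 2 + y * q = (a0 * q / 2 + y) ^ 2 / a0 := by
      field_simp; ring
    have h0 : 0 ≤ (a0 * q / 2 + y) ^ 2 / a0 := by positivity
    linarith
  have h9 := h8 z
  have h10 := h8 F
  have hc : ∀ c y : ℝ, 0 ≤ c → 0 ≤ c * y ^ 2 := fun c y hc => mul_nonneg hc (sq_nonneg y)
  have k1 := hc (A ^ 2) F (sq_nonneg _)
  have k2 := hc (A ^ 2) z (sq_nonneg _)
  have hq : 0 ≤ (A * a1) ^ 2 / a0 := by positivity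
  have hr : 0 ≤ 1 / a0 := by positivity
  have k3 := hc _ Z hq
  have k4 := hc _ F hq
  have k5 := hc _ G hq
  have k6 := hc _ Z hr
  have k7 := hc _ G hr
  have k8 := hc _ Z hA0.le
  have k9 := hc _ G hA0.le
  have k10 := hc _ F hA0.le
  nlinarith

/-- Dissipation of `V_x` and `W_x` for the linearised system
`V_t = W_x`, `W_t = α V_x + Z_x + F`, `τ Z_t + Z = β W_x + G`. -/
lemma cross_estimate {a0 b0 : ℝ} (a1 : ℝ) (ha0 : 0 < a0) (hb0 : 0 < b0) : ∃ K : ℝ, 0 < K ∧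
    ∀ (T τ : ℝ) (V W Z : Jet) (α β F G : ℝ → ℝ → ℝ) (g : ℝ → ℝ), 0 ≤ T → 0 < τ → τ ≤ 1 →
      Reg (Icc 0 T) V → Reg (Icc 0 T) W → Reg (Icc 0 T) Z → ContinuousOn g (Icc 0 T) →
      (∀ t ∈ Icc 0 T, L2C (F t) ∧ L2C (G t) ∧ n2 (F t) + n2 (G t) ≤ g t) →
      (∀ t ∈ Icc 0 T, ∀ x, a0 ≤ α t x ∧ α t x ≤ a1 ∧ b0 ≤ β t x ∧ V.ft t x = W.fx t x ∧
        W.ft t x = α t x * V.fx t x + Z.fx t x + F t x ∧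
        τ * Z.ft t x + Z.f t x = β t x * W.fx t x + G t x) →
      ∫ s in (0:ℝ)..T, (n2 (W.fx s) + n2 (V.fx s)) ≤
        K * ((∫ s in (0:ℝ)..T, (n2 (Z.f s) + n2 (Z.fx s) + g s))
          + (n2 (V.fx T) + n2 (W.f T) + n2 (W.fx T) + τ * n2 (Z.f T))
          + (n2 (V.fx 0) + n2 (W.f 0) + n2 (W.fx 0) + τ * n2 (Z.f 0))) := by
  set A := 3 / b0 with hA
  have hA0 : 0 < A := by positivity
  set c := min 1 (a0 / 4) with hc
  have hc0 : 0 < c := by positivity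
  set K := A ^ 2 + (A * a1) ^ 2 / a0 + 2 * A + 1 / a0 with hK
  have hK0 : 0 < K := by positivity
  refine ⟨c⁻¹ * (K + A + 1), by positivity, ?_⟩
  intro T τ V W Z α β F G g hT hτ hτ1 hV hW hZ hg hFG heq
  have h0 : (0:ℝ) ∈ Icc 0 T := ⟨le_rfl, hT⟩
  have h1 : T ∈ Icc 0 T := ⟨hT, le_rfl⟩
  obtain ⟨i1, e1⟩ := integral_cross hT hZ hW
  obtain ⟨i2, e2⟩ := integral_cross hT hW hV
  have hcZ := hZ.cf.continuousOn
  have hcZx := hZ.cx.continuousOn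
  have hcW := hW.cx.continuousOn
  have hcV := hV.cx.continuousOn
  rw [← uIcc_of_le hT] at hcZ hcZx hcW hcV hg
  have iL : IntervalIntegrable (fun s => n2 (W.fx s) + n2 (V.fx s)) volume 0 T :=
    (hcW.add hcV).intervalIntegrable
  have iR : IntervalIntegrable (fun s => n2 (Z.f s) + n2 (Z.fx s) + g s) volume 0 T :=
    ((hcZ.add hcZx).add hg).intervalIntegrable
  have slice : ∀ s ∈ Icc 0 T, c * (n2 (W.fx s) + n2 (V.fx s)) ≤
      (A * τ) * (∫ x, (Z.ft s x * W.fx s x - W.ft s x * Z.fx s x))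
      + (∫ x, (W.ft s x * V.fx s x - V.ft s x * W.fx s x))
      + K * (n2 (Z.f s) + n2 (Z.fx s) + g s) := fun s hs => by
    obtain ⟨hF, hG, hFGg⟩ := hFG s hs
    have H1 : HasInt (fun x => Z.ft s x * W.fx s x - W.ft s x * Z.fx s x) _ :=
      ⟨((hZ.ct.1 s hs).mul_int (hW.cx.1 s hs)).sub ((hW.ct.1 s hs).mul_int (hZ.cx.1 s hs)), rfl⟩
    have H2 : HasInt (fun x => W.ft s x * V.fx s x - V.ft s x * W.fx s x) _ :=
      ⟨((hW.ct.1 s hs).mul_int (hV.cx.1 s hs)).sub ((hV.ct.1 s hs).mul_int (hW.cx.1 s hs)), rfl⟩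
    have HL := ((hW.cx.1 s hs).hasInt.add (hV.cx.1 s hs).hasInt).const_mul c
    have HR := ((H1.const_mul (A * τ)).add H2).add
      ((((hZ.cf.1 s hs).hasInt.add (hZ.cx.1 s hs).hasInt).add
        (hF.hasInt.add hG.hasInt)).const_mul K)
    refine (HL.le HR fun x => ?_).trans ?_
    · obtain ⟨k1, k2, k3, k4, k5, k6⟩ := heq s hs x
      have key := cross_pointwise (p := W.fx s x) (q := V.fx s x) (Z := Z.f s x) (z := Z.fx s x)
        (F := F s x) (G := G s x) ha0 hb0 hA k1 k2 k3 hτ hτ1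
      have hcm : c * (W.fx s x ^ 2 + V.fx s x ^ 2) ≤ W.fx s x ^ 2 + a0 / 4 * V.fx s x ^ 2 := by
        have := mul_le_mul_of_nonneg_right (min_le_left 1 (a0 / 4)) (sq_nonneg (W.fx s x))
        have := mul_le_mul_of_nonneg_right (min_le_right 1 (a0 / 4)) (sq_nonneg (V.fx s x))
        linarith
      refine hcm.trans (key.trans (le_of_eq ?_))
      rw [k4, ← k5]
      have : β s x * W.fx s x - Z.f s x + G s x = τ * Z.ft s x := by linarith
      rw [this]; ring
    · have := mul_le_mul_of_nonneg_left hFGg hK0.le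
      linarith
  have hint := intervalIntegral.integral_mono_on hT (iL.const_mul c)
    (((i1.const_mul (A * τ)).add i2).add (iR.const_mul K)) slice
  rw [intervalIntegral.integral_const_mul, intervalIntegral.integral_add
    ((i1.const_mul (A * τ)).add i2) (iR.const_mul K), intervalIntegral.integral_add
    (i1.const_mul (A * τ)) i2, intervalIntegral.integral_const_mul,
    intervalIntegral.integral_const_mul, e1, e2] at hint
  have prod_le : ∀ {f g : ℝ → ℝ}, L2C f → L2C g → |∫ x, f x * g x| ≤ n2 f + n2 g :=
    fun {f g} hf hg => (cauchy_schwarz hf hg).trans <| by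
      nlinarith [sq_nonneg (√(n2 f) - √(n2 g)), Real.sq_sqrt (n2_nonneg f),
        Real.sq_sqrt (n2_nonneg g), n2_nonneg f, n2_nonneg g]
  have p1 := abs_le.1 (prod_le (hZ.cf.1 T h1) (hW.cx.1 T h1))
  have p2 := abs_le.1 (prod_le (hZ.cf.1 0 h0) (hW.cx.1 0 h0))
  have p3 := abs_le.1 (prod_le (hW.cf.1 T h1) (hV.cx.1 T h1))
  have p4 := abs_le.1 (prod_le (hW.cf.1 0 h0) (hV.cx.1 0 h0))
  set R := ∫ s in (0:ℝ)..T, (n2 (Z.f s) + n2 (Z.fx s) + g s) with hR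
  have hR0 : 0 ≤ R := intervalIntegral.integral_nonneg hT fun s hs =>
    add_nonneg (add_nonneg (n2_nonneg _) (n2_nonneg _))
      ((add_nonneg (n2_nonneg _) (n2_nonneg _)).trans (hFG s hs).2.2)
  have q1 : (A * τ) * ((∫ x, Z.f T x * W.fx T x) - ∫ x, Z.f 0 x * W.fx 0 x) ≤
      A * ((n2 (W.fx T) + τ * n2 (Z.f T)) + (n2 (W.fx 0) + τ * n2 (Z.f 0))) := by
    rw [mul_assoc]
    refine mul_le_mul_of_nonneg_left ?_ hA0.le
    have r1 := mul_le_mul_of_nonneg_right hτ1 (n2_nonneg (W.fx T))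
    have r2 := mul_le_mul_of_nonneg_right hτ1 (n2_nonneg (W.fx 0))
    have := mul_le_mul_of_nonneg_left
      (show (∫ x, Z.f T x * W.fx T x) - ∫ x, Z.f 0 x * W.fx 0 x ≤
        (n2 (Z.f T) + n2 (W.fx T)) + (n2 (Z.f 0) + n2 (W.fx 0)) by linarith [p1.2, p2.1]) hτ.le
    linarith
  have n1 := n2_nonneg (V.fx T)
  have n3 := n2_nonneg (W.f T)
  have n4 := n2_nonneg (W.fx T)
  have n5 := mul_nonneg hτ.le (n2_nonneg (Z.f T))
  have n6 := n2_nonneg (V.fx 0)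
  have n7 := n2_nonneg (W.f 0)
  have n8 := n2_nonneg (W.fx 0)
  have n9 := mul_nonneg hτ.le (n2_nonneg (Z.f 0))
  set X := (n2 (V.fx T) + n2 (W.f T) + n2 (W.fx T) + τ * n2 (Z.f T))
    + (n2 (V.fx 0) + n2 (W.f 0) + n2 (W.fx 0) + τ * n2 (Z.f 0)) with hX
  have hX0 : 0 ≤ X := by positivity
  have hfin : c * ∫ s in (0:ℝ)..T, (n2 (W.fx s) + n2 (V.fx s)) ≤ (K + A + 1) * (R + X) := by
    have s1 : A * ((n2 (W.fx T) + τ * n2 (Z.f T)) + (n2 (W.fx 0) + τ * n2 (Z.f 0))) ≤ A * X :=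
      mul_le_mul_of_nonneg_left (by linarith) hA0.le
    have s2 := mul_nonneg hA0.le hR0
    have s3 := mul_nonneg hK0.le hX0
    linarith [p3.2, p4.1]
  rw [mul_assoc, ← div_eq_inv_mul, le_div_iff₀ hc0, mul_comm, add_assoc R]
  exact hfin

/-- Space-time energy balance with a flux. -/
lemma energy_balance {T M : ℝ} (hT : 0 ≤ T) {φ φt q qx : ℝ → ℝ → ℝ} {d : ℝ → ℝ}
    (hd : ∀ s ∈ Icc 0 T, ∀ x, HasDerivAt (fun r => φ r x) (φt s x) s)
    (hc : ContinuousOn (Function.uncurry φt) (Icc 0 T ×ˢ univ))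
    (hb : ∀ s ∈ Icc 0 T, ∃ g : ℝ → ℝ, Integrable g ∧ ∫ x, g x ≤ M ∧ ∀ x, |φt s x| ≤ g x)
    (h0 : Integrable (φ 0)) (h1 : Integrable (φ T))
    (hq : ∀ s ∈ Icc 0 T, (∀ x, HasDerivAt (q s) (qx s x) x) ∧ Integrable (q s) ∧ Integrable (qx s))
    (hr : ∀ s ∈ Icc 0 T, ∃ r : ℝ → ℝ, Integrable r ∧ ∫ x, r x ≤ d s ∧
      ∀ x, φt s x ≤ qx s x + r x)
    (hdi : ContinuousOn d (Icc 0 T)) :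
    ∫ x, φ T x ≤ (∫ x, φ 0 x) + ∫ s in (0:ℝ)..T, d s := by
  obtain ⟨i, e⟩ := integral_time_deriv hT hd hc hb h0 h1
  have hmono : ∫ s in (0:ℝ)..T, ∫ x, φt s x ≤ ∫ s in (0:ℝ)..T, d s := by
    refine intervalIntegral.integral_mono_on hT i ?_ fun s hs => ?_
    · exact ContinuousOn.intervalIntegrable (by rwa [uIcc_of_le hT])
    · obtain ⟨r, hri, hrd, hle⟩ := hr s hs
      obtain ⟨k1, k2, k3⟩ := hq s hs
      obtain ⟨g, hg, -, hgle⟩ := hb s hs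
      have hcs : Continuous (φt s) := by
        have : ContinuousOn (fun x : ℝ => φt s x) univ :=
          hc.comp (f := fun x : ℝ => (s, x)) (by fun_prop) fun x _ => ⟨hs, trivial⟩
        exact continuousOn_univ.1 this
      have := integral_mono (integrable_of_cont_le hcs hg hgle) (k3.add hri) hle
      have e0 : ∫ x, qx s x = 0 := integral_eq_zero_of_hasDerivAt_of_integrable k1 k3 k2
      simp only [Pi.add_apply] at this
      rw [MeasureTheory.integral_add k3 hri, e0] at this
      linarith
  linarith

lemma add_le_of_coercive {c₀ c₁ X Y R : ℝ} (h0 : 0 < c₀) (h1 : 0 < c₁) (hX : 0 ≤ X) (hY : 0 ≤ Y)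
    (h : c₀ * X + c₁ * Y ≤ R) : X + Y ≤ (c₀⁻¹ + c₁⁻¹) * R := by
  have h2 : X ≤ c₀⁻¹ * R := by
    rw [← div_eq_inv_mul, le_div_iff₀ h0]; nlinarith [mul_nonneg h1.le hY]
  have h3 : Y ≤ c₁⁻¹ * R := by
    rw [← div_eq_inv_mul, le_div_iff₀ h1]; nlinarith [mul_nonneg h0.le hX]
  linarith

/-- A solution of the relaxed system in the variables `w = v - 1`, `u`, `S`, which together with
its relevant space derivatives is pointwise bounded by `e`. -/
structure Sol (a μ γ τ T e : ℝ) (w u S : Jet) : Prop where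
  hμ : 0 < μ
  ha : |a| ≤ 1
  hτ : 0 < τ
  hτ1 : τ ≤ 1
  hT : 0 ≤ T
  he : 0 < e
  he1 : e ≤ 1 / 2
  heμ : e ≤ μ / 4
  hw : Reg (Icc 0 T) w
  hu : Reg (Icc 0 T) u
  hS : Reg (Icc 0 T) S
  eq1 : ∀ t ∈ Icc 0 T, ∀ x, w.ft t x = u.fx t x
  eq2 : ∀ t ∈ Icc 0 T, ∀ x,
    u.ft t x = γ * (1 + w.f t x) ^ (-γ - 1) * w.fx t x + S.fx t x
  eq3 : ∀ t ∈ Icc 0 T, ∀ x,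
    τ * S.ft t x + S.f t x = (μ + 2 * a * τ * S.f t x) / (1 + w.f t x) * u.fx t x
  bw : ∀ t ∈ Icc 0 T, ∀ x, |w.f t x| ≤ e
  bwx : ∀ t ∈ Icc 0 T, ∀ x, |w.fx t x| ≤ e
  bux : ∀ t ∈ Icc 0 T, ∀ x, |u.fx t x| ≤ e
  bS : ∀ t ∈ Icc 0 T, ∀ x, |τ * S.f t x| ≤ e
  bSx : ∀ t ∈ Icc 0 T, ∀ x, |τ * S.fx t x| ≤ e

lemma Sol.v_mem {a μ γ τ T e : ℝ} {w u S : Jet}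
    (h : Sol a μ γ τ T e w u S) {t : ℝ} (ht : t ∈ Icc 0 T) (x : ℝ) :
    1 + w.f t x ∈ Icc (1 / 2 : ℝ) (3 / 2) := by
  have := abs_le.1 ((h.bw t ht x).trans h.he1)
  constructor <;> linarith [this.1, this.2]

lemma Sol.v_pos {a μ γ τ T e : ℝ} {w u S : Jet}
    (h : Sol a μ γ τ T e w u S) {t : ℝ} (ht : t ∈ Icc 0 T) (x : ℝ) : 0 < 1 + w.f t x :=
  lt_of_lt_of_le (by norm_num) (h.v_mem ht x).1

lemma Sol.abs_aS_le {a μ γ τ T e : ℝ} {w u S : Jet}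
    (h : Sol a μ γ τ T e w u S) {t : ℝ} (ht : t ∈ Icc 0 T) (x : ℝ) :
    |2 * a * τ * S.f t x| ≤ 2 * e := by
  have e1 : 2 * a * τ * S.f t x = 2 * (a * (τ * S.f t x)) := by ring
  rw [e1, abs_mul, abs_mul, abs_two]
  have := mul_le_mul h.ha (h.bS t ht x) (abs_nonneg _) zero_le_one
  linarith

lemma Sol.m_mem {a μ γ τ T e : ℝ} {w u S : Jet}
    (h : Sol a μ γ τ T e w u S) {t : ℝ} (ht : t ∈ Icc 0 T) (x : ℝ) :
    μ + 2 * a * τ * S.f t x ∈ Icc (μ / 2) (3 * μ / 2) := by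
  have := h.heμ
  have := abs_le.1 (h.abs_aS_le ht x)
  constructor <;> linarith [this.1, this.2]

lemma Sol.m_pos {a μ γ τ T e : ℝ} {w u S : Jet}
    (h : Sol a μ γ τ T e w u S) {t : ℝ} (ht : t ∈ Icc 0 T) (x : ℝ) : 0 < μ + 2 * a * τ * S.f t x :=
  lt_of_lt_of_le (by linarith [h.hμ]) (h.m_mem ht x).1

lemma Sol.viscosity_mem {a μ γ τ T e : ℝ} {w u S : Jet}
    (h : Sol a μ γ τ T e w u S) {t : ℝ} (ht : t ∈ Icc 0 T) (x : ℝ) :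
    (μ + 2 * a * τ * S.f t x) / (1 + w.f t x) ∈ Icc (μ / 3) (3 * μ) := by
  have h1 := h.v_mem ht x
  have h2 := h.m_mem ht x
  have h3 := h.v_pos ht x
  have := h.hμ
  constructor
  · rw [le_div_iff₀ h3]; nlinarith [h1.2, h2.1]
  · rw [div_le_iff₀ h3]; nlinarith [h1.1, h2.2]

lemma Sol.modulus_mem {a μ γ τ T e : ℝ} {w u S : Jet}
    (h : Sol a μ γ τ T e w u S) {t : ℝ} (ht : t ∈ Icc 0 T) (x : ℝ) :
    (1 + w.f t x) / (μ + 2 * a * τ * S.f t x) ∈ Icc (1 / (3 * μ)) (3 / μ) := by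
  have h1 := h.v_mem ht x
  have h2 := h.m_mem ht x
  have h3 := h.m_pos ht x
  have hμ := h.hμ
  constructor
  · rw [div_le_div_iff₀ (by positivity) h3]; nlinarith [h1.1, h2.2]
  · rw [div_le_div_iff₀ h3 hμ]; nlinarith [h1.2, h2.1]

lemma Sol.continuousOn_v {a μ γ τ T e : ℝ} {w u S : Jet}
    (h : Sol a μ γ τ T e w u S) : ContinuousOn (Function.uncurry fun t x => 1 + w.f t x)
    (Icc 0 T ×ˢ univ) := continuousOn_const.add h.hw.jf.1

lemma Sol.continuousOn_v_rpow {a μ γ τ T e : ℝ} {w u S : Jet}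
    (h : Sol a μ γ τ T e w u S) (p : ℝ) :
    ContinuousOn (Function.uncurry fun t x => (1 + w.f t x) ^ p) (Icc 0 T ×ˢ univ) :=
  h.continuousOn_v.rpow_const fun y hy => Or.inl (h.v_pos hy.1 y.2).ne'

lemma Sol.continuousOn_m {a μ γ τ T e : ℝ} {w u S : Jet}
    (h : Sol a μ γ τ T e w u S) : ContinuousOn (Function.uncurry fun t x => μ + 2 * a * τ * S.f t x)
    (Icc 0 T ×ˢ univ) := continuousOn_const.add (continuousOn_const.mul h.hS.jf.1)

lemma Sol.mono {a μ γ τ T e : ℝ} {w u S : Jet}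
    (h : Sol a μ γ τ T e w u S) {T' : ℝ} (hT' : 0 ≤ T') (hle : T' ≤ T) :
    Sol a μ γ τ T' e w u S := by
  have hs : Icc 0 T' ⊆ Icc 0 T := Icc_subset_Icc_right hle
  exact { hμ := h.hμ, ha := h.ha, hτ := h.hτ, hτ1 := h.hτ1, hT := hT', he := h.he, he1 := h.he1,
          heμ := h.heμ, hw := h.hw.mono hs, hu := h.hu.mono hs, hS := h.hS.mono hs,
          eq1 := fun t ht => h.eq1 t (hs ht), eq2 := fun t ht => h.eq2 t (hs ht),
          eq3 := fun t ht => h.eq3 t (hs ht), bw := fun t ht => h.bw t (hs ht),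
          bwx := fun t ht => h.bwx t (hs ht), bux := fun t ht => h.bux t (hs ht),
          bS := fun t ht => h.bS t (hs ht), bSx := fun t ht => h.bSx t (hs ht) }

lemma CL2.intervalIntegrable {T : ℝ} (hT : 0 ≤ T) {f : ℝ → ℝ → ℝ} (hf : CL2 (Icc 0 T) f) :
    IntervalIntegrable (fun s => n2 (f s)) volume 0 T :=
  ContinuousOn.intervalIntegrable (by rw [uIcc_of_le hT]; exact hf.continuousOn)

/-- The basic energy estimate. -/
lemma basic_energy {μ γ : ℝ} (hμ : 0 < μ) (hγ : 1 < γ) : ∃ K : ℝ, 0 < K ∧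
    ∀ (a τ T e : ℝ) (w u S : Jet), Sol a μ γ τ T e w u S →
      (n2 (w.f T) + n2 (u.f T) + τ * n2 (S.f T)) + (∫ s in (0:ℝ)..T, n2 (S.f s)) ≤
        K * ((n2 (w.f 0) + n2 (u.f 0) + τ * n2 (S.f 0))
          + e * ∫ s in (0:ℝ)..T, (n2 (S.f s) + n2 (u.fx s))) := by
  obtain ⟨k, K, hk, hK, hp⟩ := pressure_bounds hγ
  set c := min k (min (1 / 2) (1 / (2 * μ))) with hc
  have hc0 : 0 < c := by positivity
  have hμi : 0 < 1 / μ := by positivity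
  refine ⟨(c⁻¹ + (1 / μ)⁻¹) * (K + 1 / 2 + 1 / (2 * μ) + (4 + 2 * μ) / μ), by positivity, ?_⟩
  intro a τ T e w u S h
  have hT := h.hT
  have hτ := h.hτ
  have he := h.he
  have h0 : (0:ℝ) ∈ Icc 0 T := ⟨le_rfl, hT⟩
  have h1 : T ∈ Icc 0 T := ⟨hT, le_rfl⟩
  set φ : ℝ → ℝ → ℝ := fun s x => entropy γ (1 + w.f s x) + (u.f s x) ^ 2 / 2
    + τ / (2 * μ) * (S.f s x) ^ 2 with hφ
  have hφc : ∀ s ∈ Icc 0 T, Continuous (φ s) := fun s hs => by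
    have e1 : Continuous fun x => entropy γ (1 + w.f s x) :=
      continuous_iff_continuousAt.2 fun x =>
        ContinuousAt.comp (f := fun x => 1 + w.f s x) (g := entropy γ)
          (hasDerivAt_entropy hγ (h.v_pos hs x)).continuousAt
          (continuous_const.add (h.hw.cf.1 s hs).cont).continuousAt
    exact (e1.add (((h.hu.cf.1 s hs).cont.pow 2).div_const 2)).add
      (((h.hS.cf.1 s hs).cont.pow 2).const_mul _)
  have hup : ∀ s ∈ Icc 0 T, ∀ x, φ s x ≤ (K + 1 / 2 + 1 / (2 * μ)) *
      (w.f s x ^ 2 + u.f s x ^ 2 + τ * S.f s x ^ 2) := fun s hs x => by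
    have q := (hp _ (h.v_mem hs x)).2.2.2.2.2.2
    rw [add_sub_cancel_left] at q
    have q1 := sq_nonneg (w.f s x)
    have q2 := sq_nonneg (u.f s x)
    have q3 := mul_nonneg hτ.le (sq_nonneg (S.f s x))
    have hm : 0 < 1 / (2 * μ) := by positivity
    have e1 : τ / (2 * μ) * (S.f s x) ^ 2 = 1 / (2 * μ) * (τ * S.f s x ^ 2) := by ring
    simp only [hφ]
    rw [e1]
    have := mul_nonneg hK.le q2
    have := mul_nonneg hK.le q3
    have := mul_nonneg hm.le q1
    have := mul_nonneg hm.le q2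
    linarith
  have hlo : ∀ s ∈ Icc 0 T, ∀ x, c * (w.f s x ^ 2 + u.f s x ^ 2 + τ * S.f s x ^ 2) ≤ φ s x :=
    fun s hs x => by
    have q := (hp _ (h.v_mem hs x)).2.2.2.2.2.1
    rw [add_sub_cancel_left] at q
    have e1 : τ / (2 * μ) * (S.f s x) ^ 2 = 1 / (2 * μ) * (τ * S.f s x ^ 2) := by ring
    simp only [hφ]
    rw [e1]
    have l1 := mul_le_mul_of_nonneg_right (show c ≤ k from min_le_left _ _) (sq_nonneg (w.f s x))
    have l2 := mul_le_mul_of_nonneg_right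
      (show c ≤ 1 / 2 from (min_le_right _ _).trans (min_le_left _ _)) (sq_nonneg (u.f s x))
    have l3 := mul_le_mul_of_nonneg_right
      (show c ≤ 1 / (2 * μ) from (min_le_right _ _).trans (min_le_right _ _))
      (mul_nonneg hτ.le (sq_nonneg (S.f s x)))
    linarith
  have hM : ∀ s ∈ Icc 0 T, HasInt (fun x => w.f s x ^ 2 + u.f s x ^ 2 + τ * S.f s x ^ 2)
      (n2 (w.f s) + n2 (u.f s) + τ * n2 (S.f s)) := fun s hs =>
    ((h.hw.cf.1 s hs).hasInt.add (h.hu.cf.1 s hs).hasInt).add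
      ((h.hS.cf.1 s hs).hasInt.const_mul τ)
  have hφi : ∀ s ∈ Icc 0 T, HasInt (φ s) (∫ x, φ s x) := fun s hs =>
    ⟨integrable_of_cont_le (hφc s hs) ((hM s hs).const_mul (K + 1 / 2 + 1 / (2 * μ))).1 fun x => by
      rw [abs_of_nonneg ((mul_nonneg hc0.le (by positivity)).trans (hlo s hs x))]
      exact hup s hs x, rfl⟩
  obtain ⟨B1, hB10, hB1⟩ := h.hw.cf.bounded
  obtain ⟨B2, hB20, hB2⟩ := h.hw.ct.bounded
  obtain ⟨B3, hB30, hB3⟩ := h.hu.cf.bounded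
  obtain ⟨B4, hB40, hB4⟩ := h.hu.ct.bounded
  obtain ⟨B5, hB50, hB5⟩ := h.hS.cf.bounded
  obtain ⟨B6, hB60, hB6⟩ := h.hS.ct.bounded
  have hbal := energy_balance (φ := φ) (T := T) (M := K * (B1 + B2) + (B3 + B4) + τ / μ * (B5 + B6))
    (φt := fun s x => (1 - (1 + w.f s x) ^ (-γ)) * w.ft s x + u.f s x * u.ft s x
      + τ / μ * (S.f s x * S.ft s x))
    (q := fun s x => (1 - (1 + w.f s x) ^ (-γ)) * u.f s x + u.f s x * S.f s x)
    (qx := fun s x => (γ * (1 + w.f s x) ^ (-γ - 1) * w.fx s x) * u.f s x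
      + (1 - (1 + w.f s x) ^ (-γ)) * u.fx s x + (u.fx s x * S.f s x + u.f s x * S.fx s x))
    (d := fun s => (4 + 2 * μ) / μ * e * (n2 (S.f s) + n2 (u.fx s)) - 1 / μ * n2 (S.f s))
    hT ?_ ?_ ?_ (hφi 0 h0).1 (hφi T h1).1 ?_ ?_ ?_
  · have iS := h.hS.cf.intervalIntegrable hT
    have iu := h.hu.cx.intervalIntegrable hT
    rw [intervalIntegral.integral_sub ((iS.add iu).const_mul _) (iS.const_mul _),
      intervalIntegral.integral_const_mul, intervalIntegral.integral_const_mul] at hbal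
    have l1 := ((hM T h1).const_mul c).le (hφi T h1) (hlo T h1)
    have l2 := (hφi 0 h0).le ((hM 0 h0).const_mul _) (hup 0 h0)
    have nS : 0 ≤ ∫ s in (0:ℝ)..T, n2 (S.f s) :=
      intervalIntegral.integral_nonneg hT fun s _ => n2_nonneg _
    have nD : 0 ≤ ∫ s in (0:ℝ)..T, (n2 (S.f s) + n2 (u.fx s)) :=
      intervalIntegral.integral_nonneg hT fun s _ => add_nonneg (n2_nonneg _) (n2_nonneg _)
    have n1 : ∀ s : ℝ, 0 ≤ n2 (w.f s) + n2 (u.f s) + τ * n2 (S.f s) := fun s =>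
      add_nonneg (add_nonneg (n2_nonneg _) (n2_nonneg _)) (mul_nonneg hτ.le (n2_nonneg _))
    refine (add_le_of_coercive hc0 hμi (n1 T) nS (R := (K + 1 / 2 + 1 / (2 * μ)) *
      (n2 (w.f 0) + n2 (u.f 0) + τ * n2 (S.f 0)) + (4 + 2 * μ) / μ * e *
        ∫ s in (0:ℝ)..T, (n2 (S.f s) + n2 (u.fx s))) (by linarith)).trans ?_
    rw [mul_assoc (c⁻¹ + (1 / μ)⁻¹)]
    refine mul_le_mul_of_nonneg_left ?_ (by positivity)
    have m1 := mul_nonneg (show 0 ≤ (4 + 2 * μ) / μ by positivity) (n1 0)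
    have m2 := mul_nonneg (show 0 ≤ K + 1 / 2 + 1 / (2 * μ) by positivity) (mul_nonneg he.le nD)
    linarith
  · intro s hs x
    have d1 := (hasDerivAt_entropy hγ (h.v_pos hs x)).comp (h := fun r => 1 + w.f r x) s
      ((h.hw.dt s hs x).const_add 1)
    have d2 := ((h.hu.dt s hs x).fun_pow 2).div_const 2
    have d3 := ((h.hS.dt s hs x).fun_pow 2).const_mul (τ / (2 * μ))
    refine ((d1.fun_add d2).fun_add d3).congr_deriv ?_
    field_simp
    ring
  · exact ((((continuousOn_const.sub (h.continuousOn_v_rpow _)).mul h.hw.jt.1).add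
      (h.hu.jf.1.mul h.hu.jt.1))).add (continuousOn_const.mul (h.hS.jf.1.mul h.hS.jt.1))
  · intro s hs
    have hI := ((((h.hw.cf.1 s hs).hasInt.add (h.hw.ct.1 s hs).hasInt).const_mul K).add
      ((h.hu.cf.1 s hs).hasInt.add (h.hu.ct.1 s hs).hasInt)).add
      (((h.hS.cf.1 s hs).hasInt.add (h.hS.ct.1 s hs).hasInt).const_mul (τ / μ))
    refine ⟨_, hI.1, ?_, fun x => ?_⟩
    · rw [hI.2]
      have := hB1 s hs
      have := hB2 s hs
      have := hB3 s hs
      have := hB4 s hs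
      have := hB5 s hs
      have := hB6 s hs
      gcongr
    · have young : ∀ p q : ℝ, |p * q| ≤ p ^ 2 + q ^ 2 := fun p q => by
        rw [abs_le]; constructor <;> nlinarith [sq_nonneg (p + q), sq_nonneg (p - q)]
      refine (abs_add_le _ _).trans (add_le_add ((abs_add_le _ _).trans (add_le_add ?_ ?_)) ?_)
      · have q := (hp _ (h.v_mem hs x)).2.2.2.2.1
        rw [add_sub_cancel_left] at q
        rw [abs_mul]
        have := young (w.f s x) (w.ft s x)
        rw [abs_mul] at this
        refine (mul_le_mul_of_nonneg_right q (abs_nonneg _)).trans ?_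
        rw [mul_assoc]
        exact mul_le_mul_of_nonneg_left this hK.le
      · exact young _ _
      · rw [abs_mul, abs_of_pos (by positivity : 0 < τ / μ)]
        exact mul_le_mul_of_nonneg_left (young _ _) (by positivity)
  · intro s hs
    have cv : Continuous fun x => 1 + w.f s x := continuous_const.add (h.hw.cf.1 s hs).cont
    have cvp : ∀ p : ℝ, Continuous fun x => (1 + w.f s x) ^ p := fun p =>
      cv.rpow_const fun x => Or.inl (h.v_pos hs x).ne'
    have hq1 : ∀ x, |1 - (1 + w.f s x) ^ (-γ)| ≤ K := fun x => by
      have q := (hp _ (h.v_mem hs x)).2.2.2.2.1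
      rw [add_sub_cancel_left] at q
      have := (h.bw s hs x).trans h.he1
      nlinarith
    have hq2 : ∀ x, |γ * (1 + w.f s x) ^ (-γ - 1)| ≤ K := fun x => by
      have q := hp _ (h.v_mem hs x)
      rw [abs_of_nonneg (hk.le.trans q.1)]
      exact q.2.1
    have hpL : L2C fun x => 1 - (1 + w.f s x) ^ (-γ) := by
      refine L2C.of_sq_le (continuous_const.sub (cvp _))
        ((h.hw.cf.1 s hs).int.const_mul (K ^ 2)) fun x => ?_
      have q := (hp _ (h.v_mem hs x)).2.2.2.2.1
      rw [add_sub_cancel_left] at q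
      calc (1 - (1 + w.f s x) ^ (-γ)) ^ 2 = |1 - (1 + w.f s x) ^ (-γ)| ^ 2 := (sq_abs _).symm
        _ ≤ (K * |w.f s x|) ^ 2 := by gcongr
        _ = K ^ 2 * w.f s x ^ 2 := by rw [mul_pow, sq_abs]
    have haL : L2C fun x => γ * (1 + w.f s x) ^ (-γ - 1) * w.fx s x :=
      (h.hw.cx.1 s hs).bdd_mul ((cvp _).const_mul γ) hq2
    refine ⟨fun x => ?_, ?_, ?_⟩
    · have d1 := (Real.hasDerivAt_rpow_const (p := -γ) (Or.inl (h.v_pos hs x).ne')).comp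
        (h := fun y => 1 + w.f s y) x ((h.hw.dx s hs x).const_add 1)
      have d2 := (d1.const_sub 1).fun_mul (h.hu.dx s hs x)
      refine (d2.fun_add ((h.hu.dx s hs x).fun_mul (h.hS.dx s hs x))).congr_deriv ?_
      simp only [Function.comp_apply]
      ring
    · exact (hpL.mul_int (h.hu.cf.1 s hs)).add ((h.hu.cf.1 s hs).mul_int (h.hS.cf.1 s hs))
    · exact ((haL.mul_int (h.hu.cf.1 s hs)).add (hpL.mul_int (h.hu.cx.1 s hs))).add
        (((h.hu.cx.1 s hs).mul_int (h.hS.cf.1 s hs)).add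
          ((h.hu.cf.1 s hs).mul_int (h.hS.cx.1 s hs)))
  · intro s hs
    have hI := (((h.hS.cf.1 s hs).hasInt.add (h.hu.cx.1 s hs).hasInt).const_mul
      ((4 + 2 * μ) / μ * e)).add ((h.hS.cf.1 s hs).hasInt.const_mul (-(1 / μ)))
    refine ⟨_, hI.1, ?_, fun x => ?_⟩
    · rw [hI.2]
      exact le_of_eq (by ring)
    · have e3 : τ * S.ft s x = (μ + 2 * a * τ * S.f s x) / (1 + w.f s x) * u.fx s x - S.f s x := by
        linarith [h.eq3 s hs x]
      have e4 : τ / μ * (S.f s x * S.ft s x) = 1 / μ * S.f s x * (τ * S.ft s x) := by ring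
      rw [e4, e3, h.eq1 s hs x, h.eq2 s hs x]
      set b := (μ + 2 * a * τ * S.f s x) / (1 + w.f s x) with hb
      have hv := h.v_mem hs x
      have hv0 := h.v_pos hs x
      have hbμ : |b / μ - 1| ≤ (4 + 2 * μ) / μ * e := by
        have e5 : b / μ - 1 = (2 * a * τ * S.f s x - μ * w.f s x) / (μ * (1 + w.f s x)) := by
          rw [hb]; field_simp; ring
        rw [e5, abs_div, abs_of_pos (by positivity : 0 < μ * (1 + w.f s x)), div_le_iff₀ (by positivity)]
        have t1 := h.abs_aS_le hs x
        have t2 : |μ * w.f s x| ≤ μ * e := by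
          rw [abs_mul, abs_of_pos hμ]; exact mul_le_mul_of_nonneg_left (h.bw s hs x) hμ.le
        have e6 : (4 + 2 * μ) / μ * e * (μ * (1 + w.f s x)) = (2 * e + μ * e) * (2 * (1 + w.f s x)) := by
          field_simp; ring
        rw [e6]
        have : 2 * e + μ * e ≤ (2 * e + μ * e) * (2 * (1 + w.f s x)) :=
          le_mul_of_one_le_right (by positivity) (by linarith [hv.1])
        exact (abs_sub _ _).trans (by linarith)
      have hcr : (b / μ - 1) * (S.f s x * u.fx s x) ≤
          (4 + 2 * μ) / μ * e * (S.f s x ^ 2 + u.fx s x ^ 2) := by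
        refine (le_abs_self _).trans ?_
        rw [abs_mul]
        refine mul_le_mul hbμ ?_ (abs_nonneg _) (by positivity)
        rw [abs_le]; constructor <;> nlinarith [sq_nonneg (S.f s x + u.fx s x),
          sq_nonneg (S.f s x - u.fx s x)]
      have e7 : 1 / μ * S.f s x * (b * u.fx s x - S.f s x) =
          (b / μ - 1) * (S.f s x * u.fx s x) + S.f s x * u.fx s x - 1 / μ * S.f s x ^ 2 := by
        field_simp; ring
      rw [e7]
      linarith
  · exact (continuousOn_const.mul (h.hS.cf.continuousOn.add h.hu.cx.continuousOn)).sub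
      (continuousOn_const.mul h.hS.cf.continuousOn)

lemma L2C.comb {f g p q : ℝ → ℝ} {P Q : ℝ} (hf : L2C f) (hg : L2C g) (hp : Continuous p)
    (hq : Continuous q) (hP : ∀ x, |p x| ≤ P) (hQ : ∀ x, |q x| ≤ Q) :
    L2C (fun x => p x * f x + q x * g x) ∧
      n2 (fun x => p x * f x + q x * g x) ≤ 2 * (P ^ 2 * n2 f + Q ^ 2 * n2 g) := by
  have hL := (hf.bdd_mul hp hP).add (hg.bdd_mul hq hQ)
  have hI := ((hf.hasInt.const_mul (P ^ 2)).add (hg.hasInt.const_mul (Q ^ 2))).const_mul 2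
  refine ⟨hL, hL.hasInt.le hI fun x => ?_⟩
  have h1 : (p x * f x) ^ 2 ≤ P ^ 2 * f x ^ 2 := by
    rw [mul_pow]
    exact mul_le_mul_of_nonneg_right (sq_le_sq' (abs_le.1 (hP x)).1 (abs_le.1 (hP x)).2)
      (sq_nonneg _)
  have h2 : (q x * g x) ^ 2 ≤ Q ^ 2 * g x ^ 2 := by
    rw [mul_pow]
    exact mul_le_mul_of_nonneg_right (sq_le_sq' (abs_le.1 (hQ x)).1 (abs_le.1 (hQ x)).2)
      (sq_nonneg _)
  nlinarith [sq_nonneg (p x * f x - q x * g x)]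

lemma commutator_one {a a1 b : ℝ → ℝ} {A h : ℝ} (hh : 0 < h) (ha : ∀ x, HasDerivAt a (a1 x) x)
    (hA : ∀ x, |a1 x| ≤ A) (hb : L2C b) :
    L2C (fun x => dq h (fun y => a y * b y) x - a x * dq h b x) ∧
      n2 (fun x => dq h (fun y => a y * b y) x - a x * dq h b x) ≤ A ^ 2 * n2 b := by
  have e : (fun x => dq h (fun y => a y * b y) x - a x * dq h b x)
      = fun x => dq h a x * b (x + h) := by
    funext x; simp only [dq]; ring
  have hac : Continuous a := continuous_iff_continuousAt.2 fun x => (ha x).continuousAt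
  have hdc : Continuous (dq h a) :=
    ((hac.comp (continuous_id.add continuous_const)).sub hac).div_const h
  rw [e]
  have hL := (hb.shift h).bdd_mul hdc (abs_dq_le ha hh hA)
  refine ⟨hL, ?_⟩
  rw [← n2_shift b h]
  refine hL.hasInt.le ((hb.shift h).hasInt.const_mul (A ^ 2)) fun x => ?_
  have := abs_le.1 (abs_dq_le ha hh hA x)
  rw [mul_pow]
  exact mul_le_mul_of_nonneg_right (sq_le_sq' this.1 this.2) (sq_nonneg _)

lemma L2C.dq_of_deriv {f f1 : ℝ → ℝ} (hd : ∀ x, HasDerivAt f (f1 x) x) (hf1 : L2C f1) {h : ℝ}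
    (hh : h ≠ 0) : L2C (_root_.dq h f) := by
  have e : _root_.dq h f = fun x => ∫ θ in (0:ℝ)..1, f1 (x + h * θ) :=
    funext (dq_eq_average hd hf1.cont hh)
  rw [e]
  exact (L2C.average (w := fun θ x => f1 (x + h * θ)) (hf1.cont.comp (by fun_prop)) fun θ =>
    ⟨hf1.shift _, (n2_shift f1 (h * θ)).le⟩).1

lemma commutator_two {a a1 a2 b b1 : ℝ → ℝ} {A B h : ℝ} (hh : 0 < h)
    (ha : ∀ x, HasDerivAt a (a1 x) x) (ha1 : ∀ x, HasDerivAt a1 (a2 x) x) (hA : ∀ x, |a1 x| ≤ A)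
    (hL1 : L2C a1) (hL2 : L2C a2) (hb : ∀ x, HasDerivAt b (b1 x) x) (hB : ∀ x, |b x| ≤ B)
    (hLb : L2C b) (hLb1 : L2C b1) :
    L2C (fun x => dq h (dq h fun y => a y * b y) x - a x * dq h (dq h b) x) ∧
      n2 (fun x => dq h (dq h fun y => a y * b y) x - a x * dq h (dq h b) x) ≤
        2 * ((2 * A) ^ 2 * n2 b1 + B ^ 2 * n2 a2) := by
  have e : (fun x => dq h (dq h fun y => a y * b y) x - a x * dq h (dq h b) x)
      = fun x => (2 * dq h a x) * dq h b (x + h) + b (x + h + h) * dq h (dq h a) x := by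
    funext x; simp only [dq]; ring
  have hac : Continuous a := continuous_iff_continuousAt.2 fun x => (ha x).continuousAt
  have hdc : Continuous (dq h a) :=
    ((hac.comp (continuous_id.add continuous_const)).sub hac).div_const h
  have hda := abs_dq_le ha hh hA
  have hdda := (L2C.dq_of_deriv ha hL1 hh.ne').dq h
  have hc := ((hLb.dq h).shift h).comb hdda (hdc.const_mul 2)
    (((hLb.shift h).shift h).cont) (P := 2 * A) (Q := B)
    (fun x => by
      rw [abs_mul, abs_two]
      exact mul_le_mul_of_nonneg_left (hda x) zero_le_two)
    (fun x => hB (x + h + h))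
  rw [e]
  refine ⟨hc.1, hc.2.trans ?_⟩
  rw [n2_shift]
  have n1 := n2_dq_le hb hLb1 h
  have n3 := (n2_dq_le (HasDerivAt.dq ha h) (hL1.dq h) h).trans (n2_dq_le ha1 hL2 h)
  gcongr

/-- The dissipation functional in terms of jets. -/
def diss (w u S : Jet) (s : ℝ) : ℝ :=
  n2 (w.fx s) + n2 (w.fxx s) + n2 (u.fx s) + n2 (u.fxx s) + n2 (S.f s) + n2 (S.fx s) + n2 (S.fxx s)

lemma diss_nonneg (w u S : Jet) (s : ℝ) : 0 ≤ diss w u S s := by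
  have := n2_nonneg (w.fx s)
  have := n2_nonneg (w.fxx s)
  have := n2_nonneg (u.fx s)
  have := n2_nonneg (u.fxx s)
  have := n2_nonneg (S.f s)
  have := n2_nonneg (S.fx s)
  have := n2_nonneg (S.fxx s)
  unfold diss
  positivity

lemma le_diss (w u S : Jet) (s : ℝ) :
    n2 (w.fx s) + n2 (w.fxx s) ≤ diss w u S s ∧ n2 (u.fx s) + n2 (u.fxx s) ≤ diss w u S s ∧
      n2 (w.fx s) + n2 (w.fxx s) + n2 (S.fxx s) ≤ diss w u S s ∧
      n2 (w.fxx s) + n2 (u.fxx s) + n2 (S.fxx s) ≤ diss w u S s := by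
  have := n2_nonneg (w.fx s)
  have := n2_nonneg (w.fxx s)
  have := n2_nonneg (u.fx s)
  have := n2_nonneg (u.fxx s)
  have := n2_nonneg (S.f s)
  have := n2_nonneg (S.fx s)
  have := n2_nonneg (S.fxx s)
  unfold diss
  refine ⟨?_, ?_, ?_, ?_⟩ <;> linarith

lemma sound_speed_derivs {γ : ℝ} (hγ : 1 < γ) : ∃ K : ℝ, 0 < K ∧
    ∀ (a μ τ T e : ℝ) (w u S : Jet), Sol a μ γ τ T e w u S → ∀ s ∈ Icc 0 T,
      ∃ a1 a2 : ℝ → ℝ,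
        (∀ x, HasDerivAt (fun y => γ * (1 + w.f s y) ^ (-γ - 1)) (a1 x) x) ∧
        (∀ x, HasDerivAt a1 (a2 x) x) ∧ (∀ x, |a1 x| ≤ K * e) ∧ L2C a1 ∧ L2C a2 ∧
        n2 a2 ≤ K * diss w u S s := by
  obtain ⟨k, K, hk, hK, hp⟩ := pressure_bounds hγ
  refine ⟨K + 2 * K ^ 2, by positivity, ?_⟩
  intro a μ τ T e w u S h s hs
  have he := h.he
  have cvp : ∀ p : ℝ, Continuous fun x => (1 + w.f s x) ^ p := fun p =>
    (continuous_const.add (h.hw.cf.1 s hs).cont).rpow_const fun x => Or.inl (h.v_pos hs x).ne'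
  have hd : ∀ c p : ℝ, ∀ x, HasDerivAt (fun y => c * (1 + w.f s y) ^ p)
      (c * p * (1 + w.f s x) ^ (p - 1) * w.fx s x) x := fun c p x =>
    (hasDerivAt_mul_rpow (h.v_pos hs x)).comp (h := fun y => 1 + w.f s y) x
      ((h.hw.dx s hs x).const_add 1)
  have hb1 : ∀ x, |γ * (-γ - 1) * (1 + w.f s x) ^ (-γ - 1 - 1)| ≤ K := fun x =>
    (hp _ (h.v_mem hs x)).2.2.1
  have hb2 : ∀ x, |γ * (-γ - 1) * (-γ - 1 - 1) * (1 + w.f s x) ^ (-γ - 1 - 1 - 1) * w.fx s x| ≤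
      K * 1 := fun x => by
    rw [abs_mul]
    exact mul_le_mul (hp _ (h.v_mem hs x)).2.2.2.1 ((h.bwx s hs x).trans (h.he1.trans (by norm_num)))
      (abs_nonneg _) hK.le
  have hc := (h.hw.cx.1 s hs).comb (h.hw.cxx.1 s hs)
    (((cvp (-γ - 1 - 1 - 1)).const_mul _).mul (h.hw.cx.1 s hs).cont)
    ((cvp (-γ - 1 - 1)).const_mul _) hb2 hb1
  refine ⟨_, _, hd γ (-γ - 1), fun x => (hd _ _ x).fun_mul (h.hw.dxx s hs x), fun x => ?_,
    (h.hw.cx.1 s hs).bdd_mul ((cvp (-γ - 1 - 1)).const_mul _) hb1, hc.1, hc.2.trans ?_⟩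
  · rw [abs_mul]
    refine (mul_le_mul (hb1 x) (h.bwx s hs x) (abs_nonneg _) hK.le).trans ?_
    exact mul_le_mul_of_nonneg_right (by nlinarith) he.le
  · have := mul_le_mul_of_nonneg_left (le_diss w u S s).1 (show 0 ≤ 2 * K ^ 2 by positivity)
    nlinarith [mul_nonneg hK.le (diss_nonneg w u S s)]

lemma viscosity_derivs {μ : ℝ} (hμ : 0 < μ) : ∃ K : ℝ, 0 < K ∧
    ∀ (a γ τ T e : ℝ) (w u S : Jet), Sol a μ γ τ T e w u S → ∀ s ∈ Icc 0 T,
      ∃ b1 b2 : ℝ → ℝ,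
        (∀ x, HasDerivAt (fun y => (μ + 2 * a * τ * S.f s y) / (1 + w.f s y)) (b1 x) x) ∧
        (∀ x, HasDerivAt b1 (b2 x) x) ∧ (∀ x, |b1 x| ≤ K * e) ∧ L2C b1 ∧ L2C b2 ∧
        n2 b2 ≤ K * diss w u S s := by
  set K1 := 4 + 6 * μ with hK1
  refine ⟨K1 + 4 * (4 ^ 2 + (6 * μ) ^ 2 + (4 * K1) ^ 2), by positivity, ?_⟩
  intro a γ τ T e w u S h s hs
  have he := h.he
  have hτ := h.hτ
  have cv : Continuous fun x => 1 + w.f s x := continuous_const.add (h.hw.cf.1 s hs).cont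
  have cm : Continuous fun x => μ + 2 * a * τ * S.f s x :=
    continuous_const.add ((h.hS.cf.1 s hs).cont.const_mul _)
  have hv0 : ∀ x, 1 + w.f s x ≠ 0 := fun x => (h.v_pos hs x).ne'
  have haτ : ∀ x, |2 * a * τ / (1 + w.f s x)| ≤ 4 := fun x => by
    rw [abs_div, abs_of_pos (h.v_pos hs x), div_le_iff₀ (h.v_pos hs x), abs_mul, abs_mul, abs_two,
      abs_of_pos hτ]
    have := (h.v_mem hs x).1
    have := mul_le_mul h.ha h.hτ1 hτ.le zero_le_one
    nlinarith
  have hmv : ∀ x, |-((μ + 2 * a * τ * S.f s x) / (1 + w.f s x) ^ 2)| ≤ 6 * μ := fun x => by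
    have hv := h.v_pos hs x
    rw [abs_neg, abs_of_pos (div_pos (h.m_pos hs x) (by positivity)), div_le_iff₀ (by positivity)]
    have := (h.v_mem hs x).1
    have h4 : 1 / 4 ≤ (1 + w.f s x) ^ 2 := by nlinarith
    nlinarith [(h.m_mem hs x).2]
  set b1 : ℝ → ℝ := fun x => 2 * a * τ / (1 + w.f s x) * S.fx s x
    + -((μ + 2 * a * τ * S.f s x) / (1 + w.f s x) ^ 2) * w.fx s x with hb1
  have c1 : Continuous fun x => 2 * a * τ / (1 + w.f s x) := continuous_const.div cv hv0
  have c2 : Continuous fun x => -((μ + 2 * a * τ * S.f s x) / (1 + w.f s x) ^ 2) :=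
    (cm.div (cv.pow 2) fun x => pow_ne_zero 2 (hv0 x)).neg
  have L1 := (h.hS.cx.1 s hs).comb (h.hw.cx.1 s hs) c1 c2 haτ hmv
  have hbd : ∀ x, |b1 x| ≤ K1 * e := fun x => by
    have e1 : 2 * a * τ / (1 + w.f s x) * S.fx s x = 2 * a / (1 + w.f s x) * (τ * S.fx s x) := by
      ring
    have e2 : |2 * a / (1 + w.f s x)| ≤ 4 := by
      rw [abs_div, abs_of_pos (h.v_pos hs x), div_le_iff₀ (h.v_pos hs x), abs_mul, abs_two]
      have := (h.v_mem hs x).1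
      have := h.ha
      nlinarith
    have t1 : |2 * a * τ / (1 + w.f s x) * S.fx s x| ≤ 4 * e := by
      rw [e1, abs_mul]
      exact mul_le_mul e2 (h.bSx s hs x) (abs_nonneg _) (by norm_num)
    have t2 : |-((μ + 2 * a * τ * S.f s x) / (1 + w.f s x) ^ 2) * w.fx s x| ≤ 6 * μ * e := by
      rw [abs_mul]
      exact mul_le_mul (hmv x) (h.bwx s hs x) (abs_nonneg _) (by positivity)
    refine (abs_add_le _ _).trans ((add_le_add t1 t2).trans (le_of_eq ?_))
    rw [hK1]; ring
  have hbd2 : ∀ x, |-(2 * b1 x / (1 + w.f s x))| ≤ 4 * K1 := fun x => by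
    rw [abs_neg, abs_div, abs_of_pos (h.v_pos hs x), div_le_iff₀ (h.v_pos hs x), abs_mul, abs_two]
    have := (h.v_mem hs x).1
    have h2 := (hbd x).trans (mul_le_of_le_one_right (by positivity)
      (h.he1.trans (by norm_num : (1/2:ℝ) ≤ 1)))
    have : 0 < K1 := by positivity
    nlinarith
  have c3 : Continuous fun x => -(2 * b1 x / (1 + w.f s x)) :=
    ((L1.1.cont.const_mul 2).div cv hv0).neg
  have L2 := (h.hS.cxx.1 s hs).comb (h.hw.cxx.1 s hs) c1 c2 haτ hmv
  have L3 := L2.1.comb (h.hw.cx.1 s hs) continuous_const c3 (P := 1) (fun x => by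
    rw [abs_one]) hbd2
  have dv : ∀ x, HasDerivAt (fun y => 1 + w.f s y) (w.fx s x) x := fun x =>
    (h.hw.dx s hs x).const_add 1
  have dm : ∀ x, HasDerivAt (fun y => μ + 2 * a * τ * S.f s y) (2 * a * τ * S.fx s x) x := fun x =>
    ((h.hS.dx s hs x).const_mul _).const_add μ
  refine ⟨b1, _, fun x => ((dm x).fun_div (dv x) (hv0 x)).congr_deriv ?_, fun x =>
    ((((hasDerivAt_const x (2 * a * τ)).fun_div (dv x) (hv0 x)).fun_mul (h.hS.dxx s hs x)).fun_add
      (((dm x).fun_div ((dv x).fun_pow 2) (pow_ne_zero 2 (hv0 x))).fun_neg.fun_mul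
        (h.hw.dxx s hs x))).congr_deriv ?_, fun x => ?_, L1.1, L3.1, L3.2.trans ?_⟩
  · have := hv0 x
    simp only [hb1]
    field_simp
    ring
  · have := hv0 x
    simp only [hb1]
    field_simp
    ring
  · refine (hbd x).trans (mul_le_mul_of_nonneg_right ?_ he.le)
    have : 0 ≤ 4 * (4 ^ 2 + (6 * μ) ^ 2 + (4 * K1) ^ 2) := by positivity
    linarith
  · have hD := (le_diss w u S s).2.2.1
    have n0 := diss_nonneg w u S s
    have n1 := n2_nonneg (w.fx s)
    have n3 := n2_nonneg (w.fxx s)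
    have n4 := n2_nonneg (S.fxx s)
    have t1 := mul_le_mul_of_nonneg_left (show n2 (S.fxx s) ≤ diss w u S s by linarith)
      (show (0:ℝ) ≤ 4 ^ 2 by norm_num)
    have t2 := mul_le_mul_of_nonneg_left (show n2 (w.fxx s) ≤ diss w u S s by linarith)
      (sq_nonneg (6 * μ))
    have t3 := mul_le_mul_of_nonneg_left (show n2 (w.fx s) ≤ diss w u S s by linarith)
      (sq_nonneg (4 * K1))
    have t4 := mul_nonneg (show 0 ≤ K1 by positivity) n0
    have t5 := mul_nonneg (sq_nonneg (4 * K1)) n0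
    linarith [L2.2]

/-- Residual of `(V, W, Z)` in the momentum equation linearised at `w`. -/
def momentumRes (γ : ℝ) (w V W Z : Jet) (s x : ℝ) : ℝ :=
  W.ft s x - γ * (1 + w.f s x) ^ (-γ - 1) * V.fx s x - Z.fx s x

/-- Residual of `(W, Z)` in the constitutive law linearised at `(w, S)`. -/
def stressRes (a μ τ : ℝ) (w S W Z : Jet) (s x : ℝ) : ℝ :=
  τ * Z.ft s x + Z.f s x - (μ + 2 * a * τ * S.f s x) / (1 + w.f s x) * W.fx s x

lemma residuals_one {μ γ : ℝ} (hμ : 0 < μ) (hγ : 1 < γ) : ∃ K : ℝ, 0 < K ∧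
    ∀ (a τ T e : ℝ) (w u S : Jet), Sol a μ γ τ T e w u S → ∀ h > 0, ∀ s ∈ Icc 0 T,
      L2C (momentumRes γ w (w.dq h) (u.dq h) (S.dq h) s) ∧
      L2C (stressRes a μ τ w S (u.dq h) (S.dq h) s) ∧
      n2 (momentumRes γ w (w.dq h) (u.dq h) (S.dq h) s) +
        n2 (stressRes a μ τ w S (u.dq h) (S.dq h) s) ≤
        K * e ^ 2 * (n2 (w.fx s) + n2 (u.fx s)) := by
  obtain ⟨K1, hK1, H1⟩ := sound_speed_derivs hγ
  obtain ⟨K2, hK2, H2⟩ := viscosity_derivs hμ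
  refine ⟨K1 ^ 2 + K2 ^ 2, by positivity, ?_⟩
  intro a τ T e w u S h k hk s hs
  obtain ⟨a1, a2, da, -, ba, -⟩ := H1 a μ τ T e w u S h s hs
  obtain ⟨b1, b2, db, -, bb, -⟩ := H2 a γ τ T e w u S h s hs
  have hF := commutator_one hk da ba (h.hw.cx.1 s hs)
  have hG := commutator_one hk db bb (h.hu.cx.1 s hs)
  have eF : momentumRes γ w (w.dq k) (u.dq k) (S.dq k) s = fun x =>
      dq k (fun y => γ * (1 + w.f s y) ^ (-γ - 1) * w.fx s y) x
        - γ * (1 + w.f s x) ^ (-γ - 1) * dq k (w.fx s) x := by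
    funext x
    simp only [momentumRes, Jet.dq, dq, h.eq2 s hs]
    ring
  have eG : stressRes a μ τ w S (u.dq k) (S.dq k) s = fun x =>
      dq k (fun y => (μ + 2 * a * τ * S.f s y) / (1 + w.f s y) * u.fx s y) x
        - (μ + 2 * a * τ * S.f s x) / (1 + w.f s x) * dq k (u.fx s) x := by
    funext x
    simp only [stressRes, Jet.dq, dq, ← h.eq3 s hs]
    ring
  rw [eF, eG]
  refine ⟨hF.1, hG.1, (add_le_add hF.2 hG.2).trans ?_⟩
  have n1 := mul_nonneg (sq_nonneg (K1 * e)) (n2_nonneg (u.fx s))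
  have n3 := mul_nonneg (sq_nonneg (K2 * e)) (n2_nonneg (w.fx s))
  linarith

lemma residuals_two {μ γ : ℝ} (hμ : 0 < μ) (hγ : 1 < γ) : ∃ K : ℝ, 0 < K ∧
    ∀ (a τ T e : ℝ) (w u S : Jet), Sol a μ γ τ T e w u S → ∀ h > 0, ∀ s ∈ Icc 0 T,
      L2C (momentumRes γ w ((w.dq h).dq h) ((u.dq h).dq h) ((S.dq h).dq h) s) ∧
      L2C (stressRes a μ τ w S ((u.dq h).dq h) ((S.dq h).dq h) s) ∧
      n2 (momentumRes γ w ((w.dq h).dq h) ((u.dq h).dq h) ((S.dq h).dq h) s) +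
        n2 (stressRes a μ τ w S ((u.dq h).dq h) ((S.dq h).dq h) s) ≤
        K * e ^ 2 * diss w u S s := by
  obtain ⟨K1, hK1, H1⟩ := sound_speed_derivs hγ
  obtain ⟨K2, hK2, H2⟩ := viscosity_derivs hμ
  refine ⟨2 * (4 * K1 ^ 2 + K1) + 2 * (4 * K2 ^ 2 + K2), by positivity, ?_⟩
  intro a τ T e w u S h k hk s hs
  obtain ⟨a1, a2, da, da1, ba, La1, La2, na⟩ := H1 a μ τ T e w u S h s hs
  obtain ⟨b1, b2, db, db1, bb, Lb1, Lb2, nb⟩ := H2 a γ τ T e w u S h s hs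
  have hF := commutator_two hk da da1 ba La1 La2 (h.hw.dxx s hs) (h.bwx s hs)
    (h.hw.cx.1 s hs) (h.hw.cxx.1 s hs)
  have hG := commutator_two hk db db1 bb Lb1 Lb2 (h.hu.dxx s hs) (h.bux s hs)
    (h.hu.cx.1 s hs) (h.hu.cxx.1 s hs)
  have eF : momentumRes γ w ((w.dq k).dq k) ((u.dq k).dq k) ((S.dq k).dq k) s = fun x =>
      dq k (dq k fun y => γ * (1 + w.f s y) ^ (-γ - 1) * w.fx s y) x
        - γ * (1 + w.f s x) ^ (-γ - 1) * dq k (dq k (w.fx s)) x := by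
    funext x
    simp only [momentumRes, Jet.dq, dq, h.eq2 s hs]
    ring
  have eG : stressRes a μ τ w S ((u.dq k).dq k) ((S.dq k).dq k) s = fun x =>
      dq k (dq k fun y => (μ + 2 * a * τ * S.f s y) / (1 + w.f s y) * u.fx s y) x
        - (μ + 2 * a * τ * S.f s x) / (1 + w.f s x) * dq k (dq k (u.fx s)) x := by
    funext x
    simp only [stressRes, Jet.dq, dq, ← h.eq3 s hs]
    ring
  rw [eF, eG]
  refine ⟨hF.1, hG.1, (add_le_add hF.2 hG.2).trans ?_⟩
  obtain ⟨d1, d2, -, -⟩ := le_diss w u S s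
  have l1 : n2 (w.fxx s) ≤ diss w u S s := by linarith [n2_nonneg (w.fx s)]
  have l2 : n2 (u.fxx s) ≤ diss w u S s := by linarith [n2_nonneg (u.fx s)]
  have t1 := mul_le_mul_of_nonneg_left l1 (sq_nonneg (2 * (K1 * e)))
  have t2 := mul_le_mul_of_nonneg_left l2 (sq_nonneg (2 * (K2 * e)))
  have t3 := mul_le_mul_of_nonneg_left na (sq_nonneg e)
  have t4 := mul_le_mul_of_nonneg_left nb (sq_nonneg e)
  linarith

lemma Sol.modulus_rate {a μ γ τ T e : ℝ} {w u S : Jet} (h : Sol a μ γ τ T e w u S) {s : ℝ}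
    (hs : s ∈ Icc 0 T) (x : ℝ) :
    |τ * ((w.ft s x * (μ + 2 * a * τ * S.f s x) - (1 + w.f s x) * (2 * a * τ * S.ft s x)) /
      (μ + 2 * a * τ * S.f s x) ^ 2)| ≤ (2 / μ + 12 * (3 * μ + 1) / μ ^ 2) * e := by
  have hμ := h.hμ
  have hτ := h.hτ
  have he := h.he
  have hm := h.m_mem hs x
  have hm0 := h.m_pos hs x
  have hv := h.v_mem hs x
  have hv0 := h.v_pos hs x
  have e3 : τ * S.ft s x =
      (μ + 2 * a * τ * S.f s x) / (1 + w.f s x) * u.fx s x - S.f s x := by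
    linarith [h.eq3 s hs x]
  have hβ := h.viscosity_mem hs x
  have hX : |τ * (τ * S.ft s x)| ≤ (3 * μ + 1) * e := by
    rw [e3, mul_sub]
    refine (abs_sub _ _).trans ?_
    have t2 := h.bS s hs x
    have t1 : |τ * ((μ + 2 * a * τ * S.f s x) / (1 + w.f s x) * u.fx s x)| ≤ 1 * (3 * μ * e) := by
      rw [abs_mul, abs_mul, abs_of_pos hτ, abs_of_pos (div_pos hm0 hv0)]
      exact mul_le_mul h.hτ1 (mul_le_mul hβ.2 (h.bux s hs x) (abs_nonneg _) (by positivity))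
        (by positivity) zero_le_one
    linarith
  have e1 : τ * ((w.ft s x * (μ + 2 * a * τ * S.f s x) - (1 + w.f s x) * (2 * a * τ * S.ft s x)) /
      (μ + 2 * a * τ * S.f s x) ^ 2) = τ * (u.fx s x / (μ + 2 * a * τ * S.f s x))
      - (2 * (1 + w.f s x) / (μ + 2 * a * τ * S.f s x) ^ 2) * (a * (τ * (τ * S.ft s x))) := by
    rw [h.eq1 s hs x]
    generalize μ + 2 * a * τ * S.f s x = m at hm0
    field_simp
  have t1 : |τ * (u.fx s x / (μ + 2 * a * τ * S.f s x))| ≤ 1 * (2 / μ * e) := by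
    rw [abs_mul, abs_of_pos hτ]
    refine mul_le_mul h.hτ1 ?_ (abs_nonneg _) zero_le_one
    rw [abs_div, abs_of_pos hm0, div_le_iff₀ hm0]
    have : 2 / μ * e * (μ / 2) ≤ 2 / μ * e * (μ + 2 * a * τ * S.f s x) :=
      mul_le_mul_of_nonneg_left hm.1 (by positivity)
    have e5 : 2 / μ * e * (μ / 2) = e := by field_simp
    linarith [h.bux s hs x]
  have t2 : |(2 * (1 + w.f s x) / (μ + 2 * a * τ * S.f s x) ^ 2) * (a * (τ * (τ * S.ft s x)))| ≤
      12 / μ ^ 2 * (1 * ((3 * μ + 1) * e)) := by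
    rw [abs_mul, abs_mul a]
    refine mul_le_mul ?_ (mul_le_mul h.ha hX (abs_nonneg _) zero_le_one) (by positivity)
      (by positivity)
    rw [abs_of_pos (by positivity), div_le_div_iff₀ (by positivity) (by positivity)]
    have : (μ / 2) ^ 2 ≤ (μ + 2 * a * τ * S.f s x) ^ 2 := by
      have := hm.1
      gcongr
    nlinarith [mul_le_mul_of_nonneg_right hv.2 (sq_nonneg μ)]
  rw [e1]
  refine (abs_sub _ _).trans ((add_le_add t1 t2).trans (le_of_eq ?_))
  ring

lemma linear_energy_pointwise {A1 A2 R ρ ρ0 ρ1 K L e V W Z F G : ℝ} (he : 0 < e)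
    (h1 : |A1| ≤ K * e) (h2 : |A2| ≤ K * e) (hR : |R| ≤ L * e) (hρ0 : 0 ≤ ρ0) (hρ : ρ0 ≤ ρ)
    (hρ1 : ρ ≤ ρ1) :
    A1 * V ^ 2 - 2 * A2 * (V * W) + 2 * (W * F) + R * Z ^ 2 - 2 * ρ * Z ^ 2 + 2 * ρ * (Z * G) ≤
      -(2 * ρ0) * Z ^ 2 + ((2 * K + L + 1 + ρ1) * e * (V ^ 2 + W ^ 2 + Z ^ 2)
        + (1 + ρ1) / e * (F ^ 2 + G ^ 2)) := by
  have hKe : 0 ≤ K * e := (abs_nonneg _).trans h1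
  have hLe : 0 ≤ L * e := (abs_nonneg _).trans hR
  have young : ∀ p q : ℝ, 2 * (p * q) ≤ e * p ^ 2 + 1 / e * q ^ 2 := fun p q => by
    have e1 : e * p ^ 2 + 1 / e * q ^ 2 - 2 * (p * q) = (e * p - q) ^ 2 / e := by
      field_simp; ring
    have : 0 ≤ (e * p - q) ^ 2 / e := by positivity
    linarith
  have l1 : A1 * V ^ 2 ≤ K * e * V ^ 2 :=
    mul_le_mul_of_nonneg_right ((le_abs_self _).trans h1) (sq_nonneg _)
  have l2 : R * Z ^ 2 ≤ L * e * Z ^ 2 :=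
    mul_le_mul_of_nonneg_right ((le_abs_self _).trans hR) (sq_nonneg _)
  have l3 : -(2 * A2 * (V * W)) ≤ K * e * (V ^ 2 + W ^ 2) := by
    have := abs_le.1 h2
    have t : 2 * |V * W| ≤ V ^ 2 + W ^ 2 := by
      rw [abs_mul]; nlinarith [sq_nonneg (|V| - |W|), sq_abs V, sq_abs W]
    calc -(2 * A2 * (V * W)) ≤ |2 * A2 * (V * W)| := neg_le_abs _
      _ = |A2| * (2 * |V * W|) := by rw [abs_mul, abs_mul, abs_two]; ring
      _ ≤ K * e * (V ^ 2 + W ^ 2) := mul_le_mul h2 t (by positivity) hKe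
  have l4 := young W F
  have hpos : 0 ≤ e * Z ^ 2 + 1 / e * G ^ 2 := by positivity
  have l5 : 2 * ρ * (Z * G) ≤ ρ1 * (e * Z ^ 2 + 1 / e * G ^ 2) := by
    have := mul_le_mul_of_nonneg_left (young Z G) (hρ0.trans hρ)
    have := mul_le_mul_of_nonneg_right hρ1 hpos
    linarith
  have l6 : ρ0 * Z ^ 2 ≤ ρ * Z ^ 2 := mul_le_mul_of_nonneg_right hρ (sq_nonneg _)
  have hρ1' : 0 ≤ ρ1 := hρ0.trans (hρ.trans hρ1)
  have p1 := mul_nonneg hKe (sq_nonneg Z)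
  have p2 := mul_nonneg hKe (sq_nonneg W)
  have p3 := mul_nonneg hLe (sq_nonneg V)
  have p4 := mul_nonneg hLe (sq_nonneg W)
  have p5 := mul_nonneg he.le (sq_nonneg V)
  have p6 := mul_nonneg he.le (sq_nonneg Z)
  have p7 := mul_nonneg hρ1' p5
  have p8 := mul_nonneg hρ1' (mul_nonneg he.le (sq_nonneg W))
  have p9 : 0 ≤ 1 / e * G ^ 2 := by positivity
  have p10 : 0 ≤ ρ1 * (1 / e * F ^ 2) := by positivity
  have e2 : (1 + ρ1) / e * (F ^ 2 + G ^ 2) =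
      1 / e * F ^ 2 + 1 / e * G ^ 2 + ρ1 * (1 / e * F ^ 2) + ρ1 * (1 / e * G ^ 2) := by ring
  rw [e2]
  linarith

/-- Energy estimate for the linearised system. -/
lemma linear_energy {μ γ : ℝ} (hμ : 0 < μ) (hγ : 1 < γ) : ∃ K : ℝ, 0 < K ∧
    ∀ (a τ T e : ℝ) (w u S : Jet), Sol a μ γ τ T e w u S →
      ∀ (V W Z : Jet) (d : ℝ → ℝ), Reg (Icc 0 T) V → Reg (Icc 0 T) W → Reg (Icc 0 T) Z →
      ContinuousOn d (Icc 0 T) →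
      (∀ s ∈ Icc 0 T, ∀ x, V.ft s x = W.fx s x) →
      (∀ s ∈ Icc 0 T, L2C (momentumRes γ w V W Z s) ∧ L2C (stressRes a μ τ w S W Z s) ∧
        n2 (V.f s) + n2 (W.f s) + n2 (Z.f s) ≤ d s ∧
        n2 (momentumRes γ w V W Z s) + n2 (stressRes a μ τ w S W Z s) ≤ e ^ 2 * d s) →
      (n2 (V.f T) + n2 (W.f T) + τ * n2 (Z.f T)) + (∫ s in (0:ℝ)..T, n2 (Z.f s)) ≤
        K * ((n2 (V.f 0) + n2 (W.f 0) + τ * n2 (Z.f 0)) + e * ∫ s in (0:ℝ)..T, d s) := by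
  obtain ⟨k, K, hk, hK, hp⟩ := pressure_bounds hγ
  set ρ0 := 1 / (3 * μ) with hρ0
  set ρ1 := 3 / μ with hρ1
  set L := 2 / μ + 12 * (3 * μ + 1) / μ ^ 2 with hL
  have hρ0p : 0 < ρ0 := by positivity
  have hρ1p : 0 < ρ1 := by positivity
  have hLp : 0 < L := by positivity
  set c := min k (min 1 ρ0) with hc
  have hc0 : 0 < c := by positivity
  set C := 2 * K + L + 2 + 2 * ρ1 with hC
  refine ⟨(c⁻¹ + (2 * ρ0)⁻¹) * (K + 1 + ρ1 + C), by positivity, ?_⟩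
  intro a τ T e w u S h V W Z d hV hW hZ hd hVW hres
  have hT := h.hT
  have hτ := h.hτ
  have he := h.he
  have h0 : (0:ℝ) ∈ Icc 0 T := ⟨le_rfl, hT⟩
  have h1 : T ∈ Icc 0 T := ⟨hT, le_rfl⟩
  set φ : ℝ → ℝ → ℝ := fun s x => γ * (1 + w.f s x) ^ (-γ - 1) * V.f s x ^ 2 + W.f s x ^ 2
    + τ * ((1 + w.f s x) / (μ + 2 * a * τ * S.f s x) * Z.f s x ^ 2) with hφ
  have cv : ∀ s ∈ Icc 0 T, Continuous fun x => 1 + w.f s x := fun s hs =>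
    continuous_const.add (h.hw.cf.1 s hs).cont
  have cvp : ∀ s ∈ Icc 0 T, ∀ p : ℝ, Continuous fun x => (1 + w.f s x) ^ p := fun s hs p =>
    (cv s hs).rpow_const fun x => Or.inl (h.v_pos hs x).ne'
  have cρ : ∀ s ∈ Icc 0 T, Continuous fun x => (1 + w.f s x) / (μ + 2 * a * τ * S.f s x) :=
    fun s hs => (cv s hs).div (continuous_const.add ((h.hS.cf.1 s hs).cont.const_mul _))
      fun x => (h.m_pos hs x).ne'
  have hφc : ∀ s ∈ Icc 0 T, Continuous (φ s) := fun s hs =>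
    ((((cvp s hs _).const_mul γ).mul ((hV.cf.1 s hs).cont.pow 2)).add
      ((hW.cf.1 s hs).cont.pow 2)).add (((cρ s hs).mul ((hZ.cf.1 s hs).cont.pow 2)).const_mul τ)
  have hup : ∀ s ∈ Icc 0 T, ∀ x, φ s x ≤ (K + 1 + ρ1) *
      (V.f s x ^ 2 + W.f s x ^ 2 + τ * Z.f s x ^ 2) := fun s hs x => by
    have q := mul_le_mul_of_nonneg_right (hp _ (h.v_mem hs x)).2.1 (sq_nonneg (V.f s x))
    have q' := mul_le_mul_of_nonneg_left (mul_le_mul_of_nonneg_right (h.modulus_mem hs x).2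
      (sq_nonneg (Z.f s x))) hτ.le
    have q1 := sq_nonneg (V.f s x)
    have q2 := sq_nonneg (W.f s x)
    have q3 := mul_nonneg hτ.le (sq_nonneg (Z.f s x))
    have := mul_nonneg hK.le q2
    have := mul_nonneg hK.le q3
    have := mul_nonneg hρ1p.le q1
    have := mul_nonneg hρ1p.le q2
    simp only [hφ]
    linarith
  have hlo : ∀ s ∈ Icc 0 T, ∀ x, c * (V.f s x ^ 2 + W.f s x ^ 2 + τ * Z.f s x ^ 2) ≤ φ s x :=
    fun s hs x => by
    have l1 := mul_le_mul_of_nonneg_right ((show c ≤ k from min_le_left _ _).trans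
      (hp _ (h.v_mem hs x)).1) (sq_nonneg (V.f s x))
    have l2 := mul_le_mul_of_nonneg_right
      (show c ≤ 1 from (min_le_right _ _).trans (min_le_left _ _)) (sq_nonneg (W.f s x))
    have l3 := mul_le_mul_of_nonneg_left (mul_le_mul_of_nonneg_right
      ((show c ≤ ρ0 from (min_le_right _ _).trans (min_le_right _ _)).trans
      (h.modulus_mem hs x).1) (sq_nonneg (Z.f s x))) hτ.le
    simp only [hφ]
    linarith
  have hM : ∀ s ∈ Icc 0 T, HasInt (fun x => V.f s x ^ 2 + W.f s x ^ 2 + τ * Z.f s x ^ 2)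
      (n2 (V.f s) + n2 (W.f s) + τ * n2 (Z.f s)) := fun s hs =>
    ((hV.cf.1 s hs).hasInt.add (hW.cf.1 s hs).hasInt).add ((hZ.cf.1 s hs).hasInt.const_mul τ)
  have hφi : ∀ s ∈ Icc 0 T, HasInt (φ s) (∫ x, φ s x) := fun s hs =>
    ⟨integrable_of_cont_le (hφc s hs) ((hM s hs).const_mul (K + 1 + ρ1)).1 fun x => by
      rw [abs_of_nonneg ((mul_nonneg hc0.le (by positivity)).trans (hlo s hs x))]
      exact hup s hs x, rfl⟩
  have hα : ∀ s ∈ Icc 0 T, ∀ x, |γ * (1 + w.f s x) ^ (-γ - 1)| ≤ K := fun s hs x => by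
    have q := hp _ (h.v_mem hs x)
    rw [abs_of_nonneg (hk.le.trans q.1)]
    exact q.2.1
  have hα1 : ∀ s ∈ Icc 0 T, ∀ x y, |y| ≤ e →
      |γ * (-γ - 1) * (1 + w.f s x) ^ (-γ - 1 - 1) * y| ≤ K * e := fun s hs x y hy => by
    rw [abs_mul]
    exact mul_le_mul (hp _ (h.v_mem hs x)).2.2.1 hy (abs_nonneg _) hK.le
  have young : ∀ p q : ℝ, |2 * (p * q)| ≤ p ^ 2 + q ^ 2 := fun p q => by
    rw [abs_le]; constructor <;> nlinarith [sq_nonneg (p + q), sq_nonneg (p - q)]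
  obtain ⟨B1, hB10, hB1⟩ := hV.cf.bounded
  obtain ⟨B2, hB20, hB2⟩ := hV.ct.bounded
  obtain ⟨B3, hB30, hB3⟩ := hW.cf.bounded
  obtain ⟨B4, hB40, hB4⟩ := hW.ct.bounded
  obtain ⟨B5, hB50, hB5⟩ := hZ.cf.bounded
  obtain ⟨B6, hB60, hB6⟩ := hZ.ct.bounded
  have hbal := energy_balance (φ := φ) (T := T)
    (M := K * e * B1 + K * (B1 + B2) + (B3 + B4) + (L * e * B5 + τ * (ρ1 * (B5 + B6))))
    (φt := fun s x => γ * (-γ - 1) * (1 + w.f s x) ^ (-γ - 1 - 1) * w.ft s x * V.f s x ^ 2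
      + γ * (1 + w.f s x) ^ (-γ - 1) * (2 * (V.f s x * V.ft s x)) + 2 * (W.f s x * W.ft s x)
      + (τ * ((w.ft s x * (μ + 2 * a * τ * S.f s x) - (1 + w.f s x) * (2 * a * τ * S.ft s x)) /
        (μ + 2 * a * τ * S.f s x) ^ 2) * Z.f s x ^ 2
        + τ * ((1 + w.f s x) / (μ + 2 * a * τ * S.f s x) * (2 * (Z.f s x * Z.ft s x)))))
    (q := fun s x => 2 * (γ * (1 + w.f s x) ^ (-γ - 1) * V.f s x * W.f s x + W.f s x * Z.f s x))
    (qx := fun s x => 2 * (((γ * (-γ - 1) * (1 + w.f s x) ^ (-γ - 1 - 1) * w.fx s x * V.f s x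
      + γ * (1 + w.f s x) ^ (-γ - 1) * V.fx s x) * W.f s x
      + γ * (1 + w.f s x) ^ (-γ - 1) * V.f s x * W.fx s x)
      + (W.fx s x * Z.f s x + W.f s x * Z.fx s x)))
    (d := fun s => C * e * d s - 2 * ρ0 * n2 (Z.f s))
    hT ?_ ?_ ?_ (hφi 0 h0).1 (hφi T h1).1 ?_ ?_ ?_
  · have iZ := hZ.cf.intervalIntegrable hT
    have id : IntervalIntegrable d volume 0 T :=
      ContinuousOn.intervalIntegrable (by rwa [uIcc_of_le hT])
    rw [intervalIntegral.integral_sub (id.const_mul _) (iZ.const_mul _),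
      intervalIntegral.integral_const_mul, intervalIntegral.integral_const_mul] at hbal
    have l1 := ((hM T h1).const_mul c).le (hφi T h1) (hlo T h1)
    have l2 := (hφi 0 h0).le ((hM 0 h0).const_mul _) (hup 0 h0)
    have nZ : 0 ≤ ∫ s in (0:ℝ)..T, n2 (Z.f s) :=
      intervalIntegral.integral_nonneg hT fun s _ => n2_nonneg _
    have nD : 0 ≤ ∫ s in (0:ℝ)..T, d s :=
      intervalIntegral.integral_nonneg hT fun s hs => (add_nonneg (add_nonneg (n2_nonneg _)
        (n2_nonneg _)) (n2_nonneg _)).trans (hres s hs).2.2.1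
    have n1 : ∀ s : ℝ, 0 ≤ n2 (V.f s) + n2 (W.f s) + τ * n2 (Z.f s) := fun s =>
      add_nonneg (add_nonneg (n2_nonneg _) (n2_nonneg _)) (mul_nonneg hτ.le (n2_nonneg _))
    refine (add_le_of_coercive hc0 (by positivity : 0 < 2 * ρ0) (n1 T) nZ (R := (K + 1 + ρ1) *
      (n2 (V.f 0) + n2 (W.f 0) + τ * n2 (Z.f 0)) + C * e * ∫ s in (0:ℝ)..T, d s)
      (by linarith)).trans ?_
    rw [mul_assoc (c⁻¹ + (2 * ρ0)⁻¹)]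
    refine mul_le_mul_of_nonneg_left ?_ (by positivity)
    have m1 := mul_nonneg (show 0 ≤ C by positivity) (n1 0)
    have m2 := mul_nonneg (show 0 ≤ K + 1 + ρ1 by positivity) (mul_nonneg he.le nD)
    linarith
  · intro s hs x
    have d1 := ((hasDerivAt_mul_rpow (c := γ) (p := -γ - 1) (h.v_pos hs x)).comp
      (h := fun r => 1 + w.f r x) s ((h.hw.dt s hs x).const_add 1)).fun_mul
        ((hV.dt s hs x).fun_pow 2)
    have d3 := ((((h.hw.dt s hs x).const_add 1).fun_div
      (((h.hS.dt s hs x).const_mul (2 * a * τ)).const_add μ) (h.m_pos hs x).ne').fun_mul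
        ((hZ.dt s hs x).fun_pow 2)).const_mul τ
    refine ((d1.fun_add ((hW.dt s hs x).fun_pow 2)).fun_add d3).congr_deriv ?_
    simp only [Function.comp_apply]
    push_cast
    ring
  · have hm0 : ∀ y ∈ Icc 0 T ×ˢ (univ : Set ℝ), μ + 2 * a * τ * S.f y.1 y.2 ≠ 0 := fun y hy =>
      (h.m_pos hy.1 y.2).ne'
    have cm := h.continuousOn_m
    have cv' := h.continuousOn_v
    have cρt := (continuousOn_const (c := τ)).mul (((h.hw.jt.1.mul cm).sub (cv'.mul
      ((continuousOn_const (c := 2 * a * τ)).mul h.hS.jt.1))).div (cm.pow 2)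
        fun y hy => pow_ne_zero 2 (hm0 y hy))
    have c1 := ((continuousOn_const (c := γ * (-γ - 1))).mul
      (h.continuousOn_v_rpow (-γ - 1 - 1))).mul h.hw.jt.1
    have c2 := (continuousOn_const (c := γ)).mul (h.continuousOn_v_rpow (-γ - 1))
    exact (((c1.mul (hV.jf.1.pow 2)).add (c2.mul (continuousOn_const.mul
      (hV.jf.1.mul hV.jt.1)))).add (continuousOn_const.mul (hW.jf.1.mul hW.jt.1))).add
      ((cρt.mul (hZ.jf.1.pow 2)).add (continuousOn_const.mul ((cv'.div cm hm0).mul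
        (continuousOn_const.mul (hZ.jf.1.mul hZ.jt.1)))))
  · intro s hs
    have iV := (hV.cf.1 s hs).hasInt
    have iVt := (hV.ct.1 s hs).hasInt
    have iW := (hW.cf.1 s hs).hasInt
    have iWt := (hW.ct.1 s hs).hasInt
    have iZ := (hZ.cf.1 s hs).hasInt
    have iZt := (hZ.ct.1 s hs).hasInt
    have hI := (((iV.const_mul (K * e)).add ((iV.add iVt).const_mul K)).add (iW.add iWt)).add
      ((iZ.const_mul (L * e)).add (((iZ.add iZt).const_mul ρ1).const_mul τ))
    refine ⟨_, hI.1, ?_, fun x => ?_⟩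
    · rw [hI.2]
      have := hB1 s hs
      have := hB2 s hs
      have := hB3 s hs
      have := hB4 s hs
      have := hB5 s hs
      have := hB6 s hs
      gcongr
    · refine (abs_add_le _ _).trans (add_le_add ((abs_add_le _ _).trans (add_le_add
        ((abs_add_le _ _).trans (add_le_add ?_ ?_)) (young _ _))) ((abs_add_le _ _).trans
          (add_le_add ?_ ?_)))
      · rw [abs_mul, abs_of_nonneg (sq_nonneg (V.f s x)), h.eq1 s hs x]
        exact mul_le_mul_of_nonneg_right (hα1 s hs x _ (h.bux s hs x)) (sq_nonneg _)
      · rw [abs_mul]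
        exact mul_le_mul (hα s hs x) (young _ _) (abs_nonneg _) hK.le
      · rw [abs_mul, abs_of_nonneg (sq_nonneg (Z.f s x))]
        exact mul_le_mul_of_nonneg_right (h.modulus_rate hs x) (sq_nonneg _)
      · rw [abs_mul, abs_of_pos hτ, abs_mul, abs_of_pos (div_pos (h.v_pos hs x) (h.m_pos hs x))]
        exact mul_le_mul_of_nonneg_left (mul_le_mul (h.modulus_mem hs x).2 (young _ _)
          (abs_nonneg _) hρ1p.le) hτ.le
  · intro s hs
    have cα := (cvp s hs (-γ - 1)).const_mul γ
    have cα1 := ((cvp s hs (-γ - 1 - 1)).const_mul (γ * (-γ - 1))).mul (h.hw.cx.1 s hs).cont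
    have L1 := (hV.cf.1 s hs).bdd_mul cα (hα s hs)
    have L2 := (hV.cf.1 s hs).bdd_mul cα1 fun x => hα1 s hs x _ (h.bwx s hs x)
    have L3 := (hV.cx.1 s hs).bdd_mul cα (hα s hs)
    refine ⟨fun x => ?_, ?_, ?_⟩
    · have d1 := (hasDerivAt_mul_rpow (c := γ) (p := -γ - 1) (h.v_pos hs x)).comp
        (h := fun y => 1 + w.f s y) x ((h.hw.dx s hs x).const_add 1)
      refine ((((d1.fun_mul (hV.dx s hs x)).fun_mul (hW.dx s hs x)).fun_add
        ((hW.dx s hs x).fun_mul (hZ.dx s hs x))).const_mul 2).congr_deriv ?_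
      simp only [Function.comp_apply]
    · exact ((L1.mul_int (hW.cf.1 s hs)).add ((hW.cf.1 s hs).mul_int (hZ.cf.1 s hs))).const_mul 2
    · exact ((((L2.add L3).mul_int (hW.cf.1 s hs)).add (L1.mul_int (hW.cx.1 s hs))).add
        (((hW.cx.1 s hs).mul_int (hZ.cf.1 s hs)).add
          ((hW.cf.1 s hs).mul_int (hZ.cx.1 s hs)))).const_mul 2
  · intro s hs
    obtain ⟨LF, LG, hd1, hd2⟩ := hres s hs
    have hI := ((hZ.cf.1 s hs).hasInt.const_mul (-(2 * ρ0))).add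
      (((((hV.cf.1 s hs).hasInt.add (hW.cf.1 s hs).hasInt).add (hZ.cf.1 s hs).hasInt).const_mul
        ((2 * K + L + 1 + ρ1) * e)).add ((LF.hasInt.add LG.hasInt).const_mul ((1 + ρ1) / e)))
    refine ⟨_, hI.1, ?_, fun x => ?_⟩
    · rw [hI.2]
      have t1 := mul_le_mul_of_nonneg_left hd1 (show 0 ≤ (2 * K + L + 1 + ρ1) * e by positivity)
      have t2 := mul_le_mul_of_nonneg_left hd2 (show 0 ≤ (1 + ρ1) / e by positivity)
      have e2 : (1 + ρ1) / e * (e ^ 2 * d s) = (1 + ρ1) * e * d s := by field_simp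
      rw [e2] at t2
      rw [hC]
      linarith
    · have key := linear_energy_pointwise (V := V.f s x) (W := W.f s x) (Z := Z.f s x)
        (F := momentumRes γ w V W Z s x) (G := stressRes a μ τ w S W Z s x) he
        (hα1 s hs x _ (h.bux s hs x)) (hα1 s hs x _ (h.bwx s hs x)) (h.modulus_rate hs x)
        hρ0p.le (h.modulus_mem hs x).1 (h.modulus_mem hs x).2
      refine le_trans (le_of_eq ?_) (add_le_add_right key _)
      simp only [momentumRes, stressRes]
      rw [← hVW s hs x, ← h.eq1 s hs x]
      have hm0 := (h.m_pos hs x).ne'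
      have hv0 := (h.v_pos hs x).ne'
      generalize μ + 2 * a * τ * S.f s x = m at hm0 ⊢
      generalize (1 + w.f s x) ^ (-γ - 1) = α
      generalize (1 + w.f s x) ^ (-γ - 1 - 1) = α'
      generalize 1 + w.f s x = v at hv0 ⊢
      field_simp
      ring
  · exact (continuousOn_const.mul hd).sub (continuousOn_const.mul hZ.cf.continuousOn)

lemma tendsto_intervalIntegral_of_le {T : ℝ} (hT : 0 ≤ T) {F : ℝ → ℝ → ℝ} {f g : ℝ → ℝ}
    {l : Filter ℝ} [l.IsCountablyGenerated] (hF : ∀ h, ContinuousOn (F h) (Icc 0 T))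
    (hg : ContinuousOn g (Icc 0 T)) (h0 : ∀ h s, 0 ≤ F h s) (hle : ∀ h, ∀ s ∈ Icc 0 T, F h s ≤ g s)
    (hlim : ∀ s ∈ Icc 0 T, Tendsto (fun h => F h s) l (nhds (f s))) :
    Tendsto (fun h => ∫ s in (0:ℝ)..T, F h s) l (nhds (∫ s in (0:ℝ)..T, f s)) := by
  have hsub : ∀ {s}, s ∈ uIoc 0 T → s ∈ Icc 0 T := fun hs => by
    rw [uIoc_of_le hT] at hs; exact Ioc_subset_Icc_self hs
  refine intervalIntegral.tendsto_integral_filter_of_dominated_convergence g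
    (Eventually.of_forall fun h => ?_) (Eventually.of_forall fun h => Eventually.of_forall
      fun s hs => ?_) (ContinuousOn.intervalIntegrable (by rwa [uIcc_of_le hT]))
    (Eventually.of_forall fun s hs => hlim s (hsub hs))
  · exact ((hF h).mono fun s hs => hsub hs).aestronglyMeasurable measurableSet_uIoc
  · rw [Real.norm_of_nonneg (h0 h s)]
    exact hle h s (hsub hs)

lemma n2_deriv_le {f f1 f2 : ℝ → ℝ} (hd : ∀ x, HasDerivAt f (f1 x) x)
    (hd1 : ∀ x, HasDerivAt f1 (f2 x) x) (hf : L2C f) (hf1 : L2C f1) (hf2 : L2C f2) :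
    n2 f1 ≤ n2 f + n2 f2 := by
  have hz : ∫ x, (f1 x * f1 x + f x * f2 x) = 0 :=
    integral_eq_zero_of_hasDerivAt_of_integrable (f := fun x => f x * f1 x)
      (fun x => (hd x).fun_mul (hd1 x)) ((hf1.mul_int hf1).add (hf.mul_int hf2)) (hf.mul_int hf1)
  have key := HasInt.le (d := n2 f + n2 f2 + 1 * 0) hf1.hasInt ((hf.hasInt.add hf2.hasInt).add
    (HasInt.const_mul (c := 0) ⟨(hf1.mul_int hf1).add (hf.mul_int hf2), hz⟩ 1)) fun x => by
      simp only [Pi.add_apply]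
      nlinarith [sq_nonneg (f x + f2 x), sq_nonneg (f x), sq_nonneg (f2 x)]
  linarith

lemma Sol.continuousOn_diss {a μ γ τ T e : ℝ} {w u S : Jet} (h : Sol a μ γ τ T e w u S) :
    ContinuousOn (diss w u S) (Icc 0 T) :=
  (((((h.hw.cx.continuousOn.add h.hw.cxx.continuousOn).add h.hu.cx.continuousOn).add
    h.hu.cxx.continuousOn).add h.hS.cf.continuousOn).add h.hS.cx.continuousOn).add
      h.hS.cxx.continuousOn

lemma Reg.n2_dq_f_le {I : Set ℝ} {J : Jet} (hJ : Reg I J) {t : ℝ} (ht : t ∈ I) (h : ℝ) :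
    n2 ((J.dq h).f t) ≤ n2 (J.fx t) := n2_dq_le (hJ.dx t ht) (hJ.cx.1 t ht) h

lemma Reg.n2_dq_fx_le {I : Set ℝ} {J : Jet} (hJ : Reg I J) {t : ℝ} (ht : t ∈ I) (h : ℝ) :
    n2 ((J.dq h).fx t) ≤ n2 (J.fxx t) := n2_dq_le (hJ.dxx t ht) (hJ.cxx.1 t ht) h

lemma Reg.n2_dq_dq_le {I : Set ℝ} {J : Jet} (hJ : Reg I J) {t : ℝ} (ht : t ∈ I) (h : ℝ) :
    n2 (((J.dq h).dq h).f t) ≤ n2 (J.fxx t) :=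
  ((hJ.dq h).n2_dq_f_le ht h).trans (hJ.n2_dq_fx_le ht h)

lemma Reg.tendsto_dq_dq {I : Set ℝ} {J : Jet} (hJ : Reg I J) {t : ℝ} (ht : t ∈ I) :
    Tendsto (fun h => n2 (((J.dq h).dq h).f t)) (nhdsWithin 0 (Ioi 0)) (nhds (n2 (J.fxx t))) :=
  tendsto_n2_dq_dq (hJ.dx t ht) (hJ.dxx t ht) (hJ.cf.1 t ht) (hJ.cx.1 t ht) (hJ.cxx.1 t ht)

lemma Reg.tendsto_dq_fx {I : Set ℝ} {J : Jet} (hJ : Reg I J) {t : ℝ} (ht : t ∈ I) :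
    Tendsto (fun h => n2 ((J.dq h).fx t)) (nhdsWithin 0 (Ioi 0)) (nhds (n2 (J.fxx t))) :=
  tendsto_n2_dq (hJ.dxx t ht) (hJ.cx.1 t ht) (hJ.cxx.1 t ht)

lemma Reg.interpolation {I : Set ℝ} {J : Jet} (hJ : Reg I J) {t : ℝ} (ht : t ∈ I) :
    n2 (J.fx t) ≤ n2 (J.f t) + n2 (J.fxx t) :=
  n2_deriv_le (hJ.dx t ht) (hJ.dxx t ht) (hJ.cf.1 t ht) (hJ.cx.1 t ht) (hJ.cxx.1 t ht)

/-- Energy estimate for the second space derivatives. -/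
lemma second_energy {μ γ : ℝ} (hμ : 0 < μ) (hγ : 1 < γ) : ∃ K : ℝ, 0 < K ∧
    ∀ (a τ T e : ℝ) (w u S : Jet), Sol a μ γ τ T e w u S →
      (n2 (w.fxx T) + n2 (u.fxx T) + τ * n2 (S.fxx T)) + (∫ s in (0:ℝ)..T, n2 (S.fxx s)) ≤
        K * ((n2 (w.fxx 0) + n2 (u.fxx 0) + τ * n2 (S.fxx 0))
          + e * ∫ s in (0:ℝ)..T, diss w u S s) := by
  obtain ⟨K1, hK1, H1⟩ := linear_energy hμ hγ
  obtain ⟨K2, hK2, H2⟩ := residuals_two hμ hγ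
  refine ⟨K1 * (1 + K2), by positivity, ?_⟩
  intro a τ T e w u S h
  have hT := h.hT
  have h0 : (0:ℝ) ∈ Icc 0 T := ⟨le_rfl, hT⟩
  have h1 : T ∈ Icc 0 T := ⟨hT, le_rfl⟩
  have hlim : Tendsto (fun k => (n2 (((w.dq k).dq k).f T) + n2 (((u.dq k).dq k).f T)
      + τ * n2 (((S.dq k).dq k).f T)) + ∫ s in (0:ℝ)..T, n2 (((S.dq k).dq k).f s))
      (nhdsWithin 0 (Ioi 0)) (nhds ((n2 (w.fxx T) + n2 (u.fxx T) + τ * n2 (S.fxx T))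
        + ∫ s in (0:ℝ)..T, n2 (S.fxx s))) := by
    refine (((h.hw.tendsto_dq_dq h1).add (h.hu.tendsto_dq_dq h1)).add
      ((h.hS.tendsto_dq_dq h1).const_mul τ)).add (tendsto_intervalIntegral_of_le hT
        (fun k => ((h.hS.dq k).dq k).cf.continuousOn) h.hS.cxx.continuousOn
        (fun k s => n2_nonneg _) (fun k s hs => h.hS.n2_dq_dq_le hs k)
        fun s hs => h.hS.tendsto_dq_dq hs)
  refine le_of_tendsto hlim ?_
  filter_upwards [self_mem_nhdsWithin] with k hk
  have key := H1 a τ T e w u S h ((w.dq k).dq k) ((u.dq k).dq k) ((S.dq k).dq k)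
    (fun s => (1 + K2) * diss w u S s) ((h.hw.dq k).dq k) ((h.hu.dq k).dq k) ((h.hS.dq k).dq k)
    (h.continuousOn_diss.const_mul _) (fun s hs x => by simp only [Jet.dq, dq, h.eq1 s hs])
    fun s hs => by
      obtain ⟨l1, l2, l3⟩ := H2 a τ T e w u S h k hk s hs
      have hD := diss_nonneg w u S s
      refine ⟨l1, l2, ?_, ?_⟩
      · have := (le_diss w u S s).2.2.2
        have := h.hw.n2_dq_dq_le hs k
        have := h.hu.n2_dq_dq_le hs k
        have := h.hS.n2_dq_dq_le hs k
        nlinarith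
      · have := mul_nonneg (sq_nonneg e) hD
        linarith
  refine key.trans ?_
  rw [intervalIntegral.integral_const_mul, mul_assoc K1]
  refine mul_le_mul_of_nonneg_left ?_ hK1.le
  have t1 := h.hw.n2_dq_dq_le h0 k
  have t2 := h.hu.n2_dq_dq_le h0 k
  have t3 := mul_le_mul_of_nonneg_left (h.hS.n2_dq_dq_le h0 k) h.hτ.le
  have n1 : 0 ≤ n2 (w.fxx 0) + n2 (u.fxx 0) + τ * n2 (S.fxx 0) :=
    add_nonneg (add_nonneg (n2_nonneg _) (n2_nonneg _)) (mul_nonneg h.hτ.le (n2_nonneg _))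
  have := mul_nonneg hK2.le n1
  have : 0 ≤ e * ∫ s in (0:ℝ)..T, diss w u S s := mul_nonneg h.he.le
    (intervalIntegral.integral_nonneg hT fun s _ => diss_nonneg w u S s)
  linarith

/-- Dissipation of the first space derivatives of `(w, u)`. -/
lemma first_dissipation {μ γ : ℝ} (hμ : 0 < μ) (hγ : 1 < γ) : ∃ K : ℝ, 0 < K ∧
    ∀ (a τ T e : ℝ) (w u S : Jet), Sol a μ γ τ T e w u S →
      ∫ s in (0:ℝ)..T, (n2 (u.fx s) + n2 (w.fx s)) ≤
        K * ((∫ s in (0:ℝ)..T, (n2 (S.f s) + n2 (S.fx s)))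
          + (n2 (w.fx T) + n2 (u.f T) + n2 (u.fx T) + τ * n2 (S.f T))
          + (n2 (w.fx 0) + n2 (u.f 0) + n2 (u.fx 0) + τ * n2 (S.f 0))) := by
  obtain ⟨k, K, hk, hK, hp⟩ := pressure_bounds hγ
  obtain ⟨C, hC, H⟩ := cross_estimate K hk (show 0 < μ / 3 by positivity)
  refine ⟨C, hC, ?_⟩
  intro a τ T e w u S h
  have hz : L2C fun _ : ℝ => (0:ℝ) := ⟨continuous_const, by simp⟩
  have hn : n2 (fun _ : ℝ => (0:ℝ)) = 0 := by simp [n2]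
  have key := H T τ w u S (fun t x => γ * (1 + w.f t x) ^ (-γ - 1))
    (fun t x => (μ + 2 * a * τ * S.f t x) / (1 + w.f t x)) (fun _ _ => 0) (fun _ _ => 0)
    (fun _ => 0) h.hT h.hτ h.hτ1 h.hw h.hu h.hS continuousOn_const
    (fun t _ => ⟨hz, hz, by simp [hn]⟩) fun t ht x =>
      ⟨(hp _ (h.v_mem ht x)).1, (hp _ (h.v_mem ht x)).2.1, (h.viscosity_mem ht x).1,
        h.eq1 t ht x, by rw [h.eq2 t ht x, add_zero], by rw [h.eq3 t ht x, add_zero]⟩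
  simpa only [add_zero] using key

/-- Dissipation of the second space derivatives of `(w, u)`. -/
lemma second_dissipation {μ γ : ℝ} (hμ : 0 < μ) (hγ : 1 < γ) : ∃ K : ℝ, 0 < K ∧
    ∀ (a τ T e : ℝ) (w u S : Jet), Sol a μ γ τ T e w u S →
      ∫ s in (0:ℝ)..T, (n2 (u.fxx s) + n2 (w.fxx s)) ≤
        K * ((∫ s in (0:ℝ)..T, (n2 (S.fx s) + n2 (S.fxx s) + e * diss w u S s))
          + (n2 (w.fxx T) + n2 (u.fx T) + n2 (u.fxx T) + τ * n2 (S.fx T))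
          + (n2 (w.fxx 0) + n2 (u.fx 0) + n2 (u.fxx 0) + τ * n2 (S.fx 0))) := by
  obtain ⟨k, K, hk, hK, hp⟩ := pressure_bounds hγ
  obtain ⟨C, hC, H⟩ := cross_estimate K hk (show 0 < μ / 3 by positivity)
  obtain ⟨K1, hK1, H1⟩ := residuals_one hμ hγ
  refine ⟨C * (1 + 2 * K1), by positivity, ?_⟩
  intro a τ T e w u S h
  have hT := h.hT
  have he := h.he
  have h0 : (0:ℝ) ∈ Icc 0 T := ⟨le_rfl, hT⟩
  have h1 : T ∈ Icc 0 T := ⟨hT, le_rfl⟩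
  have hlim : Tendsto (fun k => ∫ s in (0:ℝ)..T, (n2 ((u.dq k).fx s) + n2 ((w.dq k).fx s)))
      (nhdsWithin 0 (Ioi 0)) (nhds (∫ s in (0:ℝ)..T, (n2 (u.fxx s) + n2 (w.fxx s)))) :=
    tendsto_intervalIntegral_of_le hT
      (fun k => (h.hu.dq k).cx.continuousOn.add (h.hw.dq k).cx.continuousOn)
      (h.hu.cxx.continuousOn.add h.hw.cxx.continuousOn)
      (fun k s => add_nonneg (n2_nonneg _) (n2_nonneg _))
      (fun k s hs => add_le_add (h.hu.n2_dq_fx_le hs k) (h.hw.n2_dq_fx_le hs k))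
      fun s hs => (h.hu.tendsto_dq_fx hs).add (h.hw.tendsto_dq_fx hs)
  refine le_of_tendsto hlim ?_
  filter_upwards [self_mem_nhdsWithin] with k hk
  have key := H T τ (w.dq k) (u.dq k) (S.dq k) (fun t x => γ * (1 + w.f t x) ^ (-γ - 1))
    (fun t x => (μ + 2 * a * τ * S.f t x) / (1 + w.f t x))
    (momentumRes γ w (w.dq k) (u.dq k) (S.dq k)) (stressRes a μ τ w S (u.dq k) (S.dq k))
    (fun s => 2 * K1 * (e * diss w u S s)) hT h.hτ h.hτ1 (h.hw.dq k) (h.hu.dq k) (h.hS.dq k)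
    (continuousOn_const.mul (continuousOn_const.mul h.continuousOn_diss))
    (fun s hs => by
      obtain ⟨l1, l2, l3⟩ := H1 a τ T e w u S h k hk s hs
      refine ⟨l1, l2, l3.trans ?_⟩
      have hle : n2 (w.fx s) + n2 (u.fx s) ≤ 2 * diss w u S s := by
        have := n2_nonneg (w.fxx s)
        have := n2_nonneg (u.fxx s)
        linarith [(le_diss w u S s).1, (le_diss w u S s).2.1]
      have hee : e ^ 2 ≤ e := by nlinarith [h.he1]
      calc K1 * e ^ 2 * (n2 (w.fx s) + n2 (u.fx s)) ≤ K1 * e * (2 * diss w u S s) := by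
            exact mul_le_mul (mul_le_mul_of_nonneg_left hee hK1.le) hle
              (add_nonneg (n2_nonneg _) (n2_nonneg _)) (by positivity)
        _ = _ := by ring)
    fun t ht x => ⟨(hp _ (h.v_mem ht x)).1, (hp _ (h.v_mem ht x)).2.1, (h.viscosity_mem ht x).1,
      by simp only [Jet.dq, dq, h.eq1 t ht], by simp only [momentumRes]; ring,
      by simp only [stressRes]; ring⟩
  refine key.trans ?_
  rw [mul_assoc C]
  refine mul_le_mul_of_nonneg_left ?_ hC.le
  have cI : ∀ {f : ℝ → ℝ}, ContinuousOn f (Icc 0 T) → IntervalIntegrable f volume 0 T := fun hf =>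
    ContinuousOn.intervalIntegrable (by rwa [uIcc_of_le hT])
  have t1 : ∫ s in (0:ℝ)..T, (n2 ((S.dq k).f s) + n2 ((S.dq k).fx s)
      + 2 * K1 * (e * diss w u S s)) ≤ (1 + 2 * K1) *
        ∫ s in (0:ℝ)..T, (n2 (S.fx s) + n2 (S.fxx s) + e * diss w u S s) := by
    rw [← intervalIntegral.integral_const_mul]
    refine intervalIntegral.integral_mono_on hT (cI ?_) (cI ?_) fun s hs => ?_
    · exact ((h.hS.dq k).cf.continuousOn.add (h.hS.dq k).cx.continuousOn).add
        (continuousOn_const.mul (continuousOn_const.mul h.continuousOn_diss))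
    · exact continuousOn_const.mul ((h.hS.cx.continuousOn.add h.hS.cxx.continuousOn).add
        (continuousOn_const.mul h.continuousOn_diss))
    · have := h.hS.n2_dq_f_le hs k
      have := h.hS.n2_dq_fx_le hs k
      have := mul_nonneg he.le (diss_nonneg w u S s)
      have := mul_nonneg hK1.le (add_nonneg (n2_nonneg (S.fx s)) (n2_nonneg (S.fxx s)))
      linarith
  have t2 : ∀ t ∈ Icc 0 T, n2 ((w.dq k).fx t) + n2 ((u.dq k).f t) + n2 ((u.dq k).fx t)
      + τ * n2 ((S.dq k).f t) ≤
      (1 + 2 * K1) * (n2 (w.fxx t) + n2 (u.fx t) + n2 (u.fxx t) + τ * n2 (S.fx t)) :=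
    fun t ht => by
      have m1 := h.hw.n2_dq_fx_le ht k
      have m2 := h.hu.n2_dq_f_le ht k
      have m3 := h.hu.n2_dq_fx_le ht k
      have m4 := mul_le_mul_of_nonneg_left (h.hS.n2_dq_f_le ht k) h.hτ.le
      have := mul_nonneg hK1.le (add_nonneg (add_nonneg (add_nonneg (n2_nonneg (w.fxx t))
        (n2_nonneg (u.fx t))) (n2_nonneg (u.fxx t))) (mul_nonneg h.hτ.le (n2_nonneg (S.fx t))))
      linarith
  linarith [t2 T h1, t2 0 h0]

/-- The instantaneous energy of `(w, u, S)`. -/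
def energy (τ : ℝ) (w u S : Jet) (s : ℝ) : ℝ :=
  (n2 (w.f s) + n2 (u.f s) + τ * n2 (S.f s)) + (n2 (w.fx s) + n2 (u.fx s) + τ * n2 (S.fx s))
    + (n2 (w.fxx s) + n2 (u.fxx s) + τ * n2 (S.fxx s))

/-- The a priori estimate for solutions with small coefficients. -/
lemma a_priori {μ γ : ℝ} (hμ : 0 < μ) (hγ : 1 < γ) : ∃ K : ℝ, 0 < K ∧
    ∀ (a τ T e : ℝ) (w u S : Jet), Sol a μ γ τ T e w u S →
      energy τ w u S T + (∫ s in (0:ℝ)..T, diss w u S s) ≤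
        K * (energy τ w u S 0 + e * ∫ s in (0:ℝ)..T, diss w u S s) := by
  obtain ⟨K1, hK1, H1⟩ := basic_energy hμ hγ
  obtain ⟨K2, hK2, H2⟩ := second_energy hμ hγ
  obtain ⟨K3, hK3, H3⟩ := first_dissipation hμ hγ
  obtain ⟨K4, hK4, H4⟩ := second_dissipation hμ hγ
  set A := K1 + K2 with hA
  refine ⟨2 * A + (K3 + K4) * (2 * A + 1), by positivity, ?_⟩
  intro a τ T e w u S h
  have hT := h.hT
  have he := h.he
  have h0 : (0:ℝ) ∈ Icc 0 T := ⟨le_rfl, hT⟩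
  have h1 : T ∈ Icc 0 T := ⟨hT, le_rfl⟩
  have E1 := H1 a τ T e w u S h
  have E2 := H2 a τ T e w u S h
  have E3 := H3 a τ T e w u S h
  have E4 := H4 a τ T e w u S h
  have iS := h.hS.cf.intervalIntegrable hT
  have iSx := h.hS.cx.intervalIntegrable hT
  have iSxx := h.hS.cxx.intervalIntegrable hT
  have iu := h.hu.cx.intervalIntegrable hT
  have iw := h.hw.cx.intervalIntegrable hT
  have iuu := h.hu.cxx.intervalIntegrable hT
  have iww := h.hw.cxx.intervalIntegrable hT
  have iD : IntervalIntegrable (fun s => diss w u S s) volume 0 T :=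
    ContinuousOn.intervalIntegrable (by rw [uIcc_of_le hT]; exact h.continuousOn_diss)
  have nn : ∀ f : ℝ → ℝ → ℝ, 0 ≤ ∫ s in (0:ℝ)..T, n2 (f s) := fun f =>
    intervalIntegral.integral_nonneg hT fun s _ => n2_nonneg _
  have hD : ∫ s in (0:ℝ)..T, diss w u S s = (∫ s in (0:ℝ)..T, n2 (w.fx s))
      + (∫ s in (0:ℝ)..T, n2 (w.fxx s)) + (∫ s in (0:ℝ)..T, n2 (u.fx s))
      + (∫ s in (0:ℝ)..T, n2 (u.fxx s)) + (∫ s in (0:ℝ)..T, n2 (S.f s))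
      + (∫ s in (0:ℝ)..T, n2 (S.fx s)) + ∫ s in (0:ℝ)..T, n2 (S.fxx s) := by
    simp only [diss]
    rw [intervalIntegral.integral_add (((((iw.add iww).add iu).add iuu).add iS).add iSx) iSxx,
      intervalIntegral.integral_add ((((iw.add iww).add iu).add iuu).add iS) iSx,
      intervalIntegral.integral_add (((iw.add iww).add iu).add iuu) iS,
      intervalIntegral.integral_add ((iw.add iww).add iu) iuu,
      intervalIntegral.integral_add (iw.add iww) iu, intervalIntegral.integral_add iw iww]
  have hSx : ∫ s in (0:ℝ)..T, n2 (S.fx s) ≤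
      (∫ s in (0:ℝ)..T, n2 (S.f s)) + ∫ s in (0:ℝ)..T, n2 (S.fxx s) := by
    rw [← intervalIntegral.integral_add iS iSxx]
    exact intervalIntegral.integral_mono_on hT iSx (iS.add iSxx) fun s hs => h.hS.interpolation hs
  rw [intervalIntegral.integral_add iS iu] at E1
  rw [intervalIntegral.integral_add iu iw, intervalIntegral.integral_add iS iSx] at E3
  rw [intervalIntegral.integral_add iuu iww, intervalIntegral.integral_add (iSx.add iSxx)
    (iD.const_mul e), intervalIntegral.integral_add iSx iSxx,
    intervalIntegral.integral_const_mul] at E4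
  have nw := nn w.fx
  have nww := nn w.fxx
  have nu := nn u.fx
  have nuu := nn u.fxx
  have nS := nn S.f
  have nSx := nn S.fx
  have nSxx := nn S.fxx
  have hτS : ∀ f, 0 ≤ τ * n2 f := fun f => mul_nonneg h.hτ.le (n2_nonneg f)
  have hET : energy τ w u S T ≤ 2 * (n2 (w.f T) + n2 (u.f T) + τ * n2 (S.f T))
      + 2 * (n2 (w.fxx T) + n2 (u.fxx T) + τ * n2 (S.fxx T)) := by
    have := mul_le_mul_of_nonneg_left (h.hS.interpolation h1) h.hτ.le
    unfold energy
    linarith [h.hw.interpolation h1, h.hu.interpolation h1]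
  have hle : ∀ t, n2 (w.f t) + n2 (u.f t) + τ * n2 (S.f t) ≤ energy τ w u S t ∧
      n2 (w.fxx t) + n2 (u.fxx t) + τ * n2 (S.fxx t) ≤ energy τ w u S t ∧
      n2 (w.fx t) + n2 (u.f t) + n2 (u.fx t) + τ * n2 (S.f t) ≤ energy τ w u S t ∧
      n2 (w.fxx t) + n2 (u.fx t) + n2 (u.fxx t) + τ * n2 (S.fx t) ≤ energy τ w u S t := fun t => by
    have := hτS (S.f t)
    have := hτS (S.fx t)
    have := hτS (S.fxx t)
    have := n2_nonneg (w.f t)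
    have := n2_nonneg (w.fx t)
    have := n2_nonneg (w.fxx t)
    have := n2_nonneg (u.f t)
    have := n2_nonneg (u.fx t)
    have := n2_nonneg (u.fxx t)
    unfold energy
    refine ⟨?_, ?_, ?_, ?_⟩ <;> linarith
  set D := ∫ s in (0:ℝ)..T, diss w u S s
  set R := energy τ w u S 0 + e * D with hR
  have E1' := E1.trans (mul_le_mul_of_nonneg_left (add_le_add (hle 0).1
    (mul_le_mul_of_nonneg_left (show _ ≤ D by linarith) he.le)) hK1.le)
  have E2' := E2.trans (mul_le_mul_of_nonneg_left (add_le_add_left (hle 0).2.1 _) hK2.le)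
  have E3' := E3.trans (mul_le_mul_of_nonneg_left (show _ ≤ (2 * A + 1) * R by
    have := mul_nonneg he.le (show 0 ≤ D by linarith)
    linarith [(hle T).2.2.1, (hle 0).2.2.1]) hK3.le)
  have E4' := E4.trans (mul_le_mul_of_nonneg_left (show _ ≤ (2 * A + 1) * R by
    linarith [(hle T).2.2.2, (hle 0).2.2.2]) hK4.le)
  linarith

lemma HSq_one (f : ℝ → ℝ) : HSq 1 f = n2 f + n2 (deriv f) := by
  simp [HSq, Finset.sum_range_succ, iteratedDeriv_succ, n2]

lemma HSq_two (f : ℝ → ℝ) : HSq 2 f = n2 f + n2 (deriv f) + n2 (deriv (deriv f)) := by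
  simp [HSq, Finset.sum_range_succ, iteratedDeriv_succ, n2]

lemma MemH.one {f : ℝ → ℝ} (hf : MemH 1 f) :
    (∀ x, HasDerivAt f (deriv f x) x) ∧ L2C f ∧ L2C (deriv f) := by
  have hc : ContDiff ℝ 1 f := by simpa using hf.1
  have hd : Differentiable ℝ f := hc.differentiable one_ne_zero
  refine ⟨fun x => (hd x).hasDerivAt, ⟨hd.continuous, by simpa using hf.2 0 (by norm_num)⟩,
    hc.continuous_deriv_one, by simpa [iteratedDeriv_succ] using hf.2 1 (by norm_num)⟩

lemma MemH.two {f : ℝ → ℝ} (hf : MemH 2 f) :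
    MemH 1 f ∧ MemH 1 (deriv f) := by
  have hc : ContDiff ℝ 2 f := by simpa using hf.1
  have hc1 : ContDiff ℝ 1 (deriv f) := by
    have : ContDiff ℝ (1 + 1) f := by rwa [one_add_one_eq_two]
    exact (contDiff_succ_iff_deriv.1 this).2.2
  refine ⟨⟨by simpa using hc.of_le (by norm_num), fun j hj => hf.2 j (by omega)⟩,
    by simpa using hc1, fun j hj => ?_⟩
  have := hf.2 (j + 1) (by omega)
  simpa only [iteratedDeriv_succ'] using this

/-- The jet of a function of `(t, x)`. -/
def jetOf (f : ℝ → ℝ → ℝ) : Jet := ⟨f, pt f, px f, fun t => deriv (px f t)⟩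

lemma CL2.of_le {I : Set ℝ} {f : ℝ → ℝ → ℝ} {q : ℝ → ℝ → ℝ} (hf : ∀ t ∈ I, L2C (f t))
    (hq : ∀ s ∈ I, Tendsto (fun t => q t s) (nhdsWithin s I) (nhds 0))
    (hle : ∀ t ∈ I, ∀ s ∈ I, n2 (fun x => f t x - f s x) ≤ q t s) : CL2 I f := by
  refine ⟨hf, fun s hs => squeeze_zero' (Eventually.of_forall fun _ => n2_nonneg _) ?_ (hq s hs)⟩
  filter_upwards [self_mem_nhdsWithin] with t ht
  exact hle t ht s hs

lemma ContH.one {I : Set ℝ} {f : ℝ → ℝ → ℝ} (hm : ∀ t ∈ I, MemH 1 (f t)) (hc : ContH 1 I f) :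
    CL2 I f ∧ CL2 I (px f) := by
  have e : ∀ t ∈ I, ∀ s ∈ I, deriv (fun x => f t x - f s x) = fun x => px f t x - px f s x :=
    fun t ht s hs => funext fun x => (((hm t ht).one.1 x).sub ((hm s hs).one.1 x)).deriv
  refine ⟨CL2.of_le (fun t ht => (hm t ht).one.2.1) hc fun t ht s hs => ?_,
    CL2.of_le (fun t ht => (hm t ht).one.2.2) hc fun t ht s hs => ?_⟩ <;>
  · rw [HSq_one, e t ht s hs]
    have := n2_nonneg fun x => px f t x - px f s x
    have := n2_nonneg fun x => f t x - f s x
    linarith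

lemma ContH.two {I : Set ℝ} {f : ℝ → ℝ → ℝ} (hm : ∀ t ∈ I, MemH 2 (f t)) (hc : ContH 2 I f) :
    ContH 1 I f ∧ ContH 1 I (px f) := by
  have e : ∀ t ∈ I, ∀ s ∈ I, deriv (fun x => f t x - f s x) = fun x => px f t x - px f s x :=
    fun t ht s hs => funext fun x =>
      (((hm t ht).two.1.one.1 x).sub ((hm s hs).two.1.one.1 x)).deriv
  have hn : ∀ g : ℝ → ℝ, 0 ≤ HSq 1 g := fun g => by
    rw [HSq_one]; exact add_nonneg (n2_nonneg _) (n2_nonneg _)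
  constructor <;> intro s hs <;>
    refine squeeze_zero' (Eventually.of_forall fun _ => hn _) ?_ (hc s hs) <;>
    filter_upwards [self_mem_nhdsWithin] with t ht <;>
    rw [HSq_one, HSq_two, e t ht s hs]
  · linarith [n2_nonneg (deriv fun x => px f t x - px f s x)]
  · linarith [n2_nonneg fun x => f t x - f s x]

lemma RegH.reg {T : ℝ} {f : ℝ → ℝ → ℝ} (hf : RegH 2 (Icc 0 T) f) : Reg (Icc 0 T) (jetOf f) := by
  obtain ⟨hm, hc, hd, hmt, hct⟩ := hf
  have c1 := ContH.one (fun t ht => (hm t ht).two.1) (ContH.two hm hc).1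
  have c2 := ContH.one (f := px f) (fun t ht => (hm t ht).two.2) (ContH.two hm hc).2
  have ct := ContH.one (f := pt f) hmt hct
  have dx : ∀ t ∈ Icc 0 T, ∀ x, HasDerivAt (f t) (px f t x) x := fun t ht =>
    (hm t ht).two.1.one.1
  exact
    { dt := fun t ht x => (hd x t ht).hasDerivAt
      dx := dx
      dxx := fun t ht => (hm t ht).two.2.one.1
      cf := c1.1
      cx := c1.2
      cxx := c2.2
      ct := ct.1
      jf := JC.of_CL2 dx c1.1 c1.2
      jt := JC.of_CL2 (fun t ht => (MemH.one (hmt t ht)).1) ct.1 ct.2 }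

lemma energy_bounds {I : Set ℝ} {τ e : ℝ} {w u S : Jet} (hτ : 0 < τ) (hτ1 : τ ≤ 1) (he : 0 < e)
    (hw : Reg I w) (hu : Reg I u) (hS : Reg I S) {s : ℝ} (hs : s ∈ I)
    (hE : energy τ w u S s ≤ e ^ 2) (x : ℝ) :
    |w.f s x| ≤ e ∧ |w.fx s x| ≤ e ∧ |u.fx s x| ≤ e ∧ |τ * S.f s x| ≤ e ∧ |τ * S.fx s x| ≤ e := by
  have h0 := n2_nonneg (w.f s)
  have h1 := n2_nonneg (w.fx s)
  have h2 := n2_nonneg (w.fxx s)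
  have h3 := n2_nonneg (u.f s)
  have h4 := n2_nonneg (u.fx s)
  have h5 := n2_nonneg (u.fxx s)
  have h6 := mul_nonneg hτ.le (n2_nonneg (S.f s))
  have h7 := mul_nonneg hτ.le (n2_nonneg (S.fx s))
  have h8 := mul_nonneg hτ.le (n2_nonneg (S.fxx s))
  have scale : ∀ {y c : ℝ}, y ^ 2 ≤ c → (τ * y) ^ 2 ≤ τ * c := fun {y c} hy => by
    have t1 := mul_le_mul_of_nonneg_left hy hτ.le
    have t2 := mul_le_mul_of_nonneg_right hτ1 (mul_nonneg hτ.le (sq_nonneg y))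
    nlinarith
  have b1 := sq_le_n2_add_n2 (hw.dx s hs) (hw.cf.1 s hs) (hw.cx.1 s hs) x
  have b2 := sq_le_n2_add_n2 (hw.dxx s hs) (hw.cx.1 s hs) (hw.cxx.1 s hs) x
  have b3 := sq_le_n2_add_n2 (hu.dxx s hs) (hu.cx.1 s hs) (hu.cxx.1 s hs) x
  have b4 := scale (sq_le_n2_add_n2 (hS.dx s hs) (hS.cf.1 s hs) (hS.cx.1 s hs) x)
  have b5 := scale (sq_le_n2_add_n2 (hS.dxx s hs) (hS.cx.1 s hs) (hS.cxx.1 s hs) x)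
  unfold energy at hE
  refine ⟨?_, ?_, ?_, ?_, ?_⟩ <;> refine abs_le_of_sq_le_sq (h := ?_) he.le <;> linarith

lemma energy_nonneg {τ : ℝ} (hτ : 0 ≤ τ) (w u S : Jet) (s : ℝ) : 0 ≤ energy τ w u S s := by
  have h0 := n2_nonneg (w.f s)
  have h1 := n2_nonneg (w.fx s)
  have h2 := n2_nonneg (w.fxx s)
  have h3 := n2_nonneg (u.f s)
  have h4 := n2_nonneg (u.fx s)
  have h5 := n2_nonneg (u.fxx s)
  have h6 := n2_nonneg (S.f s)
  have h7 := n2_nonneg (S.fx s)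
  have h8 := n2_nonneg (S.fxx s)
  unfold energy
  positivity

lemma continuousOn_energy {I : Set ℝ} {τ : ℝ} {w u S : Jet} (hw : Reg I w) (hu : Reg I u)
    (hS : Reg I S) : ContinuousOn (energy τ w u S) I :=
  (((hw.cf.continuousOn.add hu.cf.continuousOn).add (hS.cf.continuousOn.const_mul _)).add
    ((hw.cx.continuousOn.add hu.cx.continuousOn).add (hS.cx.continuousOn.const_mul _))).add
      ((hw.cxx.continuousOn.add hu.cxx.continuousOn).add (hS.cxx.continuousOn.const_mul _))

lemma energy_jetOf (τ : ℝ) (v u S : ℝ → ℝ → ℝ) (s : ℝ) :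
    energy τ (jetOf fun t x => v t x - 1) (jetOf u) (jetOf S) s =
      HSq 2 (fun x => v s x - 1) + HSq 2 (u s) + τ * HSq 2 (S s) := by
  have e : ∀ f, px f s = deriv (f s) := fun _ => rfl
  simp only [HSq_two, energy, jetOf, e]
  ring

lemma px_sub_one (v : ℝ → ℝ → ℝ) : px (fun t x => v t x - 1) = px v := by
  funext t x
  simp [px, deriv_sub_const]

lemma pt_sub_one (v : ℝ → ℝ → ℝ) : pt (fun t x => v t x - 1) = pt v := by
  funext t x
  simp [pt, deriv_sub_const]

lemma diss_jetOf (v u S : ℝ → ℝ → ℝ) (s : ℝ) :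
    diss (jetOf fun t x => v t x - 1) (jetOf u) (jetOf S) s = Dn v u S s := by
  simp only [diss, jetOf, Dn, HSq_one, HSq_two, px_sub_one]
  change _ = n2 (px v s) + n2 (deriv (px v s)) + (n2 (px u s) + n2 (deriv (px u s)))
    + (n2 (S s) + n2 (px S s) + n2 (deriv (px S s)))
  ring

lemma IsSolOn.sol {a μ γ τ T e : ℝ} {v u S : ℝ → ℝ → ℝ} (h : IsSolOn a μ γ τ T v u S)
    (ha : a ∈ Icc (-1 : ℝ) 1) (hμ : 0 < μ) (hτ : 0 < τ) (hτ1 : τ ≤ 1) (he : 0 < e)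
    (he1 : e ≤ 1 / 2) (heμ : e ≤ μ / 4) {t : ℝ} (ht : 0 ≤ t) (htT : t ≤ T)
    (hE : ∀ s ∈ Icc 0 t, energy τ (jetOf fun t x => v t x - 1) (jetOf u) (jetOf S) s ≤ e ^ 2) :
    Sol a μ γ τ t e (jetOf fun t x => v t x - 1) (jetOf u) (jetOf S) := by
  obtain ⟨hsys, rv, ru, rS⟩ := h
  have hsub : Icc 0 t ⊆ Icc 0 T := Icc_subset_Icc_right htT
  have hw := rv.reg.mono hsub
  have hu := ru.reg.mono hsub
  have hS := rS.reg.mono hsub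
  have hb := fun s hs => energy_bounds hτ hτ1 he hw hu hS hs (hE s hs)
  have e1 : ∀ s x, 1 + (v s x - 1) = v s x := fun s x => by ring
  exact
    { hμ := hμ
      ha := abs_le.2 ha
      hτ := hτ
      hτ1 := hτ1
      hT := ht
      he := he
      he1 := he1
      heμ := heμ
      hw := hw
      hu := hu
      hS := hS
      eq1 := fun s hs x => by
        simp only [jetOf, pt_sub_one]
        exact (hsys s (hsub hs) x).2.2.1
      eq2 := fun s hs x => by
        obtain ⟨hv, -, -, h2, -⟩ := hsys s (hsub hs) x
        have hd : HasDerivAt (v s) (px v s x) x := by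
          have := (hw.dx s hs x).add_const 1
          simpa only [jetOf, px_sub_one, sub_add_cancel] using this
        have hd2 := hd.rpow_const (p := -γ) (Or.inl hv.ne')
        rw [hd2.deriv] at h2
        simp only [jetOf, px_sub_one, e1]
        linarith
      eq3 := fun s hs x => by
        obtain ⟨hv, -, -, -, h3⟩ := hsys s (hsub hs) x
        simp only [jetOf, e1]
        have e2 : (μ + 2 * a * τ * S s x) / v s x * px u s x =
          μ * px u s x / v s x + τ * (2 * a * S s x / v s x * px u s x) := by ring
        rw [e2]
        linarith
      bw := fun s hs x => (hb s hs x).1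
      bwx := fun s hs x => (hb s hs x).2.1
      bux := fun s hs x => (hb s hs x).2.2.1
      bS := fun s hs x => (hb s hs x).2.2.2.1
      bSx := fun s hs x => (hb s hs x).2.2.2.2 }

/-- Proposition 2.2: uniform a priori estimate. Fix `a ∈ [-1,1]`, `μ > 0`, `γ > 1`.
There are constants `δ, C > 0`, independent of `T`, of the initial data and of `τ`,
such that for every `τ ∈ (0, min 1 μ²)` and every solution of the relaxed system on
`[0,T] × ℝ` in the class `C⁰([0,T];H²) ∩ C¹([0,T];H¹)` with `v > 0`, `2τaS + μ > 0`
and `E(T) < δ`, one has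
`E(t) + ∫₀ᵗ D(s) ds ≤ C (E₀ + E(t)^{1/2} ∫₀ᵗ D(s) ds)` for all `t ∈ (0,T)`. -/
theorem uniform_a_priori_estimate
    (a μ γ : ℝ) (ha : a ∈ Icc (-1 : ℝ) 1) (hμ : 0 < μ) (hγ : 1 < γ) :
    ∃ δ > (0 : ℝ), ∃ C > (0 : ℝ),
      ∀ τ ∈ Ioo (0 : ℝ) (min 1 (μ ^ 2)), ∀ T > (0 : ℝ), ∀ v u S : ℝ → ℝ → ℝ,
        IsSolOn a μ γ τ T v u S →
        En τ v u S T < δ →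
        ∀ t ∈ Ioo (0 : ℝ) T,
          En τ v u S t + ∫ s in (0:ℝ)..t, Dn v u S s ≤
            C * (En τ v u S 0 + Real.sqrt (En τ v u S t) * ∫ s in (0:ℝ)..t, Dn v u S s) := by
  obtain ⟨K, hK, H⟩ := a_priori hμ hγ
  set b := min (1 / 2) (μ / 4) with hb
  have hb0 : 0 < b := by positivity
  refine ⟨b ^ 2, by positivity, 2 * K, by positivity, ?_⟩
  rintro τ ⟨hτ, hτm⟩ T hT v u S hsol hδ t ⟨ht0, htT⟩
  have hτ1 : τ ≤ 1 := hτm.le.trans (min_le_left _ _)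
  set E := energy τ (jetOf fun t x => v t x - 1) (jetOf u) (jetOf S) with hE
  have hEn : ∀ r, En τ v u S r = sSup (E '' Icc 0 r) := fun r => by
    simp only [En, hE, ← energy_jetOf]
  have hbdd : BddAbove (E '' Icc 0 T) := (isCompact_Icc.image_of_continuousOn
    (continuousOn_energy hsol.2.1.reg hsol.2.2.1.reg hsol.2.2.2.reg)).bddAbove
  have hsub : E '' Icc 0 t ⊆ E '' Icc 0 T := image_mono (Icc_subset_Icc_right htT.le)
  have hne : (E '' Icc 0 t).Nonempty := ⟨_, mem_image_of_mem _ ⟨le_rfl, ht0.le⟩⟩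
  have hle : ∀ s ∈ Icc 0 t, E s ≤ En τ v u S t := fun s hs => by
    rw [hEn]
    exact le_csSup (hbdd.mono hsub) (mem_image_of_mem _ hs)
  have hnn : ∀ s, 0 ≤ E s := fun s => energy_nonneg hτ.le _ _ _ _
  have ht_nn : 0 ≤ En τ v u S t := (hnn 0).trans (hle 0 ⟨le_rfl, ht0.le⟩)
  have hlt : √(En τ v u S t) < b := by
    rw [Real.sqrt_lt' hb0]
    refine lt_of_le_of_lt ?_ hδ
    rw [hEn, hEn]
    exact csSup_le_csSup hbdd hne hsub
  have h0 : En τ v u S 0 = E 0 := by simp [hEn]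
  simp only [← diss_jetOf]
  set I := ∫ s in (0:ℝ)..t, diss (jetOf fun t x => v t x - 1) (jetOf u) (jetOf S) s with hI
  have hlim : Tendsto (fun e => 2 * K * (En τ v u S 0 + e * I))
      (nhdsWithin (√(En τ v u S t)) (Ioi √(En τ v u S t)))
      (nhds (2 * K * (En τ v u S 0 + √(En τ v u S t) * I))) :=
    ((continuous_const.mul (continuous_const.add (continuous_id.mul
      continuous_const))).tendsto _).mono_left nhdsWithin_le_nhds
  refine ge_of_tendsto hlim ?_
  filter_upwards [Ioo_mem_nhdsGT hlt] with e he
  have he0 : 0 < e := (Real.sqrt_nonneg _).trans_lt he.1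
  have hEe : En τ v u S t ≤ e ^ 2 := (Real.sqrt_le_left he0.le).1 he.1.le
  have sol := hsol.sol ha hμ hτ hτ1 he0 (he.2.le.trans (min_le_left _ _))
    (he.2.le.trans (min_le_right _ _)) ht0.le htT.le fun s hs => (hle s hs).trans hEe
  have key : ∀ s ∈ Icc 0 t, E s ≤ K * (E 0 + e * I) := fun s hs => by
    have hs' := H a τ s e _ _ _ (sol.mono hs.1 hs.2)
    have n1 := intervalIntegral.integral_nonneg (μ := volume) hs.1 fun r _ =>
      diss_nonneg (jetOf fun t x => v t x - 1) (jetOf u) (jetOf S) r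
    have m1 : ∫ r in (0:ℝ)..s, diss (jetOf fun t x => v t x - 1) (jetOf u) (jetOf S) r ≤ I :=
      intervalIntegral.integral_mono_interval le_rfl hs.1 hs.2
        (Eventually.of_forall fun r => diss_nonneg _ _ _ r)
        (ContinuousOn.intervalIntegrable (by rw [uIcc_of_le ht0.le]; exact sol.continuousOn_diss))
    have m2 := mul_le_mul_of_nonneg_left (add_le_add_right (mul_le_mul_of_nonneg_left m1 he0.le)
      (E 0)) hK.le
    linarith
  have k1 : En τ v u S t ≤ K * (E 0 + e * I) := by
    rw [hEn]
    refine csSup_le hne ?_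
    rintro _ ⟨s, hs, rfl⟩
    exact key s hs
  have k2 := H a τ t e _ _ _ sol
  rw [h0]
  linarith [hnn t]
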